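/- Let N ≥ 2 and let O ⊂ ℝ^{N+1} be a bounded open set. If for every point (x,t) of the parabolic boundary ∂_pO one has ∫_0^1 PH_1^N( O^c ∩ ( B_{ρ/30}(x) × (t−30ρ², t−ρ²) ) ) ρ^{−N} (dρ/ρ) = ∞, then the equation ∂_t u − Δu + e^u − 1 = 0 admits a large solution in O. -/

import Mathlib

open MeasureTheory Metric Set
open scoped ENNReal NNReal

noncomputable section

/-- Points of `ℝ^{N+1}` are written `(x, t)` with `x ∈ ℝ^N` and `t ∈ ℝ`. -/
abbrev PSpace (N : ℕ) := EuclideanSpace ℝ (Fin N) × ℝ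

/-- The parabolic cylinder `Q_δ(x,t) = B_δ(x) × (t - δ², t]`. -/
def pQ (N : ℕ) (δ : ℝ) (z : PSpace N) : Set (PSpace N) :=
  ball z.1 δ ×ˢ Ioc (z.2 - δ ^ 2) z.2

/-- The parabolic cylinder `Q̃_r(x,t) = B_r(x) × (t - r², t + r²)`. -/
def pQt (N : ℕ) (r : ℝ) (z : PSpace N) : Set (PSpace N) :=
  ball z.1 r ×ˢ Ioo (z.2 - r ^ 2) (z.2 + r ^ 2)

/-- The parabolic boundary of an open set `O ⊆ ℝ^{N+1}`: points of the topological
boundary such that every downward cylinder `Q_δ` meets the complement of `O`. -/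
def pBoundary (N : ℕ) (O : Set (PSpace N)) : Set (PSpace N) :=
  {z ∈ frontier O | ∀ δ > 0, (pQ N δ z ∩ Oᶜ).Nonempty}

/-- Partial derivative in time. -/
def tDeriv {N : ℕ} (u : PSpace N → ℝ) (z : PSpace N) : ℝ :=
  deriv (fun s => u (z.1, s)) z.2

/-- Partial derivative in the `i`-th spatial direction. -/
def xDeriv {N : ℕ} (i : Fin N) (u : PSpace N → ℝ) (z : PSpace N) : ℝ :=
  lineDeriv ℝ (fun y => u (y, z.2)) z.1 (EuclideanSpace.single i 1)

/-- Second spatial partial derivative. -/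
def xxDeriv {N : ℕ} (i j : Fin N) (u : PSpace N → ℝ) (z : PSpace N) : ℝ :=
  xDeriv i (xDeriv j u) z

/-- Spatial Laplacian. -/
def lapl {N : ℕ} (u : PSpace N → ℝ) (z : PSpace N) : ℝ :=
  ∑ i : Fin N, xxDeriv i i u z

/-- Euclidean norm of the spatial gradient. -/
def gradNorm {N : ℕ} (u : PSpace N → ℝ) (z : PSpace N) : ℝ :=
  Real.sqrt (∑ i : Fin N, (xDeriv i u z) ^ 2)

/-- `u ∈ C^{2,1}(O)` : `u`, its first and second spatial derivatives and its time
derivative exist and are continuous in `O`. -/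
structure IsC21 {N : ℕ} (O : Set (PSpace N)) (u : PSpace N → ℝ) : Prop where
  cont : ContinuousOn u O
  diff_t : ∀ z ∈ O, DifferentiableAt ℝ (fun s => u (z.1, s)) z.2
  cont_t : ContinuousOn (tDeriv u) O
  diff_x : ∀ (i : Fin N), ∀ z ∈ O,
    LineDifferentiableAt ℝ (fun y => u (y, z.2)) z.1 (EuclideanSpace.single i 1)
  cont_x : ∀ i : Fin N, ContinuousOn (xDeriv i u) O
  diff_xx : ∀ (i j : Fin N), ∀ z ∈ O,
    LineDifferentiableAt ℝ (fun y => xDeriv j u (y, z.2)) z.1 (EuclideanSpace.single i 1)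
  cont_xx : ∀ i j : Fin N, ContinuousOn (xxDeriv i j u) O

/-- The blow-up condition `lim_{δ→0} inf_{O ∩ Q_δ(z)} u = ∞` at every point of the
parabolic boundary. -/
def BlowsUp {N : ℕ} (O : Set (PSpace N)) (u : PSpace N → ℝ) : Prop :=
  ∀ z ∈ pBoundary N O, ∀ M : ℝ, ∃ δ > (0 : ℝ), ∀ w ∈ O ∩ pQ N δ z, M ≤ u w

/-- A large solution of `∂_t u - Δu + f(u) = 0` in `O`. -/
def IsLargeSolution {N : ℕ} (O : Set (PSpace N)) (f : ℝ → ℝ) (u : PSpace N → ℝ) : Prop :=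
  IsC21 O u ∧ (∀ z ∈ O, tDeriv u z - lapl u z + f (u z) = 0) ∧ BlowsUp O u

/-- The parabolic Sobolev norm `‖φ‖_{W^{2,1}_p(ℝ^{N+1})}`. -/
def W21Norm (N : ℕ) (p : ℝ) (φ : PSpace N → ℝ) : ℝ :=
  (eLpNorm φ (ENNReal.ofReal p) volume).toReal
    + (eLpNorm (tDeriv φ) (ENNReal.ofReal p) volume).toReal
    + (eLpNorm (gradNorm φ) (ENNReal.ofReal p) volume).toReal
    + ∑ i : Fin N, ∑ j : Fin N, (eLpNorm (xxDeriv i j φ) (ENNReal.ofReal p) volume).toReal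

/-- The capacity `Cap_{2,1,p}` of a compact set `K ⊆ ℝ^{N+1}`. -/
def cap21c (N : ℕ) (p : ℝ) (K : Set (PSpace N)) : ℝ :=
  sInf { c | ∃ φ : SchwartzMap (PSpace N) ℝ,
    (∃ U, IsOpen U ∧ K ⊆ U ∧ ∀ z ∈ U, 1 ≤ φ z) ∧ c = W21Norm N p (fun z => φ z) ^ p }

/-- The capacity `Cap_{2,1,p}` of an arbitrary (Suslin) set. -/
def cap21 (N : ℕ) (p : ℝ) (E : Set (PSpace N)) : ℝ :=
  sSup { c | ∃ D, D ⊆ E ∧ IsCompact D ∧ c = cap21c N p D }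

/-- The parabolic Hausdorff capacity `PH_ρ^N(E)`. -/
def PHcap (N : ℕ) (ρ : ℝ) (E : Set (PSpace N)) : ℝ≥0∞ :=
  ⨅ (c : ℕ → PSpace N × ℝ)
    (_ : (∀ j, 0 ≤ (c j).2 ∧ (c j).2 ≤ ρ) ∧ E ⊆ ⋃ j, pQt N (c j).2 (c j).1),
    ∑' j, ENNReal.ofReal ((c j).2 ^ N)

/-- The truncated Riesz parabolic potential `I_2^R[μ]`. -/
def riesz (N : ℕ) (R : ℝ) (μ : Measure (PSpace N)) (z : PSpace N) : ℝ≥0∞ :=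
  ∫⁻ ρ in Ioo (0 : ℝ) R, μ (pQt N ρ z) / ENNReal.ofReal (ρ ^ (N + 1))

/-- The truncated fractional maximal parabolic potential `M_2^R[μ]`. -/
def maxPot (N : ℕ) (R : ℝ) (μ : Measure (PSpace N)) (z : PSpace N) : ℝ≥0∞ :=
  ⨆ (ρ : ℝ) (_ : ρ ∈ Ioo (0 : ℝ) R), μ (pQt N ρ z) / ENNReal.ofReal (ρ ^ N)

/-- The Gaussian heat kernel on `ℝ^{N+1}`. -/
def heatK (N : ℕ) (z : PSpace N) : ℝ :=
  if 0 < z.2 then (4 * Real.pi * z.2) ^ (-(N : ℝ) / 2) * Real.exp (-‖z.1‖ ^ 2 / (4 * z.2))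
  else 0

/-- The heat potential `(ℍ * μ)(x,t)` of a nonnegative measure. -/
def heatPot (N : ℕ) (μ : Measure (PSpace N)) (z : PSpace N) : ℝ≥0∞ :=
  ∫⁻ w, ENNReal.ofReal (heatK N (z.1 - w.1, z.2 - w.2)) ∂μ

/-- Exponential on `ℝ≥0∞`. -/
def expE (x : ℝ≥0∞) : ℝ≥0∞ := if x = ⊤ then ⊤ else ENNReal.ofReal (Real.exp x.toReal)

/-- Parabolic distance from a point to a set (taken over points at earlier times). -/
def pDist (N : ℕ) (z : PSpace N) (S : Set (PSpace N)) : ℝ :=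
  sInf { r | ∃ w ∈ S, w.2 ≤ z.2 ∧ r = max (dist z.1 w.1) (Real.sqrt (z.2 - w.2)) }

end

section LargeSolution

variable {N : ℕ}

instance pspace_isAddHaar : (volume : Measure (PSpace N)).IsAddHaarMeasure := by
  rw [Measure.volume_eq_prod]; infer_instance

lemma heatK_nonneg (z : PSpace N) : 0 ≤ heatK N z := by
  unfold heatK
  split_ifs with h
  · positivity
  · exact le_rfl

lemma heatK_of_pos {y : EuclideanSpace ℝ (Fin N)} {s : ℝ} (hs : 0 < s) :
    heatK N (y, s) = (4 * Real.pi * s) ^ (-(N : ℝ) / 2) * Real.exp (-‖y‖ ^ 2 / (4 * s)) := by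
  simp [heatK, hs]

lemma heatK_of_nonpos {z : PSpace N} (hs : z.2 ≤ 0) : heatK N z = 0 := by
  simp [heatK, not_lt.2 hs]

lemma measurable_heatK : Measurable (heatK N) := by
  unfold heatK
  refine Measurable.ite (measurableSet_lt measurable_const measurable_snd) ?_ measurable_const
  fun_prop

lemma integral_heatK {s : ℝ} (hs : 0 < s) :
    ∫ y : EuclideanSpace ℝ (Fin N), heatK N (y, s) = 1 := by
  simp_rw [heatK_of_pos hs]
  rw [integral_const_mul]
  have h := GaussianFourier.integral_rexp_neg_mul_sq_norm
    (V := EuclideanSpace ℝ (Fin N)) (b := 1 / (4 * s)) (by positivity)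
  have e : (fun y : EuclideanSpace ℝ (Fin N) => Real.exp (-‖y‖ ^ 2 / (4 * s)))
      = fun y => Real.exp (-(1 / (4 * s)) * ‖y‖ ^ 2) := by
    ext y; congr 1; ring
  rw [e, h, finrank_euclideanSpace_fin]
  have : Real.pi / (1 / (4 * s)) = 4 * Real.pi * s := by field_simp
  rw [this, ← Real.rpow_add (by positivity)]
  rw [show -(N : ℝ) / 2 + N / 2 = 0 by ring, Real.rpow_zero]

lemma integrable_heatK {s : ℝ} (hs : 0 < s) :
    Integrable (fun y : EuclideanSpace ℝ (Fin N) => heatK N (y, s)) := by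
  by_contra h
  have := integral_heatK (N := N) hs
  rw [integral_undef h] at this
  norm_num at this

lemma lintegral_heatK {s : ℝ} (hs : 0 < s) :
    ∫⁻ y : EuclideanSpace ℝ (Fin N), ENNReal.ofReal (heatK N (y, s)) = 1 := by
  rw [← ofReal_integral_eq_lintegral_ofReal (integrable_heatK hs)
    (Filter.Eventually.of_forall fun y => heatK_nonneg _), integral_heatK hs, ENNReal.ofReal_one]

/-- Completing the square in the product of two Gaussian kernels. -/
lemma heatK_mul_heatK (y x : EuclideanSpace ℝ (Fin N)) {s r : ℝ} (hs : 0 < s) (hr : 0 < r) :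
    heatK N (y - x, s) * heatK N (x, r)
      = heatK N (y, s + r) * heatK N (x - (r / (s + r)) • y, s * r / (s + r)) := by
  rw [heatK_of_pos hs, heatK_of_pos hr, heatK_of_pos (by positivity), heatK_of_pos (by positivity)]
  have h1 : (4 * Real.pi * s) ^ (-(N : ℝ) / 2) * (4 * Real.pi * r) ^ (-(N : ℝ) / 2)
      = (4 * Real.pi * (s + r)) ^ (-(N : ℝ) / 2)
        * (4 * Real.pi * (s * r / (s + r))) ^ (-(N : ℝ) / 2) := by
    rw [← Real.mul_rpow (by positivity) (by positivity),
      ← Real.mul_rpow (by positivity) (by positivity)]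
    congr 1
    field_simp
  have h2 : Real.exp (-‖y - x‖ ^ 2 / (4 * s)) * Real.exp (-‖x‖ ^ 2 / (4 * r))
      = Real.exp (-‖y‖ ^ 2 / (4 * (s + r)))
        * Real.exp (-‖x - (r / (s + r)) • y‖ ^ 2 / (4 * (s * r / (s + r)))) := by
    rw [← Real.exp_add, ← Real.exp_add]
    congr 1
    rw [norm_sub_sq_real, norm_sub_sq_real, norm_smul, inner_smul_right, real_inner_comm x y,
      Real.norm_of_nonneg (by positivity)]
    field_simp
    ring
  calc _ = ((4 * Real.pi * s) ^ (-(N : ℝ) / 2) * (4 * Real.pi * r) ^ (-(N : ℝ) / 2)) *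
      (Real.exp (-‖y - x‖ ^ 2 / (4 * s)) * Real.exp (-‖x‖ ^ 2 / (4 * r))) := by ring
    _ = _ := by rw [h1, h2]; ring

lemma lintegral_heatK_conv {s r : ℝ} (hs : 0 < s) (hr : 0 < r)
    {g : EuclideanSpace ℝ (Fin N) → ℝ≥0∞} (hg : Measurable g) :
    ∫⁻ x, ENNReal.ofReal (heatK N (x, r)) *
        ∫⁻ y, ENNReal.ofReal (heatK N (y, s)) * g (x + y)
      = ∫⁻ y, ENNReal.ofReal (heatK N (y, s + r)) * g y := by
  have hm : ∀ s, Measurable fun y : EuclideanSpace ℝ (Fin N) => ENNReal.ofReal (heatK N (y, s)) :=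
    fun s => (measurable_heatK.comp (by fun_prop)).ennreal_ofReal
  have hm2 : Measurable fun p : EuclideanSpace ℝ (Fin N) × EuclideanSpace ℝ (Fin N) =>
      ENNReal.ofReal (heatK N (p.2 - p.1, s)) :=
    (measurable_heatK.comp (by fun_prop)).ennreal_ofReal
  have h1 : ∀ x, ∫⁻ y, ENNReal.ofReal (heatK N (y, s)) * g (x + y)
      = ∫⁻ y, ENNReal.ofReal (heatK N (y - x, s)) * g y := fun x => by
    rw [← lintegral_add_left_eq_self (fun y => ENNReal.ofReal (heatK N (y - x, s)) * g y) x]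
    simp
  simp_rw [h1]
  have h2 : ∀ x, ENNReal.ofReal (heatK N (x, r)) *
        ∫⁻ y, ENNReal.ofReal (heatK N (y - x, s)) * g y
      = ∫⁻ y, ENNReal.ofReal (heatK N (y, s + r)) * g y *
          ENNReal.ofReal (heatK N (x - (r / (s + r)) • y, s * r / (s + r))) := fun x => by
    rw [← lintegral_const_mul]
    · congr 1 with y
      rw [← mul_assoc, ← ENNReal.ofReal_mul (heatK_nonneg _), mul_comm (heatK N (x, r)),
        heatK_mul_heatK y x hs hr, ENNReal.ofReal_mul (heatK_nonneg _)]
      ring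
    · exact (hm2.comp (measurable_const.prodMk measurable_id)).mul hg
  simp_rw [h2]
  rw [lintegral_lintegral_swap]
  · congr 1 with y
    rw [lintegral_const_mul]
    · rw [lintegral_sub_right_eq_self (fun x => ENNReal.ofReal (heatK N (x, s * r / (s + r)))),
        lintegral_heatK (by positivity), mul_one]
    · exact (measurable_heatK.comp (by fun_prop)).ennreal_ofReal
  · apply Measurable.aemeasurable
    refine Measurable.mul (Measurable.mul ?_ ?_) ?_
    · exact (hm _).comp measurable_snd
    · exact hg.comp measurable_snd
    · exact (measurable_heatK.comp (by fun_prop)).ennreal_ofReal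

/-- The measure with density `w(t) H(x,t)` with respect to Lebesgue measure. -/
noncomputable def heatMeas (N : ℕ) (w : ℝ → ℝ≥0∞) : Measure (PSpace N) :=
  volume.withDensity fun z => w z.2 * ENNReal.ofReal (heatK N z)

lemma measurable_heatDens {w : ℝ → ℝ≥0∞} (hw : Measurable w) :
    Measurable fun z : PSpace N => w z.2 * ENNReal.ofReal (heatK N z) :=
  (hw.comp measurable_snd).mul measurable_heatK.ennreal_ofReal

lemma lintegral_heatMeas {w : ℝ → ℝ≥0∞} (hw : Measurable w) {G : PSpace N → ℝ≥0∞}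
    (hG : Measurable G) :
    ∫⁻ z, G z ∂heatMeas N w
      = ∫⁻ s in Ioi 0, w s * ∫⁻ y, ENNReal.ofReal (heatK N (y, s)) * G (y, s) := by
  have hm : Measurable fun z : PSpace N => w z.2 * (ENNReal.ofReal (heatK N z) * G z) :=
    (hw.comp measurable_snd).mul (measurable_heatK.ennreal_ofReal.mul hG)
  rw [heatMeas, lintegral_withDensity_eq_lintegral_mul _ (measurable_heatDens hw) hG]
  simp only [Pi.mul_apply, mul_assoc]
  rw [Measure.volume_eq_prod, lintegral_prod_symm _ hm.aemeasurable,
    ← lintegral_indicator measurableSet_Ioi]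
  congr 1 with s
  by_cases hs : 0 < s
  · rw [indicator_of_mem (by exact hs)]
    change ∫⁻ x, w s * (ENNReal.ofReal (heatK N (x, s)) * G (x, s)) = _
    rw [lintegral_const_mul]
    exact ((measurable_heatK.comp (by fun_prop)).ennreal_ofReal.mul (hG.comp (by fun_prop)))
  · rw [indicator_of_notMem (by exact hs)]
    simp [heatK_of_nonpos (z := ((_ : EuclideanSpace ℝ (Fin N)), s)) (not_lt.1 hs)]

lemma heatMeas_univ {w : ℝ → ℝ≥0∞} (hw : Measurable w) :
    heatMeas N w univ = ∫⁻ s in Ioi 0, w s := by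
  rw [← lintegral_one, lintegral_heatMeas hw measurable_const]
  refine setLIntegral_congr_fun measurableSet_Ioi fun s hs => ?_
  simp [lintegral_heatK (N := N) hs]

lemma measurable_timeConv {w₁ w₂ : ℝ → ℝ≥0∞} (h₁ : Measurable w₁) (h₂ : Measurable w₂) :
    Measurable fun t => ∫⁻ s in Ioo 0 t, w₁ s * w₂ (t - s) := by
  have : (fun t => ∫⁻ s in Ioo 0 t, w₁ s * w₂ (t - s)) = fun t => ∫⁻ s,
      {p : ℝ × ℝ | 0 < p.2 ∧ p.2 < p.1}.indicator (fun p => w₁ p.2 * w₂ (p.1 - p.2)) (t, s) := by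
    ext t
    rw [← lintegral_indicator measurableSet_Ioo]
    rfl
  rw [this]
  apply Measurable.lintegral_prod_right'
    (f := {p : ℝ × ℝ | 0 < p.2 ∧ p.2 < p.1}.indicator (fun p => w₁ p.2 * w₂ (p.1 - p.2)))
  refine Measurable.indicator (by fun_prop) ?_
  exact (measurableSet_lt measurable_const measurable_snd).inter
    (measurableSet_lt measurable_snd measurable_fst)

/-- Semigroup property: iterated heat averages compose by convolving the time weights. -/
lemma lintegral_lintegral_heatMeas {w₁ w₂ : ℝ → ℝ≥0∞} (h₁ : Measurable w₁) (h₂ : Measurable w₂)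
    {G : PSpace N → ℝ≥0∞} (hG : Measurable G) :
    ∫⁻ a, ∫⁻ b, G (a + b) ∂heatMeas N w₂ ∂heatMeas N w₁
      = ∫⁻ c, G c ∂heatMeas N (fun t => ∫⁻ s in Ioo 0 t, w₁ s * w₂ (t - s)) := by
  have hH : Measurable fun z : PSpace N => ENNReal.ofReal (heatK N z) :=
    measurable_heatK.ennreal_ofReal
  set Γ : ℝ → ℝ≥0∞ := fun t => ∫⁻ y, ENNReal.ofReal (heatK N (y, t)) * G (y, t) with hΓ
  have hΓm : Measurable Γ := by
    apply Measurable.lintegral_prod_right'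
      (f := fun p : ℝ × EuclideanSpace ℝ (Fin N) =>
        ENNReal.ofReal (heatK N (p.2, p.1)) * G (p.2, p.1))
    exact (hH.comp (by fun_prop)).mul (hG.comp (by fun_prop))
  have step : ∀ a : PSpace N, ∫⁻ b, G (a + b) ∂heatMeas N w₂
      = ∫⁻ s in Ioi 0, w₂ s * ∫⁻ y, ENNReal.ofReal (heatK N (y, s)) * G (a + (y, s)) :=
    fun a => lintegral_heatMeas h₂ (hG.comp (by fun_prop))
  have hA : Measurable fun p : (PSpace N × ℝ) × EuclideanSpace ℝ (Fin N) =>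
      ENNReal.ofReal (heatK N (p.2, p.1.2)) * G (p.1.1 + (p.2, p.1.2)) :=
    (hH.comp (by fun_prop)).mul (hG.comp (by fun_prop))
  have hB : Measurable fun p : PSpace N × ℝ =>
      ∫⁻ y, ENNReal.ofReal (heatK N (y, p.2)) * G (p.1 + (y, p.2)) :=
    Measurable.lintegral_prod_right' hA
  have hC : Measurable fun p : PSpace N × ℝ =>
      w₂ p.2 * ∫⁻ y, ENNReal.ofReal (heatK N (y, p.2)) * G (p.1 + (y, p.2)) :=
    (h₂.comp measurable_snd).mul hB
  simp_rw [step]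
  rw [lintegral_heatMeas h₁ (Measurable.lintegral_prod_right' hC)]
  have inner : ∀ r ∈ Ioi (0:ℝ), w₁ r * ∫⁻ x, ENNReal.ofReal (heatK N (x, r)) *
        ∫⁻ s in Ioi 0, w₂ s * ∫⁻ y, ENNReal.ofReal (heatK N (y, s)) * G ((x, r) + (y, s))
      = w₁ r * ∫⁻ s in Ioi 0, w₂ s * Γ (s + r) := by
    intro r hr
    congr 1
    have e1 : ∀ x : EuclideanSpace ℝ (Fin N), ENNReal.ofReal (heatK N (x, r)) *
        ∫⁻ s in Ioi 0, w₂ s * ∫⁻ y, ENNReal.ofReal (heatK N (y, s)) * G ((x, r) + (y, s))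
        = ∫⁻ s in Ioi 0, ENNReal.ofReal (heatK N (x, r)) *
          (w₂ s * ∫⁻ y, ENNReal.ofReal (heatK N (y, s)) * G ((x, r) + (y, s))) := fun x => by
      rw [lintegral_const_mul]
      exact hC.comp (g := fun p => w₂ p.2 * ∫⁻ y, ENNReal.ofReal (heatK N (y, p.2)) *
        G (p.1 + (y, p.2))) (f := fun s => ((x, r), s)) (by fun_prop)
    simp_rw [e1]
    rw [lintegral_lintegral_swap]
    · refine setLIntegral_congr_fun measurableSet_Ioi fun s hs => ?_
      have e2 : ∀ x : EuclideanSpace ℝ (Fin N), ENNReal.ofReal (heatK N (x, r)) *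
          (w₂ s * ∫⁻ y, ENNReal.ofReal (heatK N (y, s)) * G ((x, r) + (y, s)))
          = w₂ s * (ENNReal.ofReal (heatK N (x, r)) *
            ∫⁻ y, ENNReal.ofReal (heatK N (y, s)) * G (x + y, s + r)) := fun x => by
        rw [mul_left_comm]
        simp only [Prod.mk_add_mk, add_comm r s]
      simp only [e2]
      have hD : Measurable fun x : EuclideanSpace ℝ (Fin N) =>
          ∫⁻ y, ENNReal.ofReal (heatK N (y, s)) * G (x + y, s + r) := by
        apply Measurable.lintegral_prod_right' (f := fun p : EuclideanSpace ℝ (Fin N) ×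
          EuclideanSpace ℝ (Fin N) => ENNReal.ofReal (heatK N (p.2, s)) * G (p.1 + p.2, s + r))
        exact (hH.comp (by fun_prop)).mul (hG.comp (by fun_prop))
      have hM : Measurable fun x : EuclideanSpace ℝ (Fin N) => ENNReal.ofReal (heatK N (x, r)) *
          ∫⁻ y, ENNReal.ofReal (heatK N (y, s)) * G (x + y, s + r) :=
        Measurable.mul (hH.comp (f := fun x => (x, r)) (by fun_prop)) hD
      rw [lintegral_const_mul _ hM,
        lintegral_heatK_conv hs hr (g := fun x => G (x, s + r)) (hG.comp (by fun_prop))]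
    · apply Measurable.aemeasurable
      refine (hH.comp (f := fun p : EuclideanSpace ℝ (Fin N) × ℝ => (p.1, r)) (by fun_prop)).mul ?_
      exact hC.comp (g := fun p => w₂ p.2 * ∫⁻ y, ENNReal.ofReal (heatK N (y, p.2)) *
        G (p.1 + (y, p.2))) (f := fun p : EuclideanSpace ℝ (Fin N) × ℝ => ((p.1, r), p.2))
        (by fun_prop)
  rw [setLIntegral_congr_fun measurableSet_Ioi inner,
    lintegral_heatMeas (measurable_timeConv h₁ h₂) hG]
  -- the one-dimensional change of variables
  have e3 : ∀ r ∈ Ioi (0:ℝ), w₁ r * ∫⁻ s in Ioi 0, w₂ s * Γ (s + r)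
      = ∫⁻ t, (Ioi r).indicator (fun t => w₁ r * (w₂ (t - r) * Γ t)) t := by
    intro r _
    rw [← lintegral_add_right_eq_self
        (fun t => (Ioi r).indicator (fun t => w₁ r * (w₂ (t - r) * Γ t)) t) r,
      ← lintegral_indicator measurableSet_Ioi,
      ← lintegral_const_mul _ (Measurable.indicator (by fun_prop) measurableSet_Ioi)]
    congr 1 with s
    simp only [indicator, mem_Ioi, sub_neg_eq_add, lt_add_iff_pos_left, add_sub_cancel_right]
    split_ifs <;> simp
  rw [setLIntegral_congr_fun measurableSet_Ioi e3, lintegral_lintegral_swap]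
  · rw [← lintegral_indicator measurableSet_Ioi]
    congr 1 with t
    by_cases ht : 0 < t
    · rw [indicator_of_mem (by exact ht), ← lintegral_mul_const _ (by fun_prop),
        ← lintegral_indicator measurableSet_Ioi, ← lintegral_indicator measurableSet_Ioo]
      congr 1 with r
      simp only [indicator, mem_Ioi, mem_Ioo]
      by_cases h0 : 0 < r <;> by_cases h1 : r < t <;> simp [h0, h1, mul_assoc, Γ]
    · rw [indicator_of_notMem (by exact ht)]
      rw [setLIntegral_congr_fun (g := fun _ => 0) measurableSet_Ioi]
      · simp
      · intro r hr
        have : ¬ r < t := fun h => ht (lt_trans hr h)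
        simp [indicator, this]
  · apply Measurable.aemeasurable
    change Measurable fun p : ℝ × ℝ =>
      (Ioi p.1).indicator (fun t => w₁ p.1 * (w₂ (t - p.1) * Γ t)) p.2
    have : (fun p : ℝ × ℝ => (Ioi p.1).indicator (fun t => w₁ p.1 * (w₂ (t - p.1) * Γ t)) p.2)
        = {p : ℝ × ℝ | p.1 < p.2}.indicator (fun p => w₁ p.1 * (w₂ (p.2 - p.1) * Γ p.2)) := rfl
    rw [this]
    exact Measurable.indicator (by fun_prop) (measurableSet_lt measurable_fst measurable_snd)

/-- The fundamental solution of `∂_t - Δ + L`, as a measure. -/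
noncomputable def kap (N : ℕ) (L : ℝ) : Measure (PSpace N) :=
  heatMeas N fun s => ENNReal.ofReal (Real.exp (-L * s))

lemma measurable_expWeight (L : ℝ) : Measurable fun s : ℝ => ENNReal.ofReal (Real.exp (-L * s)) :=
  by fun_prop

lemma lintegral_exp_Ioi {L : ℝ} (hL : 0 < L) :
    ∫⁻ s in Ioi (0 : ℝ), ENNReal.ofReal (Real.exp (-L * s)) = ENNReal.ofReal (1 / L) := by
  rw [← ofReal_integral_eq_lintegral_ofReal]
  · rw [integral_exp_mul_Ioi (by linarith)]
    congr 1
    simp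
  · exact integrableOn_exp_mul_Ioi (by linarith) 0
  · exact Filter.Eventually.of_forall fun s => (Real.exp_pos _).le

lemma kap_univ {L : ℝ} (hL : 0 < L) : kap N L univ = ENNReal.ofReal (1 / L) := by
  rw [kap, heatMeas_univ (measurable_expWeight L), lintegral_exp_Ioi hL]

lemma isFiniteMeasure_kap {L : ℝ} (hL : 0 < L) : IsFiniteMeasure (kap N L) :=
  ⟨by rw [kap_univ hL]; exact ENNReal.ofReal_lt_top⟩

lemma kap_real_univ {L : ℝ} (hL : 0 < L) : (kap N L).real univ = 1 / L := by
  rw [Measure.real, kap_univ hL, ENNReal.toReal_ofReal (by positivity)]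

lemma expWeight_conv {L : ℝ} (hL : 1 < L) {t : ℝ} (ht : 0 < t) :
    ENNReal.ofReal (Real.exp (-1 * t)) = ENNReal.ofReal (Real.exp (-L * t)) +
      ENNReal.ofReal (L - 1) * ∫⁻ s in Ioo 0 t, ENNReal.ofReal (Real.exp (-L * s)) *
        ENNReal.ofReal (Real.exp (-1 * (t - s))) := by
  have hInt : IntegrableOn (fun s => Real.exp (-L * s) * Real.exp (-1 * (t - s))) (Ioo 0 t) :=
    (Continuous.integrableOn_Icc (by fun_prop)).mono_set Ioo_subset_Icc_self
  have h1 : ∫⁻ s in Ioo 0 t, ENNReal.ofReal (Real.exp (-L * s)) *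
      ENNReal.ofReal (Real.exp (-1 * (t - s)))
      = ENNReal.ofReal ((Real.exp (-1 * t) - Real.exp (-L * t)) / (L - 1)) := by
    simp_rw [← ENNReal.ofReal_mul (Real.exp_pos _).le]
    rw [← ofReal_integral_eq_lintegral_ofReal hInt
      (Filter.Eventually.of_forall fun s => by positivity)]
    congr 1
    rw [← integral_Ioc_eq_integral_Ioo, ← intervalIntegral.integral_of_le ht.le]
    have hd : ∀ s ∈ uIcc 0 t, HasDerivAt
        (fun s => -(Real.exp (-L * s) * Real.exp (-1 * (t - s))) / (L - 1))
        (Real.exp (-L * s) * Real.exp (-1 * (t - s))) s := by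
      intro s _
      have a := ((hasDerivAt_id s).const_mul (-L)).exp
      have b := (((hasDerivAt_id s).const_sub t).const_mul (-1)).exp
      refine ((a.mul b).neg.div_const (L - 1)).congr_deriv ?_
      have : L - 1 ≠ 0 := by linarith
      simp only [id]
      field_simp
      ring
    rw [intervalIntegral.integral_eq_sub_of_hasDerivAt hd (Continuous.intervalIntegrable
      (by fun_prop) _ _)]
    simp
    ring
  rw [h1, ← ENNReal.ofReal_mul (by linarith), ← ENNReal.ofReal_add (Real.exp_pos _).le]
  · congr 1
    have : L - 1 ≠ 0 := by linarith
    field_simp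
    ring
  · apply mul_nonneg (by linarith)
    apply div_nonneg _ (by linarith)
    rw [sub_nonneg, Real.exp_le_exp]
    nlinarith

/-- The resolvent identity. -/
lemma kap_one_eq {L : ℝ} (hL : 1 < L) :
    kap N 1 = kap N L + ENNReal.ofReal (L - 1) • (kap N L).conv (kap N 1) := by
  have := isFiniteMeasure_kap (N := N) one_pos
  have := isFiniteMeasure_kap (N := N) (L := L) (by linarith)
  refine Measure.ext_of_lintegral _ fun f hf => ?_
  rw [lintegral_add_measure, lintegral_smul_measure, Measure.lintegral_conv hf]
  unfold kap
  rw [lintegral_lintegral_heatMeas (measurable_expWeight _) (measurable_expWeight _) hf,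
    lintegral_heatMeas (measurable_expWeight _) hf, lintegral_heatMeas (measurable_expWeight _) hf,
    lintegral_heatMeas (measurable_timeConv (measurable_expWeight _) (measurable_expWeight _)) hf]
  have hΓm : Measurable fun s => ∫⁻ y, ENNReal.ofReal (heatK N (y, s)) * f (y, s) := by
    apply Measurable.lintegral_prod_right'
      (f := fun p : ℝ × EuclideanSpace ℝ (Fin N) =>
        ENNReal.ofReal (heatK N (p.2, p.1)) * f (p.2, p.1))
    exact (measurable_heatK.ennreal_ofReal.comp (by fun_prop)).mul (hf.comp (by fun_prop))
  have hm := measurable_timeConv (measurable_expWeight L) (measurable_expWeight 1)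
  rw [smul_eq_mul]
  have e1 := lintegral_const_mul (μ := volume.restrict (Ioi (0 : ℝ))) (ENNReal.ofReal (L - 1))
    (hm.mul hΓm)
  have e2 := lintegral_add_left (μ := volume.restrict (Ioi (0 : ℝ)))
    ((measurable_expWeight L).mul hΓm)
  simp only [Pi.mul_apply] at e1 e2
  rw [← e1, ← e2]
  refine setLIntegral_congr_fun measurableSet_Ioi fun t ht => ?_
  rw [expWeight_conv hL ht]
  ring

/-- Bounded measurable functions. -/
def BM (G : PSpace N → ℝ) : Prop := Measurable G ∧ ∃ C, ∀ z, |G z| ≤ C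

lemma BM.const (c : ℝ) : BM fun _ : PSpace N => c := ⟨measurable_const, |c|, fun _ => le_rfl⟩

lemma BM.add {G H : PSpace N → ℝ} (hG : BM G) (hH : BM H) : BM fun z => G z + H z := by
  obtain ⟨a, C, hC⟩ := hG
  obtain ⟨b, D, hD⟩ := hH
  exact ⟨a.add b, C + D, fun z => (abs_add_le _ _).trans (add_le_add (hC z) (hD z))⟩

lemma BM.const_mul {G : PSpace N → ℝ} (hG : BM G) (c : ℝ) : BM fun z => c * G z := by
  obtain ⟨a, C, hC⟩ := hG
  exact ⟨a.const_mul c, |c| * C, fun z => by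
    rw [abs_mul]; exact mul_le_mul_of_nonneg_left (hC z) (abs_nonneg _)⟩

lemma BM.sub {G H : PSpace N → ℝ} (hG : BM G) (hH : BM H) : BM fun z => G z - H z := by
  obtain ⟨a, C, hC⟩ := hG
  obtain ⟨b, D, hD⟩ := hH
  exact ⟨a.sub b, C + D, fun z => (abs_sub _ _).trans (add_le_add (hC z) (hD z))⟩

lemma BM.comp {G : PSpace N → ℝ} (hG : BM G) {g : ℝ → ℝ} (hg : Continuous g) :
    BM fun z => g (G z) := by
  obtain ⟨a, C, hC⟩ := hG
  obtain ⟨D, hD⟩ := (isCompact_Icc (a := -C) (b := C)).exists_bound_of_continuousOn hg.continuousOn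
  exact ⟨hg.measurable.comp a, D, fun z => hD _ (abs_le.1 (hC z))⟩

lemma BM.comp_sub {G : PSpace N → ℝ} (hG : BM G) (z : PSpace N) : BM fun w => G (z - w) :=
  ⟨hG.1.comp (by fun_prop), hG.2.imp fun _ h w => h _⟩

lemma BM.integrable {G : PSpace N → ℝ} (hG : BM G) (μ : Measure (PSpace N)) [IsFiniteMeasure μ] :
    Integrable G μ := by
  obtain ⟨a, C, hC⟩ := hG
  exact Integrable.of_bound a.aestronglyMeasurable C (Filter.Eventually.of_forall hC)

/-- The potential operator `(∂_t - Δ + L)⁻¹`. -/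
noncomputable def pot (N : ℕ) (L : ℝ) (G : PSpace N → ℝ) (z : PSpace N) : ℝ :=
  ∫ w, G (z - w) ∂kap N L

section
variable {L : ℝ} (hL : 0 < L) {G H : PSpace N → ℝ}
include hL

lemma integrable_pot (hG : BM G) (z : PSpace N) : Integrable (fun w => G (z - w)) (kap N L) :=
  have := isFiniteMeasure_kap (N := N) hL
  (hG.comp_sub z).integrable _

lemma pot_mono (hG : BM G) (hH : BM H) (h : ∀ z, G z ≤ H z) (z : PSpace N) :
    pot N L G z ≤ pot N L H z :=
  integral_mono (integrable_pot hL hG z) (integrable_pot hL hH z) fun w => h _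

lemma pot_const (c : ℝ) (z : PSpace N) : pot N L (fun _ => c) z = c / L := by
  simp only [pot, integral_const, kap_real_univ hL, smul_eq_mul]
  ring

lemma pot_le (hG : BM G) {c : ℝ} (h : ∀ z, G z ≤ c) (z : PSpace N) : pot N L G z ≤ c / L := by
  rw [← pot_const hL c z]
  exact pot_mono hL hG (BM.const c) h z

lemma le_pot (hG : BM G) {c : ℝ} (h : ∀ z, c ≤ G z) (z : PSpace N) : c / L ≤ pot N L G z := by
  rw [← pot_const hL c z]
  exact pot_mono hL (BM.const c) hG h z

lemma pot_add (hG : BM G) (hH : BM H) (z : PSpace N) :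
    pot N L (fun z => G z + H z) z = pot N L G z + pot N L H z :=
  integral_add (integrable_pot hL hG z) (integrable_pot hL hH z)

lemma pot_sub (hG : BM G) (hH : BM H) (z : PSpace N) :
    pot N L (fun z => G z - H z) z = pot N L G z - pot N L H z :=
  integral_sub (integrable_pot hL hG z) (integrable_pot hL hH z)

omit hL in
lemma pot_const_mul (c : ℝ) (z : PSpace N) :
    pot N L (fun z => c * G z) z = c * pot N L G z :=
  integral_const_mul _ _

lemma measurable_pot (hG : Measurable G) : Measurable (pot N L G) := by
  have := isFiniteMeasure_kap (N := N) hL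
  apply StronglyMeasurable.measurable
  apply StronglyMeasurable.integral_prod_right' (f := fun p : PSpace N × PSpace N => G (p.1 - p.2))
  exact (hG.comp (by fun_prop)).stronglyMeasurable

lemma abs_pot_le (hG : BM G) {C : ℝ} (h : ∀ z, |G z| ≤ C) (z : PSpace N) :
    |pot N L G z| ≤ C / L := by
  rw [abs_le, ← neg_div]
  exact ⟨le_pot hL hG (fun z => (abs_le.1 (h z)).1) z, pot_le hL hG (fun z => (abs_le.1 (h z)).2) z⟩

lemma BM.pot (hG : BM G) : BM (pot N L G) := by
  obtain ⟨C, hC⟩ := hG.2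
  exact ⟨measurable_pot hL hG.1, C / L, abs_pot_le hL hG hC⟩

lemma continuous_pot (hG : BM G) (hc : Continuous G) : Continuous (_root_.pot N L G) := by
  have := isFiniteMeasure_kap (N := N) hL
  obtain ⟨C, hC⟩ := hG.2
  refine continuous_of_dominated (bound := fun _ => C) (fun z => ?_) (fun z => ?_)
    (integrable_const C) ?_
  · exact (hc.comp (by fun_prop)).aestronglyMeasurable
  · exact Filter.Eventually.of_forall fun w => hC _
  · exact Filter.Eventually.of_forall fun w => hc.comp (by fun_prop)

end

/-- Resolvent identity for potentials. -/
lemma pot_one_eq {L : ℝ} (hL : 1 < L) {G : PSpace N → ℝ} (hG : BM G) (z : PSpace N) :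
    pot N 1 G z = pot N L (fun z => G z + (L - 1) * pot N 1 G z) z := by
  have hL0 : 0 < L := by linarith
  have := isFiniteMeasure_kap (N := N) one_pos
  have := isFiniteMeasure_kap (N := N) hL0
  rw [pot_add hL0 hG ((hG.pot one_pos).const_mul _), pot_const_mul]
  have hf := hG.comp_sub z
  conv_lhs => rw [pot, kap_one_eq hL]
  have hi : Integrable (fun w => G (z - w)) ((kap N L).conv (kap N 1)) := hf.integrable _
  rw [integral_add_measure (hf.integrable _) (hi.smul_measure ENNReal.ofReal_ne_top),
    integral_smul_measure, integral_conv hi, ENNReal.toReal_ofReal (by linarith), smul_eq_mul]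
  congr 2
  unfold pot
  congr 1 with a
  congr 1 with b
  rw [sub_sub]

/-- The nonlinearity `s - (e^s - 1)`. -/
noncomputable def phi (s : ℝ) : ℝ := s + 1 - Real.exp s

lemma continuous_phi : Continuous phi := by unfold phi; fun_prop

/-- `L s - (e^s - 1)` is increasing with slope at most `L - 1` on `[0, log L]`. -/
lemma phi_sub_le {L a b : ℝ} (ha : 0 ≤ b) (hab : b ≤ a) (hL : Real.exp a ≤ L) :
    0 ≤ (phi a + (L - 1) * a) - (phi b + (L - 1) * b) ∧
      (phi a + (L - 1) * a) - (phi b + (L - 1) * b) ≤ (L - 1) * (a - b) := by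
  have h1 : a - b ≤ Real.exp a - Real.exp b := by
    have : Real.exp a = Real.exp b * Real.exp (a - b) := by rw [← Real.exp_add]; ring_nf
    have h2 := Real.add_one_le_exp (a - b)
    have h3 := Real.one_le_exp ha
    nlinarith
  have h2 : Real.exp a - Real.exp b ≤ L * (a - b) := by
    have : Real.exp b = Real.exp a * Real.exp (b - a) := by rw [← Real.exp_add]; ring_nf
    have h2 := Real.add_one_le_exp (b - a)
    have h3 := Real.exp_pos a
    nlinarith
  unfold phi
  constructor <;> nlinarith

/-- Comparison principle. -/
lemma pot_comparison {F G u v : PSpace N → ℝ} (hF : BM F) (hG : BM G) (hu : BM u)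
    (hue : ∀ z, u z = pot N 1 (fun z => F z + phi (u z)) z)
    (hve : ∀ z, v z = pot N 1 G z) (hu0 : ∀ z, 0 ≤ u z)
    (h : ∀ z, G z ≤ F z + phi (max (v z) 0)) (z : PSpace N) : v z ≤ u z := by
  have hv : BM v := by
    have := hG.pot (N := N) one_pos
    rwa [show pot N 1 G = v from funext fun z => (hve z).symm] at this
  obtain ⟨C, hC⟩ := hu.2
  obtain ⟨D, hD⟩ := hv.2
  have hC0 : 0 ≤ C := (abs_nonneg _).trans (hC 0)
  have hD0 : 0 ≤ D := (abs_nonneg _).trans (hD 0)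
  set L := Real.exp (max C D) + 1
  have hL1 : 1 < L := by have := Real.exp_pos (max C D); simp only [L]; linarith
  have hL0 : 0 < L := by linarith
  have hFu : BM fun z => F z + phi (u z) := hF.add (hu.comp continuous_phi)
  have key : ∀ z, v z - u z = pot N L (fun z => (G z + (L - 1) * v z) -
      (F z + phi (u z) + (L - 1) * u z)) z := by
    intro z
    rw [pot_sub hL0 (hG.add (hv.const_mul _)) (hFu.add (hu.const_mul _)),
      hve, pot_one_eq hL1 hG, hue, pot_one_eq hL1 hFu]
    simp_rw [← hve, ← hue]
  have hbd : BddAbove (range fun z => v z - u z) :=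
    ⟨D + C, by rintro _ ⟨z, rfl⟩; have := abs_le.1 (hC z); have := abs_le.1 (hD z); simp only; linarith⟩
  set d := ⨆ z, v z - u z
  have hd : ∀ z, v z - u z ≤ d := fun z => le_ciSup hbd z
  have hbm := (hG.add (hv.const_mul (L - 1))).sub (hFu.add (hu.const_mul (L - 1)))
  have step : ∀ z, (G z + (L - 1) * v z) - (F z + phi (u z) + (L - 1) * u z)
      ≤ (L - 1) * max d 0 := by
    intro z
    have hz := h z
    have e1 : (L - 1) * v z ≤ (L - 1) * max (v z) 0 :=
      mul_le_mul_of_nonneg_left (le_max_left _ _) (by linarith)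
    set p := max (v z) 0
    have hp0 : 0 ≤ p := le_max_right _ _
    have hpD : p ≤ D := max_le (abs_le.1 (hD z)).2 hD0
    have hpd : p - u z ≤ max d 0 := by
      rcases max_cases (v z) 0 with ⟨e, _⟩ | ⟨e, _⟩
      · exact le_max_of_le_left (by simp only [p, e]; exact hd z)
      · exact le_max_of_le_right (by simp only [p, e]; linarith [hu0 z])
    have hmul : (L - 1) * (p - u z) ≤ (L - 1) * max d 0 :=
      mul_le_mul_of_nonneg_left hpd (by linarith)
    rcases le_total (u z) p with hle | hle
    · have := (phi_sub_le (hu0 z) hle (L := L) (by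
        have := Real.exp_le_exp.2 (hpD.trans (le_max_right C D)); simp only [L]; linarith)).2
      linarith
    · have := (phi_sub_le hp0 hle (L := L) (by
        have := Real.exp_le_exp.2 ((abs_le.1 (hC z)).2.trans (le_max_left C D))
        simp only [L]; linarith)).1
      have : 0 ≤ (L - 1) * max d 0 := mul_nonneg (by linarith) (le_max_right _ _)
      linarith
  have hd2 : d ≤ (L - 1) * max d 0 / L := ciSup_le fun z => by
    rw [key z]; exact pot_le hL0 hbm step z
  have hd0 : d ≤ 0 := by
    by_contra hd0
    push Not at hd0
    rw [max_eq_left hd0.le, le_div_iff₀ hL0] at hd2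
    linarith
  linarith [hd z]

/-- Existence for the penalised problem on the whole space. -/
lemma exists_pot_solution {F : PSpace N → ℝ} (hFc : Continuous F) {A : ℝ}
    (hF0 : ∀ z, 0 ≤ F z) (hFA : ∀ z, F z ≤ A) :
    ∃ u : PSpace N → ℝ, Continuous u ∧ BM u ∧ (∀ z, 0 ≤ u z) ∧
      ∀ z, u z = pot N 1 (fun z => F z + phi (u z)) z := by
  have hA : 0 ≤ A := (hF0 0).trans (hFA 0)
  set L := 2 + A
  have hL1 : 1 < L := by simp only [L]; linarith
  have hL0 : 0 < L := by linarith
  set m := Real.log L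
  have hm0 : 0 ≤ m := Real.log_nonneg hL1.le
  have hem : Real.exp m = L := Real.exp_log hL0
  set Ψ : ℝ → ℝ := fun s => phi (max 0 (min s m)) + (L - 1) * max 0 (min s m) with hΨ
  have hΨc : Continuous Ψ := by have := continuous_phi; fun_prop
  have hcl : ∀ a b : ℝ, b ≤ a → 0 ≤ Ψ a - Ψ b ∧ Ψ a - Ψ b ≤ (L - 1) * (a - b) := by
    intro a b hab
    have hmono : max 0 (min b m) ≤ max 0 (min a m) := max_le_max le_rfl (min_le_min hab le_rfl)
    have hm' : max 0 (min a m) ≤ m := max_le hm0 (min_le_right _ _)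
    have h := phi_sub_le (le_max_left _ _) hmono (L := L) (by
      rw [← hem]; exact Real.exp_le_exp.2 hm')
    refine ⟨h.1, h.2.trans (mul_le_mul_of_nonneg_left ?_ (by linarith))⟩
    have : max 0 (min a m) ≤ max 0 (min b m) + (a - b) := by
      apply max_le
      · have := le_max_left 0 (min b m); linarith
      · have h1 : min a m ≤ min b m + (a - b) := by
          rcases le_total b m with h | h
          · rw [min_eq_left h]; have := min_le_left a m; linarith
          · rw [min_eq_right h]; have := min_le_right a m; linarith
        have := le_max_right 0 (min b m); linarith
    linarith
  have habs : ∀ a b : ℝ, |Ψ a - Ψ b| ≤ (L - 1) * |a - b| := by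
    intro a b
    rcases le_total b a with h | h
    · rw [abs_of_nonneg (hcl a b h).1, abs_of_nonneg (by linarith)]; exact (hcl a b h).2
    · rw [abs_sub_comm, abs_sub_comm a, abs_of_nonneg (hcl b a h).1, abs_of_nonneg (by linarith)]
      exact (hcl b a h).2
  have hFb : BM F := ⟨hFc.measurable, A, fun z => by rw [abs_of_nonneg (hF0 z)]; exact hFA z⟩
  have hub : ∀ u : BoundedContinuousFunction (PSpace N) ℝ, BM fun z => F z + Ψ (u z) := fun u =>
    hFb.add (BM.comp ⟨u.continuous.measurable, ‖u‖, fun z => u.norm_coe_le_norm z⟩ hΨc)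
  have huc : ∀ u : BoundedContinuousFunction (PSpace N) ℝ, Continuous fun z => F z + Ψ (u z) :=
    fun u => hFc.add (hΨc.comp u.continuous)
  let T : BoundedContinuousFunction (PSpace N) ℝ → BoundedContinuousFunction (PSpace N) ℝ :=
    fun u => BoundedContinuousFunction.ofNormedAddCommGroup (pot N L fun z => F z + Ψ (u z))
      (continuous_pot hL0 (hub u) (huc u)) (((hub u).pot hL0).2.choose)
      (((hub u).pot hL0).2.choose_spec)
  have hT : ∀ u z, T u z = pot N L (fun z => F z + Ψ (u z)) z := fun u z => rfl
  have hcon : ContractingWith (Real.toNNReal ((L - 1) / L)) T := by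
    constructor
    · rw [Real.toNNReal_lt_one, div_lt_one hL0]; linarith
    · refine LipschitzWith.of_dist_le_mul fun u v => ?_
      rw [Real.coe_toNNReal _ (div_nonneg (by linarith) hL0.le)]
      refine (BoundedContinuousFunction.dist_le (mul_nonneg (div_nonneg (by linarith) hL0.le)
        dist_nonneg)).2 fun z => ?_
      rw [hT, hT, Real.dist_eq, ← pot_sub hL0 (hub u) (hub v), div_mul_eq_mul_div]
      refine abs_pot_le hL0 ((hub u).sub (hub v)) (fun w => ?_) z
      rw [add_sub_add_left_eq_sub]
      refine (habs _ _).trans (mul_le_mul_of_nonneg_left ?_ (by linarith))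
      rw [← Real.dist_eq]; exact BoundedContinuousFunction.dist_coe_le_dist w
  set u := ContractingWith.fixedPoint T hcon
  have hfix : ∀ z, u z = pot N L (fun z => F z + Ψ (u z)) z := fun z => by
    rw [← hT]; exact congrArg (fun f : BoundedContinuousFunction (PSpace N) ℝ => f z)
      hcon.fixedPoint_isFixedPt.symm
  have hΨ0 : ∀ s, 0 ≤ Ψ s := by
    intro s
    have h := (hcl (max s 0) 0 (le_max_right _ _)).1
    have h0 : Ψ 0 = 0 := by simp [hΨ, hm0, phi]
    have : Ψ (max s 0) = Ψ s := by
      simp only [hΨ]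
      have : max 0 (min (max s 0) m) = max 0 (min s m) := by
        rcases le_total s 0 with h | h
        · rw [max_eq_right h, min_eq_left hm0, max_self,
            max_eq_left ((min_le_left _ _).trans h)]
        · rw [max_eq_left h]
      rw [this]
    linarith
  have hΨm : ∀ s, Ψ s ≤ L * m - (L - 1) := by
    intro s
    have h := (hcl (max s m) s (le_max_left _ _)).1
    have : Ψ (max s m) = L * m - (L - 1) := by
      simp only [hΨ, min_eq_right (le_max_right s m), max_eq_right hm0, phi, hem]; ring
    linarith
  have hu0 : ∀ z, 0 ≤ u z := fun z => by
    rw [hfix z, ← zero_div L]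
    exact le_pot hL0 (hub u) (fun z => add_nonneg (hF0 z) (hΨ0 _)) z
  have hum : ∀ z, u z ≤ m := fun z => by
    have := pot_le hL0 (hub u) (c := L * m) (fun z => by
      have := hFA z; have := hΨm (u z); simp only [L] at *; linarith) z
    rw [hfix z]
    rwa [mul_div_cancel_left₀ _ hL0.ne'] at this
  have huB : BM u := ⟨u.continuous.measurable, ‖u‖, fun z => u.norm_coe_le_norm z⟩
  have hFu : BM fun z => F z + phi (u z) := hFb.add (huB.comp continuous_phi)
  refine ⟨u, u.continuous, huB, hu0, ?_⟩
  have hclamp : ∀ z, Ψ (u z) = phi (u z) + (L - 1) * u z := fun z => by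
    simp only [hΨ, min_eq_left (hum z), max_eq_right (hu0 z)]
  set w := pot N 1 fun z => F z + phi (u z)
  have hw : BM w := hFu.pot one_pos
  have key : ∀ z, u z - w z = pot N L (fun z => (L - 1) * (u z - w z)) z := fun z => by
    conv_lhs => rw [show w z = _ from pot_one_eq hL1 hFu z, hfix z, ← pot_sub hL0 (hub u)
      (hFu.add (hw.const_mul _))]
    congr 1
    ext z
    rw [hclamp]
    ring
  have hd : BM fun z => u z - w z := huB.sub hw
  obtain ⟨C, hC⟩ := hd.2
  have hbd : BddAbove (range fun z => |u z - w z|) := ⟨C, by rintro _ ⟨z, rfl⟩; exact hC z⟩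
  set d := ⨆ z, |u z - w z|
  have hdz : ∀ z, |u z - w z| ≤ d := fun z => le_ciSup hbd z
  have hd2 : d ≤ (L - 1) * d / L := ciSup_le fun z => by
    rw [key z]
    refine abs_pot_le hL0 (hd.const_mul _) (fun z => ?_) z
    rw [abs_mul, abs_of_nonneg (by linarith : 0 ≤ L - 1)]
    exact mul_le_mul_of_nonneg_left (hdz z) (by linarith)
  rw [le_div_iff₀ hL0] at hd2
  intro z
  have := hdz z
  have : |u z - w z| ≤ 0 := by linarith
  linarith [abs_nonpos_iff.1 this]

section flatGauss
open Filter Topology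

/-- `τ^p e^{-1/(4τ)}`, extended by zero to `τ ≤ 0`. -/
noncomputable def flatG (p τ : ℝ) : ℝ := if 0 < τ then τ ^ p * Real.exp (-(1 / 4) * τ⁻¹) else 0

lemma tendsto_flatG_zero (p : ℝ) : Tendsto (flatG p) (𝓝 0) (𝓝 0) := by
  have h1 : Tendsto (flatG p) (𝓝[>] 0) (𝓝 0) := by
    have h := (tendsto_rpow_mul_exp_neg_mul_atTop_nhds_zero (-p) (1 / 4) (by norm_num)).comp
      (tendsto_inv_nhdsGT_zero (𝕜 := ℝ))
    refine h.congr' ?_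
    filter_upwards [self_mem_nhdsWithin] with τ hτ
    simp only [Function.comp, flatG, if_pos (show 0 < τ from hτ)]
    rw [Real.inv_rpow (le_of_lt hτ), Real.rpow_neg (le_of_lt hτ), inv_inv]
  have h2 : Tendsto (flatG p) (𝓝[≤] 0) (𝓝 0) := by
    refine tendsto_const_nhds.congr' ?_
    filter_upwards [self_mem_nhdsWithin] with τ hτ
    simp [flatG, not_lt.2 (show τ ≤ 0 from hτ)]
  have := h2.sup h1
  rwa [← nhdsWithin_union, Iic_union_Ioi, nhdsWithin_univ] at this

lemma hasDerivAt_flatG (p τ : ℝ) :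
    HasDerivAt (flatG p) (p * flatG (p - 1) τ + 1 / 4 * flatG (p - 2) τ) τ := by
  rcases lt_trichotomy τ 0 with h | h | h
  · have : flatG p =ᶠ[𝓝 τ] fun _ => 0 := by
      filter_upwards [gt_mem_nhds h] with s hs
      simp [flatG, not_lt.2 (le_of_lt hs)]
    refine ((hasDerivAt_const τ (0 : ℝ)).congr_of_eventuallyEq this).congr_deriv ?_
    simp [flatG, not_lt.2 h.le]
  · subst h
    rw [hasDerivAt_iff_tendsto_slope_zero]
    have e : p * flatG (p - 1) 0 + 1 / 4 * flatG (p - 2) 0 = 0 := by simp [flatG]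
    rw [e]
    refine ((tendsto_flatG_zero (p - 1)).mono_left nhdsWithin_le_nhds).congr' ?_
    filter_upwards [self_mem_nhdsWithin] with s hs
    simp only [flatG, zero_add, lt_irrefl, if_false, sub_zero, smul_eq_mul]
    split_ifs with h
    · rw [Real.rpow_sub_one h.ne']; field_simp
    · simp
  · have : flatG p =ᶠ[𝓝 τ] fun s => s ^ p * Real.exp (-(1 / 4) * s⁻¹) := by
      filter_upwards [lt_mem_nhds h] with s hs
      simp [flatG, hs]
    have d := (Real.hasDerivAt_rpow_const (p := p) (Or.inl h.ne')).mul
      ((((hasDerivAt_inv h.ne').const_mul (-(1 / 4))).exp))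
    refine (d.congr_of_eventuallyEq this).congr_deriv ?_
    simp only [flatG, if_pos h]
    rw [Real.rpow_sub h p 2, Real.rpow_two]
    field_simp

lemma contDiff_flatG : ∀ (n : ℕ) (p : ℝ), ContDiff ℝ n (flatG p) := by
  intro n
  induction n with
  | zero => exact fun p => contDiff_zero.2 (continuous_iff_continuousAt.2 fun τ =>
      (hasDerivAt_flatG p τ).continuousAt)
  | succ n ih =>
    intro p
    push_cast
    rw [contDiff_succ_iff_deriv]
    refine ⟨fun τ => (hasDerivAt_flatG p τ).differentiableAt, fun h => by simp at h, ?_⟩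
    rw [show deriv (flatG p) = fun τ => p * flatG (p - 1) τ + 1 / 4 * flatG (p - 2) τ from
      funext fun τ => (hasDerivAt_flatG p τ).deriv]
    exact (contDiff_const.mul (ih _)).add (contDiff_const.mul (ih _))

end flatGauss

/-- The fundamental solution of `∂_t - Δ + 1`. -/
noncomputable def Kf (N : ℕ) (z : PSpace N) : ℝ := Real.exp (-z.2) * heatK N z

lemma Kf_nonneg (z : PSpace N) : 0 ≤ Kf N z := mul_nonneg (Real.exp_pos _).le (heatK_nonneg z)

lemma Kf_of_nonpos {z : PSpace N} (h : z.2 ≤ 0) : Kf N z = 0 := by simp [Kf, heatK_of_nonpos h]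

lemma measurable_Kf : Measurable (Kf N) := by
  unfold Kf; exact (by fun_prop : Measurable _).mul measurable_heatK

lemma Kf_eq_flatG {z : PSpace N} (hz : z.1 ≠ 0) :
    Kf N z = Real.exp (-z.2) * ((4 * Real.pi) ^ (-(N : ℝ) / 2) *
      (‖z.1‖ ^ 2) ^ (-(N : ℝ) / 2) * flatG (-(N : ℝ) / 2) (z.2 / ‖z.1‖ ^ 2)) := by
  have hn : 0 < ‖z.1‖ ^ 2 := by positivity
  by_cases h : 0 < z.2
  · have h2 : 0 < z.2 / ‖z.1‖ ^ 2 := by positivity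
    rw [Kf, heatK, if_pos h, flatG, if_pos h2, ← mul_assoc (_ * _) (_ ^ _),
      mul_assoc (_ ^ _) (_ ^ _) ((z.2 / ‖z.1‖ ^ 2) ^ _), ← Real.mul_rpow hn.le h2.le,
      mul_div_cancel₀ _ hn.ne', ← Real.mul_rpow (by positivity) h.le]
    congr 3
    field_simp
  · have h2 : ¬ 0 < z.2 / ‖z.1‖ ^ 2 := by
      rw [not_lt] at h ⊢; exact div_nonpos_of_nonpos_of_nonneg h hn.le
    rw [Kf, heatK, if_neg h, flatG, if_neg h2]; simp

open Filter Topology in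
lemma contDiffAt_Kf {z : PSpace N} (hz : z ≠ 0) : ContDiffAt ℝ (⊤ : ℕ∞) (Kf N) z := by
  rcases lt_trichotomy z.2 0 with h | h | h
  · have : Kf N =ᶠ[𝓝 z] fun _ => 0 := by
      filter_upwards [(continuous_snd.tendsto z).eventually (gt_mem_nhds h)] with w hw
      exact Kf_of_nonpos (le_of_lt hw)
    exact contDiffAt_const.congr_of_eventuallyEq this
  · have hx : z.1 ≠ 0 := fun h' => hz (Prod.ext h' h)
    have : Kf N =ᶠ[𝓝 z] fun z => Real.exp (-z.2) * ((4 * Real.pi) ^ (-(N : ℝ) / 2) *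
      (‖z.1‖ ^ 2) ^ (-(N : ℝ) / 2) * flatG (-(N : ℝ) / 2) (z.2 / ‖z.1‖ ^ 2)) := by
      filter_upwards [continuous_fst.continuousAt.eventually_ne hx] with w hw
      exact Kf_eq_flatG hw
    refine ContDiffAt.congr_of_eventuallyEq ?_ this
    have hn : ‖z.1‖ ^ 2 ≠ 0 := by positivity
    have hq : ContDiffAt ℝ (⊤ : ℕ∞) (fun z : PSpace N => ‖z.1‖ ^ 2) z :=
      (contDiff_fst.norm_sq ℝ).contDiffAt
    refine (contDiff_snd.neg.exp.contDiffAt).mul ((contDiffAt_const.mul ?_).mul ?_)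
    · exact hq.rpow_const_of_ne hn
    · exact (contDiff_infty.2 fun n => contDiff_flatG n _).contDiffAt.comp z
        (contDiff_snd.contDiffAt.div hq hn)
  · have : Kf N =ᶠ[𝓝 z] fun z => Real.exp (-z.2) *
        ((4 * Real.pi * z.2) ^ (-(N : ℝ) / 2) * Real.exp (-‖z.1‖ ^ 2 / (4 * z.2))) := by
      filter_upwards [(continuous_snd.tendsto z).eventually (lt_mem_nhds h)] with w hw
      simp [Kf, heatK, if_pos (show 0 < w.2 from hw)]
    refine ContDiffAt.congr_of_eventuallyEq ?_ this
    have h4 : (4 * Real.pi * z.2) ≠ 0 := by positivity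
    refine (contDiff_snd.neg.exp.contDiffAt).mul (ContDiffAt.mul ?_ ?_)
    · exact (contDiffAt_const.mul contDiff_snd.contDiffAt).rpow_const_of_ne h4
    · refine ContDiffAt.exp (ContDiffAt.div ?_ (contDiffAt_const.mul contDiff_snd.contDiffAt)
        (by positivity))
      exact (contDiff_fst.norm_sq ℝ).neg.contDiffAt

/-- Directional derivative. -/
noncomputable def dd (e : PSpace N) (f : PSpace N → ℝ) (z : PSpace N) : ℝ := fderiv ℝ f z e

/-- The `i`-th spatial direction. -/
noncomputable def ex (i : Fin N) : PSpace N := (EuclideanSpace.single i 1, 0)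

/-- The time direction. -/
noncomputable def et (N : ℕ) : PSpace N := (0, 1)

/-- The operator `∂_t - Δ + 1`. -/
noncomputable def Lop (f : PSpace N → ℝ) (z : PSpace N) : ℝ :=
  dd (et N) f z - ∑ i, dd (ex i) (dd (ex i) f) z + f z

/-- Test functions. -/
def Tst (f : PSpace N → ℝ) : Prop := ContDiff ℝ (⊤ : ℕ∞) f ∧ HasCompactSupport f

lemma dd_eq_of_hasFDerivAt {f : PSpace N → ℝ} {f' : PSpace N →L[ℝ] ℝ} {z e : PSpace N}
    (h : HasFDerivAt f f' z) : dd e f z = f' e := by rw [dd, h.fderiv]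

lemma contDiff_dd {f : PSpace N → ℝ} (hf : ContDiff ℝ (⊤ : ℕ∞) f) (e : PSpace N) :
    ContDiff ℝ (⊤ : ℕ∞) (dd e f) :=
  (hf.fderiv_right (m := (⊤ : ℕ∞)) (by simp)).clm_apply contDiff_const

lemma contDiffAt_dd {f : PSpace N → ℝ} {z : PSpace N} (hf : ContDiffAt ℝ (⊤ : ℕ∞) f z)
    (e : PSpace N) : ContDiffAt ℝ (⊤ : ℕ∞) (dd e f) z :=
  (hf.fderiv_right (m := (⊤ : ℕ∞)) (by simp)).clm_apply contDiffAt_const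

lemma Tst.dd {f : PSpace N → ℝ} (hf : Tst f) (e : PSpace N) : Tst (dd e f) :=
  ⟨contDiff_dd hf.1 e, (hf.2.fderiv_apply ℝ (v := e))⟩

lemma Tst.add {f g : PSpace N → ℝ} (hf : Tst f) (hg : Tst g) : Tst fun z => f z + g z :=
  ⟨hf.1.add hg.1, hf.2.add hg.2⟩

lemma Tst.neg {f : PSpace N → ℝ} (hf : Tst f) : Tst fun z => - f z :=
  ⟨hf.1.neg, hf.2.comp_left (g := fun x => -x) (by simp)⟩

lemma Tst.sub {f g : PSpace N → ℝ} (hf : Tst f) (hg : Tst g) : Tst fun z => f z - g z := by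
  simpa [sub_eq_add_neg] using hf.add hg.neg

lemma Tst.mul_left {f g : PSpace N → ℝ} (hf : ContDiff ℝ (⊤ : ℕ∞) f) (hg : Tst g) :
    Tst fun z => f z * g z := ⟨hf.mul hg.1, hg.2.mul_left⟩

lemma Tst.zero : Tst fun _ : PSpace N => (0 : ℝ) := ⟨contDiff_const, HasCompactSupport.zero⟩

lemma Tst.sum {ι : Type*} (s : Finset ι) {f : ι → PSpace N → ℝ} (hf : ∀ i, Tst (f i)) :
    Tst fun z => ∑ i ∈ s, f i z := by
  classical
  induction s using Finset.induction_on with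
  | empty => simpa using Tst.zero
  | insert a s ha ih => simp_rw [Finset.sum_insert ha]; exact (hf a).add ih

lemma Tst.Lop {f : PSpace N → ℝ} (hf : Tst f) : Tst (Lop f) :=
  ((hf.dd _).sub (Tst.sum _ fun i => (hf.dd (ex i)).dd (ex i))).add hf

lemma Tst.bm {f : PSpace N → ℝ} (hf : Tst f) : BM f :=
  ⟨hf.1.continuous.measurable, by
    obtain ⟨C, hC⟩ := hf.2.exists_bound_of_continuous hf.1.continuous
    exact ⟨C, hC⟩⟩

lemma Tst.integrable {f : PSpace N → ℝ} (hf : Tst f) : Integrable f :=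
  hf.1.continuous.integrable_of_hasCompactSupport hf.2

lemma dd_mul {f g : PSpace N → ℝ} {z : PSpace N} (e : PSpace N) (hf : DifferentiableAt ℝ f z)
    (hg : DifferentiableAt ℝ g z) :
    dd e (fun z => f z * g z) z = dd e f z * g z + f z * dd e g z := by
  rw [dd, fderiv_fun_mul hf hg]
  simp [dd]; ring

lemma dd_add {f g : PSpace N → ℝ} {z : PSpace N} (e : PSpace N) (hf : DifferentiableAt ℝ f z)
    (hg : DifferentiableAt ℝ g z) :
    dd e (fun z => f z + g z) z = dd e f z + dd e g z := by
  rw [dd, fderiv_fun_add hf hg]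
  simp [dd]

open Filter Topology in
lemma dd_congr {f g : PSpace N → ℝ} {z : PSpace N} (e : PSpace N) (h : f =ᶠ[𝓝 z] g) :
    dd e f z = dd e g z := by rw [dd, h.fderiv_eq]; rfl

open Filter Topology in
lemma dd_dd_congr {f g : PSpace N → ℝ} {z : PSpace N} (e e' : PSpace N) (h : f =ᶠ[𝓝 z] g) :
    dd e (dd e' f) z = dd e (dd e' g) z :=
  dd_congr e (h.eventuallyEq_nhds.mono fun _ hw => dd_congr e' hw)

/-- Product rule for the heat operator. -/
lemma Lop_mul {f g : PSpace N → ℝ} {z : PSpace N} (hf : ContDiffAt ℝ (⊤ : ℕ∞) f z)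
    (hg : ContDiffAt ℝ (⊤ : ℕ∞) g z) :
    Lop (fun z => f z * g z) z = f z * Lop g z + ((dd (et N) f z - ∑ i, dd (ex i) (dd (ex i) f) z)
      * g z - 2 * ∑ i, dd (ex i) f z * dd (ex i) g z) := by
  have h2 : ∀ i : Fin N, dd (ex i) (dd (ex i) fun z => f z * g z) z
      = dd (ex i) (dd (ex i) f) z * g z + 2 * (dd (ex i) f z * dd (ex i) g z)
        + f z * dd (ex i) (dd (ex i) g) z := by
    intro i
    have hd : ∀ {h : PSpace N → ℝ}, ContDiffAt ℝ (⊤ : ℕ∞) h z →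
        ∀ᶠ w in nhds z, DifferentiableAt ℝ h w := fun {h} hh =>
      ((hh.of_le (m := 1) (by simp)).eventually (by simp)).mono fun w hw =>
        hw.differentiableAt (by simp)
    have e : (dd (ex i) fun z => f z * g z) =ᶠ[nhds z]
        fun w => dd (ex i) f w * g w + f w * dd (ex i) g w := by
      filter_upwards [hd hf, hd hg] with w h1 h2
      exact dd_mul _ h1 h2
    have a1 := (contDiffAt_dd hf (ex i)).differentiableAt (by simp)
    have a2 := (contDiffAt_dd hg (ex i)).differentiableAt (by simp)
    have a3 := hf.differentiableAt (by simp)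
    have a4 := hg.differentiableAt (by simp)
    rw [dd_congr _ e, dd_add (f := fun w => dd (ex i) f w * g w)
      (g := fun w => f w * dd (ex i) g w) _ (a1.mul a4) (a3.mul a2), dd_mul _ a1 a4, dd_mul _ a3 a2]
    ring
  rw [Lop, Lop, dd_mul _ (hf.differentiableAt (by simp)) (hg.differentiableAt (by simp))]
  simp_rw [h2, Finset.sum_add_distrib, ← Finset.mul_sum, ← Finset.sum_mul]
  ring

/-- The exponent of the fundamental solution. -/
noncomputable def cexp (N : ℕ) (z : PSpace N) : ℝ :=
  -z.2 - N / 2 * Real.log (4 * Real.pi * z.2) - ‖z.1‖ ^ 2 / (4 * z.2)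

lemma Kf_eq_exp {z : PSpace N} (h : 0 < z.2) : Kf N z = Real.exp (cexp N z) := by
  rw [Kf, heatK, if_pos h, cexp, Real.rpow_def_of_pos (by positivity), ← Real.exp_add,
    ← Real.exp_add]
  congr 1
  ring

lemma hasFDerivAt_cexp {z : PSpace N} (h : 0 < z.2) :
    HasFDerivAt (cexp N) ((-1 - N / (2 * z.2) + ‖z.1‖ ^ 2 / (4 * z.2 ^ 2)) •
      ContinuousLinearMap.snd ℝ (EuclideanSpace ℝ (Fin N)) ℝ
      - (1 / (2 * z.2)) • (innerSL ℝ z.1).comp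
        (ContinuousLinearMap.fst ℝ (EuclideanSpace ℝ (Fin N)) ℝ)) z := by
  have hs : HasFDerivAt (fun z : PSpace N => z.2)
    (ContinuousLinearMap.snd ℝ (EuclideanSpace ℝ (Fin N)) ℝ) z := hasFDerivAt_snd
  have hn : HasFDerivAt (fun z : PSpace N => ‖z.1‖ ^ 2) _ z := (hasFDerivAt_fst (𝕜 := ℝ)).norm_sq
  have hl := (hs.const_mul (4 * Real.pi)).log (by positivity)
  have hi : HasFDerivAt (fun z : PSpace N => (4 * z.2)⁻¹) _ z :=
    (hasDerivAt_inv (by positivity : (4 * z.2) ≠ 0)).comp_hasFDerivAt z (hs.const_mul 4)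
  have hd := hn.mul hi
  refine ((hs.neg.sub (hl.const_mul (N / 2 : ℝ))).sub hd).congr_fderiv ?_ |>.congr_of_eventuallyEq ?_
  · ext v
    · simp [innerSL_apply_apply]
      field_simp
      ring
    · simp
      field_simp
  · refine Filter.Eventually.of_forall fun w => ?_
    simp [cexp, div_eq_mul_inv]

lemma dd_Kf {z : PSpace N} (h : 0 < z.2) (e : PSpace N) :
    dd e (Kf N) z = Kf N z * ((-1 - N / (2 * z.2) + ‖z.1‖ ^ 2 / (4 * z.2 ^ 2)) * e.2
      - 1 / (2 * z.2) * inner ℝ z.1 e.1) := by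
  have hev : Kf N =ᶠ[nhds z] fun z => Real.exp (cexp N z) := by
    filter_upwards [(continuous_snd.tendsto z).eventually (lt_mem_nhds h)] with w hw
    exact Kf_eq_exp hw
  rw [dd_congr e hev, dd_eq_of_hasFDerivAt (hasFDerivAt_cexp h).exp, Kf_eq_exp h]
  simp

lemma dd_ex_Kf {z : PSpace N} (h : 0 < z.2) (i : Fin N) :
    dd (ex i) (Kf N) z = Kf N z * (-(z.1 i) / (2 * z.2)) := by
  rw [dd_Kf h]
  simp [ex, EuclideanSpace.inner_single_right]
  field_simp

lemma dd_ex_dd_ex_Kf {z : PSpace N} (h : 0 < z.2) (i : Fin N) :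
    dd (ex i) (dd (ex i) (Kf N)) z
      = Kf N z * (z.1 i ^ 2 / (4 * z.2 ^ 2) - 1 / (2 * z.2)) := by
  have hev : dd (ex i) (Kf N) =ᶠ[nhds z] fun z => Kf N z * (-(z.1 i) * (2 * z.2)⁻¹) := by
    filter_upwards [(continuous_snd.tendsto z).eventually (lt_mem_nhds h)] with w hw
    rw [dd_ex_Kf hw]; rfl
  have hz : z ≠ 0 := fun h0 => by simp [h0] at h
  have hi : HasFDerivAt (fun z : PSpace N => z.1 i) ((EuclideanSpace.proj i).comp
      (ContinuousLinearMap.fst ℝ (EuclideanSpace ℝ (Fin N)) ℝ)) z :=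
    (((EuclideanSpace.proj i : EuclideanSpace ℝ (Fin N) →L[ℝ] ℝ)).comp
      (ContinuousLinearMap.fst ℝ (EuclideanSpace ℝ (Fin N)) ℝ)).hasFDerivAt
  have hs : HasFDerivAt (fun z : PSpace N => z.2)
    (ContinuousLinearMap.snd ℝ (EuclideanSpace ℝ (Fin N)) ℝ) z := hasFDerivAt_snd
  have hv : HasFDerivAt (fun z : PSpace N => (2 * z.2)⁻¹) _ z :=
    (hasDerivAt_inv (by positivity : (2 * z.2) ≠ 0)).comp_hasFDerivAt z (hs.const_mul 2)
  have hq : HasFDerivAt (fun z : PSpace N => -(z.1 i) * (2 * z.2)⁻¹) _ z := hi.neg.mul hv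
  rw [dd_congr _ hev, dd_mul _ ((contDiffAt_Kf hz).differentiableAt (by simp))
    hq.differentiableAt, dd_ex_Kf h, dd_eq_of_hasFDerivAt hq]
  simp [ex]
  field_simp
  ring

lemma Lop_Kf {z : PSpace N} (h : 0 < z.2) : Lop (Kf N) z = 0 := by
  rw [Lop, dd_Kf h]
  simp_rw [dd_ex_dd_ex_Kf h]
  rw [← Finset.mul_sum, Finset.sum_sub_distrib, ← Finset.sum_div]
  simp only [et, inner_zero_right, Finset.sum_const, Finset.card_univ, Fintype.card_fin,
    nsmul_eq_mul]
  rw [← EuclideanSpace.real_norm_sq_eq]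
  field_simp
  ring

/-- A smooth cutoff in time vanishing for `t ≤ δ` and equal to `1` for `t ≥ 2δ`. -/
noncomputable def tcut (δ t : ℝ) : ℝ := Real.smoothTransition ((t - δ) / δ)

lemma contDiff_tcut (δ : ℝ) : ContDiff ℝ (⊤ : ℕ∞) (tcut δ) :=
  Real.smoothTransition.contDiff.comp ((contDiff_id.sub contDiff_const).div_const δ)

lemma tcut_nonneg (δ t : ℝ) : 0 ≤ tcut δ t := Real.smoothTransition.nonneg _

lemma tcut_le_one (δ t : ℝ) : tcut δ t ≤ 1 := Real.smoothTransition.le_one _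

lemma tcut_of_le {δ t : ℝ} (hδ : 0 < δ) (h : t ≤ δ) : tcut δ t = 0 :=
  Real.smoothTransition.zero_of_nonpos (div_nonpos_of_nonpos_of_nonneg (by linarith) hδ.le)

lemma tcut_of_ge {δ t : ℝ} (hδ : 0 < δ) (h : 2 * δ ≤ t) : tcut δ t = 1 :=
  Real.smoothTransition.one_of_one_le ((one_le_div hδ).2 (by linarith))

lemma monotone_tcut {δ : ℝ} (hδ : 0 < δ) : Monotone (tcut δ) := fun a b h =>
  Real.smoothTransition.monotone (div_le_div_of_nonneg_right (by linarith) hδ.le)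

lemma deriv_tcut_nonneg {δ : ℝ} (hδ : 0 < δ) (t : ℝ) : 0 ≤ deriv (tcut δ) t :=
  (monotone_tcut hδ).deriv_nonneg

lemma continuous_deriv_tcut (δ : ℝ) : Continuous (deriv (tcut δ)) :=
  (contDiff_tcut δ).continuous_deriv (by simp)

lemma deriv_tcut_of_notMem {δ t : ℝ} (hδ : 0 < δ) (h : t ∉ Icc δ (2 * δ)) :
    deriv (tcut δ) t = 0 := by
  rw [mem_Icc, not_and_or, not_le, not_le] at h
  rcases h with h | h
  · have : tcut δ =ᶠ[nhds t] fun _ => 0 := by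
      filter_upwards [gt_mem_nhds h] with s hs using tcut_of_le hδ (le_of_lt hs)
    rw [this.deriv_eq]; simp
  · have : tcut δ =ᶠ[nhds t] fun _ => 1 := by
      filter_upwards [lt_mem_nhds h] with s hs using tcut_of_ge hδ (le_of_lt hs)
    rw [this.deriv_eq]; simp

lemma lintegral_deriv_tcut {δ : ℝ} (hδ : 0 < δ) :
    ∫⁻ t in Ioi (0 : ℝ), ENNReal.ofReal (deriv (tcut δ) t) = 1 := by
  have hc := continuous_deriv_tcut δ
  have e : ∫⁻ t in Ioi (0 : ℝ), ENNReal.ofReal (deriv (tcut δ) t)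
      = ∫⁻ t in Ioc δ (2 * δ), ENNReal.ofReal (deriv (tcut δ) t) := by
    rw [← lintegral_indicator measurableSet_Ioi, ← lintegral_indicator measurableSet_Ioc]
    refine lintegral_congr_ae ?_
    filter_upwards [Measure.ae_ne volume δ] with t ht
    simp only [indicator]
    by_cases h : t ∈ Icc δ (2 * δ)
    · rw [if_pos (show t ∈ Ioi 0 from lt_of_lt_of_le hδ h.1),
        if_pos (show t ∈ Ioc δ (2 * δ) from ⟨lt_of_le_of_ne h.1 ht.symm, h.2⟩)]
    · simp [deriv_tcut_of_notMem hδ h]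
  rw [e, ← ofReal_integral_eq_lintegral_ofReal
    ((hc.integrableOn_Icc).mono_set Ioc_subset_Icc_self)
    (Filter.Eventually.of_forall fun t => deriv_tcut_nonneg hδ t),
    ← intervalIntegral.integral_of_le (by linarith),
    intervalIntegral.integral_deriv_eq_sub
      (fun t _ => (contDiff_tcut δ).differentiable (by simp) t) (hc.intervalIntegrable _ _),
    tcut_of_ge hδ le_rfl, tcut_of_le hδ le_rfl]
  simp

/-- The kernel truncated away from `t = 0`. -/
noncomputable def Kd (N : ℕ) (δ : ℝ) (z : PSpace N) : ℝ := tcut δ z.2 * Kf N z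

lemma contDiff_tcut_snd (δ : ℝ) : ContDiff ℝ (⊤ : ℕ∞) fun z : PSpace N => tcut δ z.2 :=
  (contDiff_tcut δ).comp contDiff_snd

lemma contDiff_tcut_mul {δ : ℝ} (hδ : 0 < δ) {f : PSpace N → ℝ}
    (hf : ∀ z, z ≠ 0 → ContDiffAt ℝ (⊤ : ℕ∞) f z) :
    ContDiff ℝ (⊤ : ℕ∞) fun z : PSpace N => tcut δ z.2 * f z := by
  rw [contDiff_iff_contDiffAt]
  intro z
  by_cases h : z = 0
  · have : (fun z : PSpace N => tcut δ z.2 * f z) =ᶠ[nhds z] fun _ => 0 := by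
      have hz : z.2 < δ := by simp [h, hδ]
      filter_upwards [(continuous_snd.tendsto z).eventually (gt_mem_nhds hz)] with w hw
      rw [tcut_of_le hδ (le_of_lt hw), zero_mul]
    exact contDiffAt_const.congr_of_eventuallyEq this
  · exact (contDiff_tcut_snd δ).contDiffAt.mul (hf z h)

lemma dd_ex_tcut (δ : ℝ) (i : Fin N) (z : PSpace N) :
    dd (ex i) (fun z : PSpace N => tcut δ z.2) z = 0 := by
  have h : HasFDerivAt (fun z : PSpace N => tcut δ z.2) _ z := ((contDiff_tcut δ).differentiable (by simp) z.2).hasDerivAt.comp_hasFDerivAt z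
    (hasFDerivAt_snd (𝕜 := ℝ) (E := EuclideanSpace ℝ (Fin N)) (F := ℝ))
  rw [dd_eq_of_hasFDerivAt h]
  simp [ex]

lemma dd_et_tcut (δ : ℝ) (z : PSpace N) :
    dd (et N) (fun z : PSpace N => tcut δ z.2) z = deriv (tcut δ) z.2 := by
  have h : HasFDerivAt (fun z : PSpace N => tcut δ z.2) _ z := ((contDiff_tcut δ).differentiable (by simp) z.2).hasDerivAt.comp_hasFDerivAt z
    (hasFDerivAt_snd (𝕜 := ℝ) (E := EuclideanSpace ℝ (Fin N)) (F := ℝ))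
  rw [dd_eq_of_hasFDerivAt h]
  simp [et]

/-- The time cutoff commutes with spatial derivatives. -/
lemma dd_ex_tcut_mul {δ : ℝ} (hδ : 0 < δ) {f : PSpace N → ℝ}
    (hf : ∀ z, z ≠ 0 → ContDiffAt ℝ (⊤ : ℕ∞) f z) (i : Fin N) (z : PSpace N) :
    dd (ex i) (fun z : PSpace N => tcut δ z.2 * f z) z = tcut δ z.2 * dd (ex i) f z := by
  by_cases h : z = 0
  · have hz : z.2 < δ := by simp [h, hδ]
    have : (fun z : PSpace N => tcut δ z.2 * f z) =ᶠ[nhds z] fun _ => 0 := by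
      filter_upwards [(continuous_snd.tendsto z).eventually (gt_mem_nhds hz)] with w hw
      rw [tcut_of_le hδ (le_of_lt hw), zero_mul]
    rw [dd_congr _ this, tcut_of_le hδ hz.le]
    simp [dd]
  · rw [dd_mul _ ((contDiff_tcut_snd δ).differentiable (by simp) z)
      ((hf z h).differentiableAt (by simp)), dd_ex_tcut]
    ring

/-- `(∂_t - Δ + 1)` applied to the time-truncated function. -/
lemma Lop_tcut_mul {δ : ℝ} (hδ : 0 < δ) {f : PSpace N → ℝ}
    (hf : ∀ z, z ≠ 0 → ContDiffAt ℝ (⊤ : ℕ∞) f z) (z : PSpace N) :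
    Lop (fun z : PSpace N => tcut δ z.2 * f z) z
      = tcut δ z.2 * Lop f z + deriv (tcut δ) z.2 * f z := by
  by_cases h : z = 0
  · have hz : z.2 < δ := by simp [h, hδ]
    have : (fun z : PSpace N => tcut δ z.2 * f z) =ᶠ[nhds z] fun _ => 0 := by
      filter_upwards [(continuous_snd.tendsto z).eventually (gt_mem_nhds hz)] with w hw
      rw [tcut_of_le hδ (le_of_lt hw), zero_mul]
    have h0 : ∀ e : PSpace N, dd e (fun _ : PSpace N => (0 : ℝ)) = fun _ => 0 := fun e => by
      ext; simp [dd]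
    rw [Lop, dd_congr _ this]
    simp_rw [dd_dd_congr _ _ this, h0]
    rw [tcut_of_le hδ hz.le, deriv_tcut_of_notMem hδ (fun h => by have := h.1; linarith)]
    simp
  · rw [Lop_mul (contDiff_tcut_snd δ).contDiffAt (hf z h), dd_et_tcut]
    have h0 : ∀ i : Fin N, dd (ex i) (fun z : PSpace N => tcut δ z.2) = fun _ => 0 := fun i => by
      ext; exact dd_ex_tcut δ i _
    simp_rw [h0]
    simp [dd]

/-- Real-valued convolution. -/
noncomputable def cv (f g : PSpace N → ℝ) (z : PSpace N) : ℝ := ∫ w, f w * g (z - w)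

lemma ae_snd_ne (N : ℕ) : ∀ᵐ z : PSpace N, z.2 ≠ 0 := by
  rw [Measure.volume_eq_prod]
  exact Measure.quasiMeasurePreserving_snd.ae (Measure.ae_ne volume (0 : ℝ))

lemma kap_one_eq_withDensity : kap N 1 = volume.withDensity fun z => ENNReal.ofReal (Kf N z) := by
  rw [kap, heatMeas]
  congr 1 with z
  rw [Kf, ENNReal.ofReal_mul (Real.exp_pos _).le]
  simp

lemma integral_kap_one (g : PSpace N → ℝ) : ∫ w, g w ∂kap N 1 = ∫ w, Kf N w * g w := by
  rw [kap_one_eq_withDensity, integral_withDensity_eq_integral_toReal_smul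
    measurable_Kf.ennreal_ofReal (Filter.Eventually.of_forall fun _ => ENNReal.ofReal_lt_top)]
  simp [ENNReal.toReal_ofReal (Kf_nonneg _)]

lemma pot_one_eq_cv (G : PSpace N → ℝ) (z : PSpace N) : pot N 1 G z = cv (Kf N) G z :=
  integral_kap_one _

lemma integrable_Kf : Integrable (Kf N) := by
  refine ⟨measurable_Kf.aestronglyMeasurable, ?_⟩
  rw [hasFiniteIntegral_iff_ofReal (Filter.Eventually.of_forall Kf_nonneg)]
  have := kap_univ (N := N) one_pos
  rw [kap_one_eq_withDensity, withDensity_apply _ MeasurableSet.univ, setLIntegral_univ] at this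
  rw [this]; exact ENNReal.ofReal_lt_top

lemma integrable_mul_BM {f g : PSpace N → ℝ} (hf : Integrable f) (hg : BM g) :
    Integrable fun w => f w * g w := by
  obtain ⟨a, C, hC⟩ := hg
  exact hf.mul_bdd a.aestronglyMeasurable (Filter.Eventually.of_forall hC)

lemma integrable_cv {f g : PSpace N → ℝ} (hf : Integrable f) (hg : BM g) (z : PSpace N) :
    Integrable fun w => f w * g (z - w) := integrable_mul_BM hf (hg.comp_sub z)

lemma integral_mul_dd {f g : PSpace N → ℝ} (hf : ContDiff ℝ (⊤ : ℕ∞) f) (hg : Tst g)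
    (e : PSpace N) : ∫ w, f w * dd e g w = -∫ w, dd e f w * g w := by
  refine integral_mul_fderiv_eq_neg_fderiv_mul_of_integrable ?_ ?_ ?_ ?_ ?_
  · exact (Tst.mul_left (contDiff_dd hf e) hg).integrable
  · exact (Tst.mul_left hf (hg.dd e)).integrable
  · exact (Tst.mul_left hf hg).integrable
  · exact fun x _ => hf.differentiable (by simp) x
  · exact fun x _ => hg.1.differentiable (by simp) x

lemma Tst.comp_sub {g : PSpace N → ℝ} (hg : Tst g) (z : PSpace N) : Tst fun w => g (z - w) :=
  ⟨hg.1.comp (contDiff_const.sub contDiff_id), hg.2.comp_homeomorph (Homeomorph.subLeft z)⟩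

lemma dd_comp_sub {g : PSpace N → ℝ} (hg : Differentiable ℝ g) (z e w : PSpace N) :
    dd e (fun w => g (z - w)) w = -dd e g (z - w) := by
  have h1 : HasFDerivAt (fun w : PSpace N => z - w) (-ContinuousLinearMap.id ℝ (PSpace N)) w :=
    (hasFDerivAt_id w).const_sub z
  have h := (hg (z - w)).hasFDerivAt.comp w h1
  rw [dd_eq_of_hasFDerivAt (f := fun w => g (z - w)) h]
  simp [dd]

/-- Derivatives move across a convolution. -/
lemma cv_dd_right {f g : PSpace N → ℝ} (hf : ContDiff ℝ (⊤ : ℕ∞) f) (hg : Tst g)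
    (e z : PSpace N) : cv f (dd e g) z = cv (dd e f) g z := by
  have h := integral_mul_dd hf (hg.comp_sub z) e
  simp_rw [dd_comp_sub (hg.1.differentiable (by simp)), mul_neg, integral_neg, neg_inj] at h
  exact h

lemma cv_Lop_right {f g : PSpace N → ℝ} (hf : ContDiff ℝ (⊤ : ℕ∞) f) (hg : Tst g)
    (z : PSpace N) : cv f (Lop g) z = cv (Lop f) g z := by
  have i1 : ∀ {f g : PSpace N → ℝ}, ContDiff ℝ (⊤ : ℕ∞) f → Tst g →
      Integrable fun w => f w * g (z - w) := fun {f g} hf hg =>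
    (Tst.mul_left hf (hg.comp_sub z)).integrable
  have hi : ∀ i : Fin N, ContDiff ℝ (⊤ : ℕ∞) (dd (ex i) f) := fun i => contDiff_dd hf _
  have h2 : ∀ i : Fin N, cv f (dd (ex i) (dd (ex i) g)) z = cv (dd (ex i) (dd (ex i) f)) g z :=
    fun i => by rw [cv_dd_right hf (hg.dd _), cv_dd_right (hi i) hg]
  have h3 := cv_dd_right hf hg (et N) z
  have l : cv f (Lop g) z
      = cv f (dd (et N) g) z - ∑ i, cv f (dd (ex i) (dd (ex i) g)) z + cv f g z := by
    simp only [cv, Lop, mul_add, mul_sub, Finset.mul_sum]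
    rw [integral_add _ (i1 hf hg), integral_sub (i1 hf (hg.dd _)), integral_finsetSum]
    · exact fun i _ => i1 hf ((hg.dd _).dd _)
    · exact integrable_finsetSum _ fun i _ => i1 hf ((hg.dd _).dd _)
    · exact (i1 hf (hg.dd _)).sub (integrable_finsetSum _ fun i _ => i1 hf ((hg.dd _).dd _))
  have r : cv (Lop f) g z
      = cv (dd (et N) f) g z - ∑ i, cv (dd (ex i) (dd (ex i) f)) g z + cv f g z := by
    simp only [cv, Lop, add_mul, sub_mul, Finset.sum_mul]
    rw [integral_add _ (i1 hf hg), integral_sub (i1 (contDiff_dd hf _) hg), integral_finsetSum]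
    · exact fun i _ => i1 (contDiff_dd (hi i) _) hg
    · exact integrable_finsetSum _ fun i _ => i1 (contDiff_dd (hi i) _) hg
    · exact (i1 (contDiff_dd hf _) hg).sub
        (integrable_finsetSum _ fun i _ => i1 (contDiff_dd (hi i) _) hg)
  rw [l, r, h3]
  simp_rw [h2]

/-- Pointwise Gaussian domination by the kernel at twice the time. -/
lemma heatK_le_heatK_two {y : EuclideanSpace ℝ (Fin N)} {s : ℝ} (hs : 0 < s) :
    heatK N (y, s) = 2 ^ ((N : ℝ) / 2) * Real.exp (-‖y‖ ^ 2 / (8 * s)) * heatK N (y, 2 * s) := by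
  rw [heatK_of_pos hs, heatK_of_pos (by positivity)]
  have hp : (0 : ℝ) ≤ 4 * Real.pi * s := by have := Real.pi_pos; positivity
  have h1 : (4 * Real.pi * (2 * s)) ^ (-(N : ℝ) / 2)
      = 2 ^ (-(N : ℝ) / 2) * (4 * Real.pi * s) ^ (-(N : ℝ) / 2) := by
    rw [← Real.mul_rpow (by norm_num) hp]; congr 1; ring
  have h2 : (2 : ℝ) ^ ((N : ℝ) / 2) * 2 ^ (-(N : ℝ) / 2) = 1 := by
    rw [← Real.rpow_add (by norm_num)]; ring_nf; simp
  have h3 : -‖y‖ ^ 2 / (4 * s) = -‖y‖ ^ 2 / (8 * s) + -‖y‖ ^ 2 / (4 * (2 * s)) := by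
    field_simp; ring
  rw [h1, h3, Real.exp_add]
  calc _ = (2 ^ ((N : ℝ) / 2) * 2 ^ (-(N : ℝ) / 2)) * ((4 * Real.pi * s) ^ (-(N : ℝ) / 2)
        * (Real.exp (-‖y‖ ^ 2 / (8 * s)) * Real.exp (-‖y‖ ^ 2 / (4 * (2 * s))))) := by
        rw [h2, one_mul]
    _ = _ := by ring

section approx

/-- The approximate identity obtained by differentiating the time cutoff. -/
noncomputable def nuM (N : ℕ) (δ : ℝ) : Measure (PSpace N) :=
  volume.withDensity fun w => ENNReal.ofReal (deriv (tcut δ) w.2 * Kf N w)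

lemma measurable_nuDens (δ : ℝ) : Measurable fun w : PSpace N => deriv (tcut δ) w.2 * Kf N w :=
  ((continuous_deriv_tcut δ).measurable.comp measurable_snd).mul measurable_Kf

lemma nuM_eq {δ : ℝ} (hδ : 0 < δ) : nuM N δ = heatMeas N fun s =>
    ENNReal.ofReal (deriv (tcut δ) s * Real.exp (-s)) := by
  rw [nuM, heatMeas]
  congr 1 with w
  rw [Kf, ← mul_assoc, ENNReal.ofReal_mul
    (mul_nonneg (deriv_tcut_nonneg hδ _) (Real.exp_pos _).le)]

lemma measurable_nuW (δ : ℝ) :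
    Measurable fun s => ENNReal.ofReal (deriv (tcut δ) s * Real.exp (-s)) :=
  ((continuous_deriv_tcut δ).mul (by fun_prop)).measurable.ennreal_ofReal

lemma nuM_univ_le {δ : ℝ} (hδ : 0 < δ) : nuM N δ univ ≤ 1 := by
  rw [nuM_eq hδ, heatMeas_univ (measurable_nuW δ), ← lintegral_deriv_tcut hδ]
  refine setLIntegral_mono' measurableSet_Ioi fun s hs => ENNReal.ofReal_le_ofReal ?_
  exact mul_le_of_le_one_right (deriv_tcut_nonneg hδ _)
    (Real.exp_le_one_iff.2 (by simpa using le_of_lt hs))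

lemma le_nuM_univ {δ : ℝ} (hδ : 0 < δ) : ENNReal.ofReal (Real.exp (-(2 * δ))) ≤ nuM N δ univ := by
  rw [nuM_eq hδ, heatMeas_univ (measurable_nuW δ), ← mul_one (ENNReal.ofReal _),
    ← lintegral_deriv_tcut hδ, ← lintegral_const_mul' _ _ ENNReal.ofReal_ne_top]
  refine setLIntegral_mono' measurableSet_Ioi fun s _ => ?_
  rw [← ENNReal.ofReal_mul (Real.exp_pos _).le, mul_comm]
  refine ENNReal.ofReal_le_ofReal ?_
  by_cases h : s ∈ Icc δ (2 * δ)
  · exact mul_le_mul_of_nonneg_left (Real.exp_le_exp.2 (by linarith [h.2])) (deriv_tcut_nonneg hδ _)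
  · simp [deriv_tcut_of_notMem hδ h]

lemma nuM_far_le {δ η : ℝ} (hδ : 0 < δ) (hη : 2 * δ < η) :
    nuM N δ {w | η ≤ ‖w‖} ≤
      ENNReal.ofReal (2 ^ ((N : ℝ) / 2) * Real.exp (-η ^ 2 / (16 * δ))) := by
  have hm : MeasurableSet {w : PSpace N | η ≤ ‖w‖} := measurableSet_le measurable_const (by fun_prop)
  rw [nuM_eq hδ, ← lintegral_indicator_one hm, lintegral_heatMeas (measurable_nuW δ)
    (measurable_one.indicator hm), ← mul_one (ENNReal.ofReal (_ * _)), ← lintegral_deriv_tcut hδ,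
    ← lintegral_const_mul' _ _ ENNReal.ofReal_ne_top]
  refine setLIntegral_mono' measurableSet_Ioi fun s (hs : 0 < s) => ?_
  by_cases h : s ∈ Icc δ (2 * δ)
  · rw [mul_comm]
    refine mul_le_mul' ?_ (ENNReal.ofReal_le_ofReal (mul_le_of_le_one_right
      (deriv_tcut_nonneg hδ _) (Real.exp_le_one_iff.2 (by linarith))))
    calc _ ≤ ∫⁻ y, ENNReal.ofReal (2 ^ ((N : ℝ) / 2) * Real.exp (-η ^ 2 / (16 * δ))) *
          ENNReal.ofReal (heatK N (y, 2 * s)) := by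
          refine lintegral_mono fun y => ?_
          simp only [indicator, mem_setOf_eq]
          split_ifs with hy
          · have hyη : η ≤ ‖y‖ := by
              rw [Prod.norm_def] at hy
              rcases le_max_iff.1 hy with h' | h'
              · exact h'
              · rw [Real.norm_of_nonneg hs.le] at h'; linarith [h.2]
            rw [Pi.one_apply, mul_one, heatK_le_heatK_two hs,
              ENNReal.ofReal_mul (by positivity)]
            gcongr ?_ * _
            refine ENNReal.ofReal_le_ofReal ?_
            gcongr 2 ^ ((N : ℝ) / 2) * Real.exp ?_
            rw [neg_div, neg_div, neg_le_neg_iff]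
            have : 0 < η := by linarith
            exact div_le_div₀ (sq_nonneg _) (by gcongr) (by positivity) (by linarith [h.2])
          · simp
      _ = _ := by
        rw [lintegral_const_mul' _ _ ENNReal.ofReal_ne_top, lintegral_heatK (by positivity),
          mul_one]
  · simp [deriv_tcut_of_notMem hδ h]

lemma integral_nuM {δ : ℝ} (hδ : 0 < δ) (g : PSpace N → ℝ) :
    ∫ w, g w ∂nuM N δ = ∫ w, deriv (tcut δ) w.2 * Kf N w * g w := by
  rw [nuM, integral_withDensity_eq_integral_toReal_smul (measurable_nuDens δ).ennreal_ofReal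
    (Filter.Eventually.of_forall fun _ => ENNReal.ofReal_lt_top)]
  simp [ENNReal.toReal_ofReal (mul_nonneg (deriv_tcut_nonneg hδ _) (Kf_nonneg _))]

open Filter Topology in
/-- Uniform concentration of the approximate identity. -/
lemma eventually_nu_close {η ε C : ℝ} (hη : 0 < η) (hε : 0 < ε) (hC : 0 ≤ C) :
    ∀ᶠ δ in 𝓝[>] (0 : ℝ), ∀ (g : PSpace N → ℝ) (c : ℝ), Measurable g → (∀ w, |g w| ≤ C) →
      |c| ≤ C → (∀ w, ‖w‖ < η → |g w - c| ≤ ε) →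
      |(∫ w, deriv (tcut δ) w.2 * Kf N w * g w) - c| ≤ 2 * ε := by
  set ε' := ε / (3 * C + 1)
  have hε' : 0 < ε' := by positivity
  have hCε : 3 * C * ε' ≤ ε := by
    rw [show ε = (3 * C + 1) * ε' by simp only [ε']; field_simp]
    nlinarith
  have t1 : Tendsto (fun δ : ℝ => Real.exp (-(2 * δ))) (𝓝[>] 0) (𝓝 1) := by
    have : Continuous fun δ : ℝ => Real.exp (-(2 * δ)) := by fun_prop
    simpa using (this.tendsto 0).mono_left nhdsWithin_le_nhds
  have t2 : Tendsto (fun δ : ℝ => (2 : ℝ) ^ ((N : ℝ) / 2) * Real.exp (-η ^ 2 / (16 * δ)))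
      (𝓝[>] 0) (𝓝 0) := by
    have h1 : Tendsto (fun δ : ℝ => -(η ^ 2 / 16) * δ⁻¹) (𝓝[>] 0) atBot :=
      (tendsto_inv_nhdsGT_zero).const_mul_atTop_of_neg (by have := sq_pos_of_pos hη; linarith)
    have h2 := (Real.tendsto_exp_atBot.comp h1).const_mul ((2 : ℝ) ^ ((N : ℝ) / 2))
    rw [mul_zero] at h2
    refine h2.congr fun δ => ?_
    simp only [Function.comp]
    congr 2
    ring
  have t3 : ∀ᶠ δ in 𝓝[>] (0 : ℝ), 2 * δ < η := by
    filter_upwards [Ioo_mem_nhdsGT (show 0 < η / 2 by linarith)] with δ h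
    linarith [h.2]
  filter_upwards [self_mem_nhdsWithin, t3, t1.eventually (lt_mem_nhds (by linarith : 1 - ε' < 1)),
    t2.eventually (gt_mem_nhds hε')] with δ (hδ : 0 < δ) h3 h1 h2 g c hg hgC hc hgc
  rw [← integral_nuM hδ]
  have hfin : IsFiniteMeasure (nuM N δ) := ⟨(nuM_univ_le hδ).trans_lt ENNReal.one_lt_top⟩
  have hmle : (nuM N δ).real univ ≤ 1 := by
    have := ENNReal.toReal_mono ENNReal.one_ne_top (nuM_univ_le (N := N) hδ)
    rwa [ENNReal.toReal_one] at this
  have hmge : 1 - ε' ≤ (nuM N δ).real univ := by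
    have := ENNReal.toReal_mono (measure_ne_top _ _) (le_nuM_univ (N := N) hδ)
    rw [ENNReal.toReal_ofReal (Real.exp_pos _).le] at this
    exact h1.le.trans this
  set S := {w : PSpace N | η ≤ ‖w‖}
  have hS : MeasurableSet S := measurableSet_le measurable_const (by fun_prop)
  have hfar : (nuM N δ).real S ≤ ε' := by
    have := ENNReal.toReal_mono ENNReal.ofReal_ne_top (nuM_far_le (N := N) hδ h3)
    rw [ENNReal.toReal_ofReal (by positivity)] at this
    exact this.trans h2.le
  have hgi : Integrable g (nuM N δ) := BM.integrable ⟨hg, C, hgC⟩ _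
  have hpt : ∀ w, |g w - c| ≤ ε + S.indicator (fun _ => 2 * C) w := by
    intro w
    by_cases h : w ∈ S
    · rw [indicator_of_mem h]
      have := (abs_sub (g w) c).trans (add_le_add (hgC w) hc); linarith
    · rw [indicator_of_notMem h, add_zero]; exact hgc w (not_le.1 h)
  have hI : |∫ w, (g w - c) ∂nuM N δ| ≤ ε + 2 * C * ε' := by
    have hib : Integrable (fun w => ε + S.indicator (fun _ => 2 * C) w) (nuM N δ) :=
      (integrable_const ε).add ((integrable_const (2 * C)).indicator hS)
    refine (abs_integral_le_integral_abs).trans ((integral_mono (hgi.sub (integrable_const c)).abs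
      hib hpt).trans ?_)
    rw [integral_add (integrable_const ε) ((integrable_const (2 * C)).indicator hS),
      integral_indicator hS, setIntegral_const, integral_const, smul_eq_mul, smul_eq_mul]
    nlinarith
  rw [integral_sub hgi (integrable_const c), integral_const, smul_eq_mul] at hI
  have h5 : |(nuM N δ).real univ * c - c| ≤ C * ε' := by
    rw [show (nuM N δ).real univ * c - c = -((1 - (nuM N δ).real univ) * c) by ring, abs_neg,
      abs_mul, abs_of_nonneg (by linarith), mul_comm]
    exact mul_le_mul hc (by linarith) (by linarith) hC
  calc _ = |((∫ w, g w ∂nuM N δ) - (nuM N δ).real univ * c) + ((nuM N δ).real univ * c - c)| := by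
        congr 1; ring
    _ ≤ _ := (abs_add_le _ _).trans (by linarith)

end approx

lemma cv_comm (f g : PSpace N → ℝ) (z : PSpace N) : cv f g z = cv g f z := by
  rw [cv, ← integral_sub_left_eq_self _ volume z]
  simp only [cv, sub_sub_cancel, mul_comm]

lemma abs_cv_le {f g : PSpace N → ℝ} (hf : Integrable f) (hg : Measurable g) {C : ℝ}
    (hC : ∀ z, |g z| ≤ C) (z : PSpace N) : |cv f g z| ≤ C * ∫ w, |f w| := by
  rw [← integral_const_mul]
  refine abs_integral_le_integral_abs.trans (integral_mono
    (integrable_cv hf ⟨hg, C, hC⟩ z).abs (hf.abs.const_mul C) fun w => ?_)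
  simp only [abs_mul]
  rw [mul_comm]
  exact mul_le_mul_of_nonneg_right (hC _) (abs_nonneg _)

lemma cv_sub_left {f f' g : PSpace N → ℝ} (hf : Integrable f) (hf' : Integrable f') (hg : BM g)
    (z : PSpace N) : cv (fun w => f w - f' w) g z = cv f g z - cv f' g z := by
  simp only [cv, sub_mul]
  exact integral_sub (integrable_cv hf hg z) (integrable_cv hf' hg z)

lemma cv_add_left {f f' g : PSpace N → ℝ} (hf : Integrable f) (hf' : Integrable f') (hg : BM g)
    (z : PSpace N) : cv (fun w => f w + f' w) g z = cv f g z + cv f' g z := by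
  simp only [cv, add_mul]
  exact integral_add (integrable_cv hf hg z) (integrable_cv hf' hg z)

/-- Convolution is associative. -/
lemma cv_assoc {f g h : PSpace N → ℝ} (hf : Integrable f) (hg : Integrable g) (hh : BM h)
    (z : PSpace N) : cv f (cv g h) z = cv (cv f g) h z := by
  obtain ⟨hm, C, hC⟩ := hh
  have hi : Integrable (fun p : PSpace N × PSpace N => f p.2 * g (p.1 - p.2) * h (z - p.1))
      (volume.prod volume) := by
    have h1 := Integrable.convolution_integrand (ContinuousLinearMap.mul ℝ ℝ) (μ := volume)
      (ν := volume) hf hg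
    exact h1.mul_bdd (hm.comp (measurable_const.sub measurable_fst)).aestronglyMeasurable
      (Filter.Eventually.of_forall fun _ => hC _)
  calc cv f (cv g h) z = ∫ w, ∫ y, f w * g (y - w) * h (z - y) := by
        refine integral_congr_ae (Filter.Eventually.of_forall fun w => ?_)
        simp only [cv]
        rw [← integral_const_mul, ← integral_sub_right_eq_self _ w]
        simp only [mul_assoc, sub_sub_sub_cancel_right]
    _ = ∫ y, ∫ w, f w * g (y - w) * h (z - y) := (integral_integral_swap hi).symm
    _ = _ := by simp only [cv, integral_mul_const]

section limits

open Filter Topology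

lemma integrable_tcut_mul {f : PSpace N → ℝ} (hf : Integrable f) (δ : ℝ) :
    Integrable fun w : PSpace N => tcut δ w.2 * f w := by
  refine hf.bdd_mul (c := 1) ((contDiff_tcut δ).continuous.comp
    continuous_snd).aestronglyMeasurable (Eventually.of_forall fun w => ?_)
  rw [Real.norm_of_nonneg (tcut_nonneg _ _)]
  exact tcut_le_one _ _

lemma tendsto_integral_tcut {f : PSpace N → ℝ} (hf : Integrable f) (h0 : ∀ w, w.2 < 0 → f w = 0) :
    Tendsto (fun δ => ∫ w, |tcut δ w.2 * f w - f w|) (𝓝[>] 0) (𝓝 0) := by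
  have h := tendsto_integral_filter_of_dominated_convergence (l := 𝓝[>] (0 : ℝ))
    (F := fun δ (w : PSpace N) => |tcut δ w.2 * f w - f w|) (f := fun _ => (0 : ℝ))
    (μ := (volume : Measure (PSpace N))) (fun w => |f w|) ?_ ?_ hf.abs ?_
  · simpa using h
  · exact Eventually.of_forall fun δ => ((integrable_tcut_mul hf δ).sub hf).abs.1
  · refine Eventually.of_forall fun δ => Eventually.of_forall fun w => ?_
    rw [Real.norm_of_nonneg (abs_nonneg _),
      show tcut δ w.2 * f w - f w = -((1 - tcut δ w.2) * f w) by ring, abs_neg, abs_mul]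
    refine mul_le_of_le_one_left (abs_nonneg _) ?_
    rw [abs_of_nonneg (by linarith [tcut_le_one δ w.2])]
    linarith [tcut_nonneg δ w.2]
  · filter_upwards [ae_snd_ne N] with w hw
    refine tendsto_nhds_of_eventually_eq ?_
    rcases lt_or_gt_of_ne hw with h | h
    · exact Eventually.of_forall fun δ => by rw [h0 w h]; simp
    · filter_upwards [Ioo_mem_nhdsGT (show 0 < w.2 / 2 by linarith)] with δ hδ
      rw [tcut_of_ge hδ.1 (by linarith [hδ.2])]
      simp

lemma eventually_cv_tcut {f : PSpace N → ℝ} (hf : Integrable f) (h0 : ∀ w, w.2 < 0 → f w = 0)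
    {C ε : ℝ} (hε : 0 < ε) :
    ∀ᶠ δ in 𝓝[>] (0 : ℝ), ∀ g : PSpace N → ℝ, Measurable g → (∀ z, |g z| ≤ C) →
      ∀ z, |cv (fun w => tcut δ w.2 * f w) g z - cv f g z| ≤ ε := by
  have h := (tendsto_integral_tcut hf h0).const_mul C
  rw [mul_zero] at h
  filter_upwards [h.eventually (gt_mem_nhds hε)] with δ hδ g hg hC z
  rw [← cv_sub_left (integrable_tcut_mul hf δ) hf ⟨hg, C, hC⟩]
  exact (abs_cv_le ((integrable_tcut_mul hf δ).sub hf) hg hC z).trans hδ.le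

lemma tendsto_cv_tcut {f g : PSpace N → ℝ} (hf : Integrable f) (h0 : ∀ w, w.2 < 0 → f w = 0)
    (hg : BM g) (z : PSpace N) :
    Tendsto (fun δ => cv (fun w => tcut δ w.2 * f w) g z) (𝓝[>] 0) (𝓝 (cv f g z)) := by
  obtain ⟨hm, C, hC⟩ := hg
  rw [Metric.tendsto_nhds]
  intro ε hε
  filter_upwards [eventually_cv_tcut hf h0 (C := C) (half_pos hε)] with δ h
  exact (h g hm hC z).trans_lt (by linarith)

lemma Kf_of_neg (w : PSpace N) (h : w.2 < 0) : Kf N w = 0 := Kf_of_nonpos h.le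

lemma contDiff_Kd {δ : ℝ} (hδ : 0 < δ) : ContDiff ℝ (⊤ : ℕ∞) (Kd N δ) :=
  contDiff_tcut_mul hδ fun _ => contDiffAt_Kf

lemma Lop_Kd {δ : ℝ} (hδ : 0 < δ) (z : PSpace N) :
    Lop (Kd N δ) z = deriv (tcut δ) z.2 * Kf N z := by
  unfold Kd
  rw [Lop_tcut_mul hδ fun _ => contDiffAt_Kf]
  by_cases h : 0 < z.2
  · rw [Lop_Kf h]; ring
  · rw [tcut_of_le hδ (by linarith)]; ring

lemma tendsto_nu {g : PSpace N → ℝ} (hg : BM g) (hc : ContinuousAt g 0) :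
    Tendsto (fun δ => ∫ w, deriv (tcut δ) w.2 * Kf N w * g w) (𝓝[>] 0) (𝓝 (g 0)) := by
  obtain ⟨hm, C, hC⟩ := hg
  rw [Metric.tendsto_nhds]
  intro ε hε
  obtain ⟨η, hη, h⟩ := Metric.continuousAt_iff.1 hc (ε / 3) (by positivity)
  filter_upwards [eventually_nu_close (N := N) hη (ε := ε / 3) (by positivity)
    ((abs_nonneg _).trans (hC 0))] with δ hδ
  refine (hδ g (g 0) hm hC (hC 0) fun w hw => (h (by simpa using hw)).le).trans_lt ?_
  linarith

/-- `Kf` is a fundamental solution of `Lop`. -/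
lemma cv_Kf_Lop {θ : PSpace N → ℝ} (hθ : Tst θ) (z : PSpace N) : cv (Kf N) (Lop θ) z = θ z := by
  have h1 := tendsto_cv_tcut integrable_Kf Kf_of_neg hθ.Lop.bm z
  have h2 := tendsto_nu (hθ.bm.comp_sub z)
    ((hθ.1.continuous.comp (continuous_const.sub continuous_id)).continuousAt)
  rw [sub_zero] at h2
  refine tendsto_nhds_unique (h1.congr' ?_) h2
  filter_upwards [self_mem_nhdsWithin] with δ (hδ : 0 < δ)
  have := cv_Lop_right (contDiff_Kd hδ) hθ z
  simp only [cv, Lop_Kd hδ] at this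
  exact this

/-- Very weak formulation of the equation for a potential. -/
lemma cv_Lop_pot {θ G : PSpace N → ℝ} (hθ : Tst θ) (hG : BM G) (z : PSpace N) :
    cv (Lop θ) (pot N 1 G) z = cv θ G z := by
  have : pot N 1 G = cv (Kf N) G := funext (pot_one_eq_cv G)
  rw [this, cv_assoc hθ.Lop.integrable integrable_Kf hG]
  congr 1
  ext w
  rw [cv_comm, cv_Kf_Lop hθ]

end limits

section cutoff

open Filter Topology

lemma tsupport_dd_subset (f : PSpace N → ℝ) (e : PSpace N) : tsupport (dd e f) ⊆ tsupport f := by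
  refine closure_minimal (fun z hz => ?_) (isClosed_tsupport f)
  by_contra h
  exact hz (by simp [dd, fderiv_of_notMem_tsupport ℝ h])

lemma dd_of_notMem {f : PSpace N → ℝ} {e z : PSpace N} (h : z ∉ tsupport f) : dd e f z = 0 :=
  image_eq_zero_of_notMem_tsupport fun h' => h (tsupport_dd_subset f e h')

lemma dd_of_eventually_const {f : PSpace N → ℝ} {e z : PSpace N} {c : ℝ}
    (h : f =ᶠ[𝓝 z] fun _ => c) : dd e f z = 0 := by
  rw [dd_congr e h]; simp [dd]

/-- The kernel cut off to a neighbourhood of the origin. -/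
noncomputable def Gam (χ : PSpace N → ℝ) (z : PSpace N) : ℝ := χ z * Kf N z

/-- The commutator of the heat operator with the cutoff, applied to the kernel. -/
noncomputable def th (χ : PSpace N → ℝ) (z : PSpace N) : ℝ :=
  (dd (et N) χ z - ∑ i, dd (ex i) (dd (ex i) χ) z) * Kf N z
    - 2 * ∑ i, dd (ex i) χ z * dd (ex i) (Kf N) z

/-- Cutoff functions equal to one near the origin. -/
def Cut (χ : PSpace N → ℝ) : Prop := Tst χ ∧ χ =ᶠ[𝓝 0] fun _ => 1

variable {χ : PSpace N → ℝ}

lemma th_of_notMem {z : PSpace N} (h : z ∉ tsupport χ) : th χ z = 0 := by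
  have h2 : ∀ i, dd (ex i) (dd (ex i) χ) z = 0 := fun i =>
    dd_of_notMem fun h' => h (tsupport_dd_subset _ _ h')
  simp [th, dd_of_notMem h, h2]

lemma tst_th (hχ : Cut χ) : Tst (th χ) := by
  refine ⟨contDiff_iff_contDiffAt.2 fun z => ?_, HasCompactSupport.intro' hχ.1.2
    (isClosed_tsupport χ) fun z hz => th_of_notMem hz⟩
  by_cases hz : z = 0
  · subst hz
    have : th χ =ᶠ[𝓝 0] fun _ => 0 := by
      filter_upwards [hχ.2.eventuallyEq_nhds] with w hw
      have h1 : ∀ e, dd e χ w = 0 := fun e => dd_of_eventually_const hw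
      have h2 : ∀ e e', dd e (dd e' χ) w = 0 := fun e e' => by
        rw [dd_dd_congr e e' hw]
        have : dd e' (fun _ : PSpace N => (1 : ℝ)) = fun _ => 0 := by ext; simp [dd]
        rw [this]; simp [dd]
      simp [th, h1, h2]
    exact contDiffAt_const.congr_of_eventuallyEq this
  · have hK := contDiffAt_Kf hz
    have hd : ∀ e, ContDiffAt ℝ (⊤ : ℕ∞) (dd e χ) z := fun e => (contDiff_dd hχ.1.1 e).contDiffAt
    have hdd : ∀ e e', ContDiffAt ℝ (⊤ : ℕ∞) (dd e (dd e' χ)) z := fun e e' =>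
      (contDiff_dd (contDiff_dd hχ.1.1 e') e).contDiffAt
    exact (((hd _).sub (ContDiffAt.sum fun i _ => hdd _ _)).mul hK).sub
      (contDiffAt_const.mul (ContDiffAt.sum fun i _ => (hd _).mul (contDiffAt_dd hK _)))

lemma contDiffAt_Gam (hχ : Tst χ) {z : PSpace N} (hz : z ≠ 0) :
    ContDiffAt ℝ (⊤ : ℕ∞) (Gam χ) z := hχ.1.contDiffAt.mul (contDiffAt_Kf hz)

lemma tst_tcut_mul {f : PSpace N → ℝ} (hf : ∀ z, z ≠ 0 → ContDiffAt ℝ (⊤ : ℕ∞) f z)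
    (hs : HasCompactSupport f) {δ : ℝ} (hδ : 0 < δ) : Tst fun z => tcut δ z.2 * f z :=
  ⟨contDiff_tcut_mul hδ hf, hs.mul_left⟩

lemma hasCompactSupport_Gam (hχ : Tst χ) : HasCompactSupport (Gam χ) := hχ.2.mul_right

lemma tst_Gamd (hχ : Tst χ) {δ : ℝ} (hδ : 0 < δ) : Tst fun z => tcut δ z.2 * Gam χ z :=
  tst_tcut_mul (fun _ => contDiffAt_Gam hχ) (hasCompactSupport_Gam hχ) hδ

lemma Lop_Gamd (hχ : Tst χ) {δ : ℝ} (hδ : 0 < δ) (z : PSpace N) :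
    Lop (fun z => tcut δ z.2 * Gam χ z) z
      = tcut δ z.2 * th χ z + deriv (tcut δ) z.2 * Kf N z * χ z := by
  rw [Lop_tcut_mul hδ fun _ => contDiffAt_Gam hχ]
  by_cases h : 0 < z.2
  · have hz : z ≠ 0 := by rintro rfl; simp at h
    unfold Gam
    rw [Lop_mul hχ.1.contDiffAt (contDiffAt_Kf hz), Lop_Kf h]
    simp only [th]; ring
  · rw [tcut_of_le hδ (by linarith), Gam]; ring

lemma integrable_Gam (hχ : Tst χ) : Integrable (Gam χ) := by
  have := integrable_mul_BM (integrable_Kf (N := N)) hχ.bm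
  exact this.congr (Filter.Eventually.of_forall fun w => mul_comm _ _)

lemma Gam_of_neg (w : PSpace N) (h : w.2 < 0) : Gam χ w = 0 := by rw [Gam, Kf_of_neg w h, mul_zero]

lemma dd_Kf_of_neg (w : PSpace N) (h : w.2 < 0) (e : PSpace N) : dd e (Kf N) w = 0 := by
  refine dd_of_eventually_const (c := 0) ?_
  filter_upwards [(continuous_snd.tendsto w).eventually (gt_mem_nhds h)] with y hy
  exact Kf_of_neg y hy

lemma th_of_neg (w : PSpace N) (h : w.2 < 0) : th χ w = 0 := by
  simp [th, dd_Kf_of_neg w h, Kf_of_neg w h]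

lemma continuous_tcutnu (hχ : Tst χ) {δ : ℝ} (hδ : 0 < δ) : Tst fun z : PSpace N =>
    deriv (tcut δ) z.2 * Kf N z * χ z := by
  refine ⟨ContDiff.mul ?_ hχ.1, hχ.2.mul_left⟩
  have : (fun z => deriv (tcut δ) z.2 * Kf N z) = Lop (Kd N δ) := by
    ext z; rw [Lop_Kd hδ]
  rw [this]
  have h := contDiff_Kd (N := N) hδ
  exact ((contDiff_dd h _).sub (ContDiff.sum fun i _ => contDiff_dd (contDiff_dd h _) _)).add h

/-- Representation of a potential through the truncated kernel. -/
lemma pot_rep (hχ : Cut χ) {G : PSpace N → ℝ} (hG : BM G) {z : PSpace N}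
    (hc : ContinuousAt (pot N 1 G) z) :
    pot N 1 G z = cv (Gam χ) G z - cv (th χ) (pot N 1 G) z := by
  have hu : BM (pot N 1 G) := BM.pot one_pos hG
  have h1 := tendsto_cv_tcut (tst_th hχ).integrable th_of_neg hu z
  have h2 : Tendsto (fun δ => ∫ w, deriv (tcut δ) w.2 * Kf N w * (χ w * pot N 1 G (z - w)))
      (𝓝[>] 0) (𝓝 (pot N 1 G z)) := by
    have h := tendsto_nu (N := N) (g := fun w => χ w * pot N 1 G (z - w)) ?_ ?_
    · simpa [hχ.2.eq_of_nhds] using h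
    · obtain ⟨a, C, hC⟩ := hχ.1.bm
      obtain ⟨b, D, hD⟩ := hu.comp_sub z
      exact ⟨a.mul b, C * D, fun w => by
        rw [abs_mul]; exact mul_le_mul (hC w) (hD w) (abs_nonneg _) ((abs_nonneg _).trans (hC w))⟩
    · refine hχ.1.1.continuous.continuousAt.mul (ContinuousAt.comp (g := pot N 1 G)
        (f := fun w => z - w) (by simpa using hc) (by fun_prop))
  have h3 := tendsto_cv_tcut (integrable_Gam hχ.1) Gam_of_neg hG z
  have h4 : ∀ᶠ δ in 𝓝[>] (0 : ℝ), cv (fun w => tcut δ w.2 * th χ w) (pot N 1 G) z +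
      ∫ w, deriv (tcut δ) w.2 * Kf N w * (χ w * pot N 1 G (z - w))
      = cv (fun w => tcut δ w.2 * Gam χ w) G z := by
    filter_upwards [self_mem_nhdsWithin] with δ (hδ : 0 < δ)
    rw [← cv_Lop_pot (tst_Gamd hχ.1 hδ) hG]
    simp only [cv, Lop_Gamd hχ.1 hδ]
    rw [← integral_add]
    · congr 1; ext w; ring
    · exact integrable_cv (integrable_tcut_mul (tst_th hχ).integrable δ) hu z
    · simpa only [mul_assoc] using integrable_cv (continuous_tcutnu hχ.1 hδ).integrable hu z
  have := tendsto_nhds_unique ((h1.add h2).congr' h4) h3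
  linarith

end cutoff

lemma div_mul_exp_le {r s : ℝ} (hs : 0 < s) (hr : 0 ≤ r) :
    r / (2 * s) * Real.exp (-r ^ 2 / (8 * s)) ≤ s ^ (-(1 : ℝ) / 2) := by
  have hq : 0 < Real.sqrt s := Real.sqrt_pos.2 hs
  have e1 : s ^ (-(1 : ℝ) / 2) = (Real.sqrt s)⁻¹ := by
    rw [Real.sqrt_eq_rpow, ← Real.rpow_neg hs.le]; norm_num
  set q := Real.sqrt s with hqd
  have hs2 : s = q ^ 2 := (Real.sq_sqrt hs.le).symm
  rw [e1, hs2, neg_div, Real.exp_neg]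
  have h1 : r / (2 * q) ≤ Real.exp (r ^ 2 / (8 * q ^ 2)) := by
    refine le_trans ?_ (Real.add_one_le_exp _)
    have : r ^ 2 / (8 * q ^ 2) = (r / (2 * q)) ^ 2 / 2 := by field_simp; norm_num
    rw [this]
    nlinarith [sq_nonneg (r / (2 * q) - 1)]
  calc r / (2 * q ^ 2) * (Real.exp (r ^ 2 / (8 * q ^ 2)))⁻¹
      = q⁻¹ * (r / (2 * q) * (Real.exp (r ^ 2 / (8 * q ^ 2)))⁻¹) := by field_simp
    _ ≤ q⁻¹ * 1 := by
        refine mul_le_mul_of_nonneg_left ?_ (by positivity)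
        rw [← div_eq_mul_inv]
        exact div_le_one_of_le₀ h1 (Real.exp_pos _).le
    _ = q⁻¹ := mul_one _

lemma integrable_dd_ex_Kf (i : Fin N) : Integrable (dd (ex i) (Kf N)) := by
  have h1 : Integrable (fun z : PSpace N => -(z.1 i) / (2 * z.2)) (kap N 1) := by
    have hm : Measurable fun z : PSpace N => -(z.1 i) / (2 * z.2) := by fun_prop
    refine ⟨hm.aestronglyMeasurable, ?_⟩
    rw [HasFiniteIntegral, kap, lintegral_heatMeas (measurable_expWeight 1) hm.enorm]
    have hb : ∀ s ∈ Ioi (0 : ℝ), (ENNReal.ofReal (Real.exp (-1 * s)) *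
        ∫⁻ y : EuclideanSpace ℝ (Fin N), ENNReal.ofReal (heatK N (y, s)) * ‖-(y i) / (2 * s)‖ₑ) ≤
        ENNReal.ofReal (2 ^ ((N : ℝ) / 2)) *
          ENNReal.ofReal (Real.exp (-s) * s ^ ((1 : ℝ) / 2 - 1)) := by
      intro s (hs : 0 < s)
      rw [ENNReal.ofReal_mul (Real.exp_pos _).le, neg_one_mul, mul_left_comm]
      gcongr
      calc _ ≤ ∫⁻ y : EuclideanSpace ℝ (Fin N), (ENNReal.ofReal (2 ^ ((N : ℝ) / 2)) *
            ENNReal.ofReal (s ^ ((1 : ℝ) / 2 - 1))) * ENNReal.ofReal (heatK N (y, 2 * s)) := by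
            refine lintegral_mono fun y => ?_
            rw [Real.enorm_eq_ofReal_abs, ← ENNReal.ofReal_mul (heatK_nonneg _),
              ← ENNReal.ofReal_mul (by positivity), ← ENNReal.ofReal_mul (by positivity)]
            refine ENNReal.ofReal_le_ofReal ?_
            rw [heatK_le_heatK_two hs, abs_div, abs_neg, abs_of_pos (by positivity : 0 < 2 * s)]
            have h2 : |y i| / (2 * s) ≤ ‖y‖ / (2 * s) := by
              gcongr; exact PiLp.norm_apply_le y i
            have h3 := div_mul_exp_le hs (norm_nonneg y)
            have h4 : s ^ ((1 : ℝ) / 2 - 1) = s ^ (-(1 : ℝ) / 2) := by norm_num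
            rw [h4]
            calc _ = 2 ^ ((N : ℝ) / 2) * (|y i| / (2 * s) * Real.exp (-‖y‖ ^ 2 / (8 * s))) *
                  heatK N (y, 2 * s) := by ring
              _ ≤ _ := by
                refine mul_le_mul_of_nonneg_right ?_ (heatK_nonneg _)
                refine mul_le_mul_of_nonneg_left ?_ (by positivity)
                exact (mul_le_mul_of_nonneg_right h2 (Real.exp_pos _).le).trans h3
        _ = _ := by
            rw [lintegral_const_mul' _ _ (ENNReal.mul_ne_top ENNReal.ofReal_ne_top
              ENNReal.ofReal_ne_top), lintegral_heatK (by positivity), mul_one]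
    refine (setLIntegral_mono' measurableSet_Ioi hb).trans_lt ?_
    rw [lintegral_const_mul' _ _ ENNReal.ofReal_ne_top]
    refine ENNReal.mul_lt_top ENNReal.ofReal_lt_top ?_
    have := Real.GammaIntegral_convergent (s := 1 / 2) (by norm_num)
    rw [← ofReal_integral_eq_lintegral_ofReal this ((ae_restrict_mem measurableSet_Ioi).mono
      fun s (hs : 0 < s) => by positivity)]
    exact ENNReal.ofReal_lt_top
  rw [kap_one_eq_withDensity, integrable_withDensity_iff_integrable_smul'
    measurable_Kf.ennreal_ofReal (Filter.Eventually.of_forall fun _ => ENNReal.ofReal_lt_top)] at h1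
  refine h1.congr ?_
  filter_upwards [ae_snd_ne N] with z hz
  rw [ENNReal.toReal_ofReal (Kf_nonneg _), smul_eq_mul]
  rcases lt_or_gt_of_ne hz with h | h
  · rw [dd_Kf_of_neg z h, Kf_of_neg z h, zero_mul]
  · rw [dd_ex_Kf h]

section kernel

variable {χ : PSpace N → ℝ}

lemma dd_Gam (hχ : Tst χ) (e : PSpace N) {z : PSpace N} (hz : z ≠ 0) :
    dd e (Gam χ) z = dd e χ z * Kf N z + χ z * dd e (Kf N) z :=
  dd_mul e (hχ.1.differentiable (by simp) z) ((contDiffAt_Kf hz).differentiableAt (by simp))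

lemma integrable_dd_ex_Gam (hχ : Tst χ) (i : Fin N) : Integrable (dd (ex i) (Gam χ)) := by
  have h := (integrable_mul_BM integrable_Kf (hχ.dd (ex i)).bm).add
    (integrable_mul_BM (integrable_dd_ex_Kf i) hχ.bm)
  refine h.congr ?_
  filter_upwards [ae_snd_ne N] with z hz
  have hz' : z ≠ 0 := by rintro rfl; simp at hz
  simp only [Pi.add_apply]
  rw [dd_Gam hχ _ hz']; ring

lemma dd_Gam_of_neg (w : PSpace N) (h : w.2 < 0) (e : PSpace N) : dd e (Gam χ) w = 0 := by
  refine dd_of_eventually_const (c := 0) ?_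
  filter_upwards [(continuous_snd.tendsto w).eventually (gt_mem_nhds h)] with y hy
  exact Gam_of_neg y hy

end kernel

section deriv

lemma hasDerivAt_line {g g' : PSpace N → ℝ} {e : PSpace N}
    (h : ∀ z, HasLineDerivAt ℝ g (g' z) z e) (z : PSpace N) (t : ℝ) :
    HasDerivAt (fun t : ℝ => g (z + t • e)) (g' (z + t • e)) t := by
  have h1 := h (z + t • e)
  rw [HasLineDerivAt] at h1
  have h2 := HasDerivAt.comp_sub_const t t (by rwa [sub_self])
    (f := fun s : ℝ => g (z + t • e + s • e))
  refine h2.congr_of_eventuallyEq (Filter.Eventually.of_forall fun s => ?_)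
  simp only [add_assoc, ← add_smul]
  congr 3
  ring

lemma Tst.hasLineDerivAt {g : PSpace N → ℝ} (hg : Tst g) (e z : PSpace N) :
    HasLineDerivAt ℝ g (_root_.dd e g z) z e :=
  (hg.1.differentiable (by simp) z).hasFDerivAt.hasLineDerivAt e

lemma continuous_cv {f g : PSpace N → ℝ} (hf : Integrable f) (hg : BM g) (hc : Continuous g) :
    Continuous (cv f g) := by
  obtain ⟨hm, C, hC⟩ := hg
  refine continuous_of_dominated (bound := fun w => |f w| * C) (fun z => ?_) (fun z => ?_)
    (hf.abs.mul_const C) ?_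
  · exact (integrable_cv hf ⟨hm, C, hC⟩ z).1
  · refine Filter.Eventually.of_forall fun w => ?_
    rw [norm_mul]
    exact mul_le_mul_of_nonneg_left (hC _) (abs_nonneg _)
  · exact Filter.Eventually.of_forall fun w =>
      continuous_const.mul (hc.comp (continuous_id.sub continuous_const))

lemma hasLineDerivAt_cv {f g g' : PSpace N → ℝ} (hf : Integrable f) (hg : BM g) (hg' : BM g')
    {e : PSpace N} (h : ∀ z, HasLineDerivAt ℝ g (g' z) z e) (z : PSpace N) :
    HasLineDerivAt ℝ (cv f g) (cv f g' z) z e := by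
  obtain ⟨hm', C, hC⟩ := hg'
  have := (hasDerivAt_integral_of_dominated_loc_of_deriv_le (𝕜 := ℝ) (μ := volume) (x₀ := (0 : ℝ))
    (F := fun t (w : PSpace N) => f w * g (z + t • e - w))
    (F' := fun t (w : PSpace N) => f w * g' (z + t • e - w))
    (bound := fun w => |f w| * C) (s := univ) Filter.univ_mem ?_ ?_ ?_ ?_ (hf.abs.mul_const C) ?_).2
  · simpa [HasLineDerivAt, cv] using this
  · exact Filter.Eventually.of_forall fun t => (integrable_cv hf hg _).1
  · exact integrable_cv hf hg _
  · exact (integrable_cv hf ⟨hm', C, hC⟩ _).1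
  · refine Filter.Eventually.of_forall fun w t _ => ?_
    rw [norm_mul]
    exact mul_le_mul_of_nonneg_left (hC _) (abs_nonneg _)
  · refine Filter.Eventually.of_forall fun w t _ => HasDerivAt.const_mul _ ?_
    have := hasDerivAt_line h (z - w) t
    simpa only [sub_add_eq_add_sub] using this

open Filter Topology

lemma hasLineDerivAt_of_tendstoUniformly {ι : Type*} {l : Filter ι} [l.NeBot]
    {f f' : ι → PSpace N → ℝ} {g g' : PSpace N → ℝ} {e : PSpace N}
    (h : ∀ᶠ n in l, ∀ z, HasLineDerivAt ℝ (f n) (f' n z) z e) (hf : TendstoUniformly f g l)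
    (hf' : TendstoUniformly f' g' l) (z : PSpace N) : HasLineDerivAt ℝ g (g' z) z e := by
  have := hasDerivAt_of_tendstoUniformly (l := l) (f := fun n (t : ℝ) => f n (z + t • e))
    (g := fun t => g (z + t • e)) (f' := fun n t => f' n (z + t • e))
    (g' := fun t => g' (z + t • e)) (hf'.comp _)
    (h.mono fun n hn t => hasDerivAt_line hn z t) (fun t => hf.tendsto_at _) 0
  simpa [HasLineDerivAt] using this

lemma tendstoUniformly_cv_tcut {f g : PSpace N → ℝ} (hf : Integrable f)
    (h0 : ∀ w, w.2 < 0 → f w = 0) (hg : BM g) :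
    TendstoUniformly (fun δ => cv (fun w => tcut δ w.2 * f w) g) (cv f g) (𝓝[>] (0 : ℝ)) := by
  obtain ⟨hm, C, hC⟩ := hg
  rw [Metric.tendstoUniformly_iff]
  intro ε hε
  filter_upwards [eventually_cv_tcut hf h0 (C := C) (half_pos hε)] with δ h z
  rw [dist_comm]
  exact (h g hm hC z).trans_lt (by linarith)

variable {χ : PSpace N → ℝ}

lemma dd_ex_Gamd (hχ : Tst χ) {δ : ℝ} (hδ : 0 < δ) (i : Fin N) :
    dd (ex i) (fun z => tcut δ z.2 * Gam χ z) = fun z => tcut δ z.2 * dd (ex i) (Gam χ) z := by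
  ext z
  exact dd_ex_tcut_mul hδ (fun _ => contDiffAt_Gam hχ) i z

lemma cv_swap_line {f h : PSpace N → ℝ} (hf : Tst f) (hh : Integrable h) (e z : PSpace N) :
    HasLineDerivAt ℝ (cv f h) (cv (dd e f) h z) z e := by
  have := hasLineDerivAt_cv hh hf.bm (hf.dd e).bm (hf.hasLineDerivAt e) z
  rwa [cv_comm h, show cv h f = cv f h from funext fun z => cv_comm _ _ _] at this

lemma continuous_cv_tst {f h : PSpace N → ℝ} (hf : Tst f) (hh : Integrable h) :
    Continuous (cv f h) := by
  rw [show cv f h = cv h f from funext fun z => cv_comm _ _ _]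
  exact continuous_cv hh hf.bm hf.1.continuous

lemma continuous_cv_of_tcut {f h : PSpace N → ℝ} (hf : Integrable f)
    (h0 : ∀ w, w.2 < 0 → f w = 0) (hs : ∀ δ > 0, Tst fun z : PSpace N => tcut δ z.2 * f z)
    (hh : BM h) (hhi : Integrable h) : Continuous (cv f h) := by
  refine (tendstoUniformly_cv_tcut hf h0 hh).continuous (Eventually.frequently ?_)
  filter_upwards [self_mem_nhdsWithin] with δ hδ
  exact continuous_cv_tst (hs δ hδ) hhi

lemma continuous_cv_Gam (hχ : Tst χ) {h : PSpace N → ℝ} (hh : BM h) (hhi : Integrable h) :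
    Continuous (cv (Gam χ) h) :=
  continuous_cv_of_tcut (integrable_Gam hχ) Gam_of_neg (fun _ => tst_Gamd hχ) hh hhi

lemma continuous_cv_dd_Gam (hχ : Tst χ) {h : PSpace N → ℝ} (hh : BM h) (hhi : Integrable h)
    (i : Fin N) : Continuous (cv (dd (ex i) (Gam χ)) h) :=
  continuous_cv_of_tcut (integrable_dd_ex_Gam hχ i) (fun w hw => dd_Gam_of_neg w hw _)
    (fun δ hδ => by rw [← dd_ex_Gamd hχ hδ]; exact (tst_Gamd hχ hδ).dd _) hh hhi

/-- One spatial derivative falls on the truncated kernel. -/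
lemma hasLineDerivAt_cv_Gam (hχ : Tst χ) {h : PSpace N → ℝ} (hh : BM h) (hhi : Integrable h)
    (i : Fin N) (z : PSpace N) :
    HasLineDerivAt ℝ (cv (Gam χ) h) (cv (dd (ex i) (Gam χ)) h z) z (ex i) := by
  refine hasLineDerivAt_of_tendstoUniformly (l := 𝓝[>] (0 : ℝ)) ?_
    (tendstoUniformly_cv_tcut (integrable_Gam hχ) Gam_of_neg hh)
    (tendstoUniformly_cv_tcut (integrable_dd_ex_Gam hχ i)
      (fun w hw => dd_Gam_of_neg w hw _) hh) z
  filter_upwards [self_mem_nhdsWithin] with δ (hδ : 0 < δ) w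
  rw [← dd_ex_Gamd hχ hδ]
  exact cv_swap_line (tst_Gamd hχ hδ) hhi _ _

lemma tendstoUniformly_nu (hχ : Cut χ) {h : PSpace N → ℝ} (hc : Continuous h)
    (hs : HasCompactSupport h) :
    TendstoUniformly (fun δ z => cv (fun w => deriv (tcut δ) w.2 * Kf N w * χ w) h z) h
      (𝓝[>] (0 : ℝ)) := by
  rw [Metric.tendstoUniformly_iff]
  intro ε hε
  obtain ⟨C, hC⟩ := hs.exists_bound_of_continuous hc
  obtain ⟨a, D, hD⟩ := hχ.1.bm
  have hC0 : 0 ≤ C := (norm_nonneg _).trans (hC 0)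
  obtain ⟨η, hη, hu⟩ := Metric.uniformContinuous_iff.1
    (hs.uniformContinuous_of_continuous hc) (ε / 3) (by positivity)
  obtain ⟨η', hη', hχ1⟩ := Metric.eventually_nhds_iff.1 hχ.2
  filter_upwards [eventually_nu_close (N := N) (lt_min hη hη') (ε := ε / 3) (by positivity)
    (by positivity : 0 ≤ max D 1 * C)] with δ hδ z
  rw [dist_comm, Real.dist_eq]
  have h1 := hδ (fun w => χ w * h (z - w)) (h z) (a.mul (hc.measurable.comp (by fun_prop)))
    (fun w => ?_) ?_ (fun w hw => ?_)
  · simp only [cv, mul_assoc] at h1 ⊢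
    linarith
  · rw [abs_mul]
    exact mul_le_mul ((hD w).trans (le_max_left _ _)) (hC _) (abs_nonneg _) (by positivity)
  · exact (hC z).trans (le_mul_of_one_le_left hC0 (le_max_right _ _))
  · rw [hχ1 (y := w) (by simpa using hw.trans_le (min_le_right _ _)), one_mul]
    refine (hu ?_).le
    simpa using hw.trans_le (min_le_left _ _)

/-- Time derivative of a truncated heat potential with spatially `C¹` density. -/
lemma hasLineDerivAt_time (hχ : Cut χ) {h : PSpace N → ℝ} {h' : Fin N → PSpace N → ℝ}
    (hc : Continuous h) (hs : HasCompactSupport h) (hc' : ∀ i, Continuous (h' i))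
    (hs' : ∀ i, HasCompactSupport (h' i)) (hd : ∀ i z, HasLineDerivAt ℝ h (h' i z) z (ex i))
    (z : PSpace N) : HasLineDerivAt ℝ (cv (Gam χ) h) (cv (th χ) h z + h z +
      ∑ i, cv (dd (ex i) (Gam χ)) (h' i) z - cv (Gam χ) h z) z (et N) := by
  have bm : ∀ {h : PSpace N → ℝ}, Continuous h → HasCompactSupport h → BM h := fun hc hs =>
    ⟨hc.measurable, hs.exists_bound_of_continuous hc⟩
  have hh := bm hc hs
  have hhi : Integrable h := hc.integrable_of_hasCompactSupport hs
  refine hasLineDerivAt_of_tendstoUniformly (l := 𝓝[>] (0 : ℝ))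
    (g' := fun z => cv (th χ) h z + h z + ∑ i, cv (dd (ex i) (Gam χ)) (h' i) z - cv (Gam χ) h z)
    (f' := fun δ z => cv (fun w => tcut δ w.2 * th χ w) h z
      + cv (fun w => deriv (tcut δ) w.2 * Kf N w * χ w) h z
      + ∑ i, cv (fun w => tcut δ w.2 * dd (ex i) (Gam χ) w) (h' i) z
      - cv (fun w => tcut δ w.2 * Gam χ w) h z) ?_
    (tendstoUniformly_cv_tcut (integrable_Gam hχ.1) Gam_of_neg hh) ?_ z
  · filter_upwards [self_mem_nhdsWithin] with δ (hδ : 0 < δ) w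
    have ht := tst_Gamd hχ.1 hδ
    have h1 := cv_swap_line ht hhi (et N) w
    have e1 : dd (et N) (fun z => tcut δ z.2 * Gam χ z) = fun z =>
        (((tcut δ z.2 * th χ z) + deriv (tcut δ) z.2 * Kf N z * χ z)
        + ∑ i, dd (ex i) (dd (ex i) fun z => tcut δ z.2 * Gam χ z) z)
        - tcut δ z.2 * Gam χ z := by
      ext z
      rw [← Lop_Gamd hχ.1 hδ, Lop]; ring
    have e2 : ∀ i, cv (dd (ex i) (dd (ex i) fun z => tcut δ z.2 * Gam χ z)) h w
        = cv (fun w => tcut δ w.2 * dd (ex i) (Gam χ) w) (h' i) w := by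
      intro i
      have a1 := cv_swap_line (ht.dd (ex i)) hhi (ex i) w
      have a2 := hasLineDerivAt_cv (ht.dd (ex i)).integrable hh (bm (hc' i) (hs' i)) (hd i) w
      rw [← dd_ex_Gamd hχ.1 hδ]
      exact HasDerivAt.unique a1 a2
    have i1 : Integrable fun z : PSpace N => tcut δ z.2 * th χ z :=
      integrable_tcut_mul (tst_th hχ).integrable δ
    have i2 := (continuous_tcutnu hχ.1 hδ).integrable
    have i3 : ∀ i, Integrable (dd (ex i) (dd (ex i) fun z => tcut δ z.2 * Gam χ z)) := fun i =>
      ((ht.dd _).dd _).integrable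
    convert h1 using 1
    have i4 : Integrable fun z => tcut δ z.2 * th χ z + deriv (tcut δ) z.2 * Kf N z * χ z :=
      i1.add i2
    have i5 : Integrable fun z => ∑ i, dd (ex i) (dd (ex i) fun z => tcut δ z.2 * Gam χ z) z :=
      integrable_finsetSum _ fun i _ => i3 i
    have i6 : Integrable fun z => tcut δ z.2 * th χ z + deriv (tcut δ) z.2 * Kf N z * χ z
        + ∑ i, dd (ex i) (dd (ex i) fun z => tcut δ z.2 * Gam χ z) z := i4.add i5
    rw [e1, cv_sub_left i6 ht.integrable hh, cv_add_left i4 i5 hh, cv_add_left i1 i2 hh]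
    congr 2
    simp_rw [← e2]
    simp only [cv, Finset.sum_mul]
    rw [integral_finsetSum]
    exact fun i _ => integrable_cv (i3 i) hh w
  · have t1 := tendstoUniformly_cv_tcut (tst_th hχ).integrable th_of_neg hh
    have t2 := tendstoUniformly_nu hχ hc hs
    have t3 : TendstoUniformly (fun δ z => ∑ i, cv (fun w => tcut δ w.2 * dd (ex i) (Gam χ) w)
        (h' i) z) (fun z => ∑ i, cv (dd (ex i) (Gam χ)) (h' i) z) (𝓝[>] (0 : ℝ)) := by
      have : ∀ s : Finset (Fin N), TendstoUniformly (fun δ z => ∑ i ∈ s,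
          cv (fun w => tcut δ w.2 * dd (ex i) (Gam χ) w) (h' i) z)
          (fun z => ∑ i ∈ s, cv (dd (ex i) (Gam χ)) (h' i) z) (𝓝[>] (0 : ℝ)) := by
        classical
        intro s
        induction s using Finset.induction_on with
        | empty =>
          simp only [Finset.sum_empty]
          exact fun u hu => Eventually.of_forall fun _ _ => refl_mem_uniformity hu
        | insert i s hi ih =>
          simp only [Finset.sum_insert hi]
          exact (tendstoUniformly_cv_tcut (integrable_dd_ex_Gam hχ.1 i)
            (fun w hw => dd_Gam_of_neg w hw _) (bm (hc' i) (hs' i))).add ih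
      exact this _
    have t4 := tendstoUniformly_cv_tcut (integrable_Gam hχ.1) Gam_of_neg hh
    exact ((t1.add t2).add t3).sub t4

end deriv

/-- Local smooth data witnessing that `u` is a classical solution on `W`. -/
def LocSol (W : Set (PSpace N)) (u : PSpace N → ℝ) : Prop :=
  ∃ (u0 ut : PSpace N → ℝ) (ui : Fin N → PSpace N → ℝ) (uij : Fin N → Fin N → PSpace N → ℝ),
    Continuous u0 ∧ Continuous ut ∧ (∀ i, Continuous (ui i)) ∧ (∀ i j, Continuous (uij i j)) ∧
    (∀ z ∈ W, u z = u0 z) ∧ (∀ z, HasLineDerivAt ℝ u0 (ut z) z (et N)) ∧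
    (∀ i z, HasLineDerivAt ℝ u0 (ui i z) z (ex i)) ∧
    (∀ i j z, HasLineDerivAt ℝ (ui j) (uij i j z) z (ex i)) ∧
    ∀ z ∈ W, ut z - ∑ i, uij i i z + (Real.exp (u z) - 1) = 0

section classical

open Filter Topology

lemma eventually_line_mem {W : Set (PSpace N)} (hW : IsOpen W) {z : PSpace N} (hz : z ∈ W)
    (e : PSpace N) : ∀ᶠ t : ℝ in 𝓝 0, z + t • e ∈ W := by
  have hc : Continuous fun t : ℝ => z + t • e := by fun_prop
  exact hc.continuousAt.eventually_mem (by simpa using hW.mem_nhds hz)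

lemma hasLineDerivAt_slice {W : Set (PSpace N)} (hW : IsOpen W) {f g : PSpace N → ℝ}
    (hfg : ∀ z ∈ W, f z = g z) {z : PSpace N} (hz : z ∈ W) {v : ℝ} {i : Fin N}
    (h : HasLineDerivAt ℝ g v z (ex i)) :
    HasLineDerivAt ℝ (fun y => f (y, z.2)) v z.1 (EuclideanSpace.single i 1) := by
  have h1 : HasDerivAt (fun t : ℝ => g (z + t • ex i)) v 0 := h
  refine HasDerivAt.congr_of_eventuallyEq h1 ?_
  filter_upwards [eventually_line_mem hW hz (ex i)] with t ht
  rw [← hfg _ ht]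
  simp [ex, Prod.ext_iff, ← Prod.mk_zero_zero]
  congr 1
  ext <;> simp

lemma hasDerivAt_time_slice {W : Set (PSpace N)} (hW : IsOpen W) {f g : PSpace N → ℝ}
    (hfg : ∀ z ∈ W, f z = g z) {z : PSpace N} (hz : z ∈ W) {v : ℝ}
    (h : HasLineDerivAt ℝ g v z (et N)) : HasDerivAt (fun s => f (z.1, s)) v z.2 := by
  have h1 : HasDerivAt (fun t : ℝ => f (z + t • et N)) v 0 := by
    refine HasDerivAt.congr_of_eventuallyEq (show HasDerivAt (fun t : ℝ => g (z + t • et N)) v 0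
      from h) ?_
    filter_upwards [eventually_line_mem hW hz (et N)] with t ht
    exact hfg _ ht
  have h2 := HasDerivAt.comp_sub_const z.2 z.2 (by rwa [sub_self])
    (f := fun t : ℝ => f (z + t • et N))
  refine h2.congr_of_eventuallyEq (Eventually.of_forall fun s => ?_)
  simp only
  congr 1
  ext <;> simp [et]

lemma isC21_of_locSol {O : Set (PSpace N)} {u : PSpace N → ℝ}
    (h : ∀ z ∈ O, ∃ W, IsOpen W ∧ z ∈ W ∧ LocSol W u) :
    IsC21 O u ∧ ∀ z ∈ O, tDeriv u z - lapl u z + (Real.exp (u z) - 1) = 0 := by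
  have key : ∀ z ∈ O, ContinuousAt u z ∧ DifferentiableAt ℝ (fun s => u (z.1, s)) z.2 ∧
      ContinuousAt (tDeriv u) z ∧
      (∀ i : Fin N, LineDifferentiableAt ℝ (fun y => u (y, z.2)) z.1 (EuclideanSpace.single i 1)) ∧
      (∀ i : Fin N, ContinuousAt (xDeriv i u) z) ∧
      (∀ i j : Fin N, LineDifferentiableAt ℝ (fun y => xDeriv j u (y, z.2)) z.1
        (EuclideanSpace.single i 1)) ∧
      (∀ i j : Fin N, ContinuousAt (xxDeriv i j u) z) ∧
      tDeriv u z - lapl u z + (Real.exp (u z) - 1) = 0 := by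
    intro z hzO
    obtain ⟨W, hW, hz, u0, ut, ui, uij, c0, ct, ci, cij, e0, dt, di, dij, pde⟩ := h z hzO
    have hn : W ∈ 𝓝 z := hW.mem_nhds hz
    have et' : ∀ w ∈ W, tDeriv u w = ut w := fun w hw =>
      (hasDerivAt_time_slice hW e0 hw (dt w)).deriv
    have ei : ∀ i, ∀ w ∈ W, xDeriv i u w = ui i w := fun i w hw =>
      (hasLineDerivAt_slice hW e0 hw (di i w)).lineDeriv
    have eij : ∀ i j, ∀ w ∈ W, xxDeriv i j u w = uij i j w := fun i j w hw =>
      (hasLineDerivAt_slice hW (ei j) hw (dij i j w)).lineDeriv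
    have cg : ∀ {f g : PSpace N → ℝ}, (∀ w ∈ W, f w = g w) → Continuous g → ContinuousAt f z :=
      fun hfg hg => hg.continuousAt.congr (by filter_upwards [hn] with w hw using (hfg w hw).symm)
    refine ⟨cg e0 c0, (hasDerivAt_time_slice hW e0 hz (dt z)).differentiableAt, cg et' ct,
      fun i => (hasLineDerivAt_slice hW e0 hz (di i z)).lineDifferentiableAt, fun i => cg (ei i) (ci i),
      fun i j => (hasLineDerivAt_slice hW (ei j) hz (dij i j z)).lineDifferentiableAt,
      fun i j => cg (eij i j) (cij i j), ?_⟩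
    rw [et' z hz, lapl, ← pde z hz]
    congr 2
    exact Finset.sum_congr rfl fun i _ => eij i i z hz
  refine ⟨⟨fun z hz => (key z hz).1.continuousWithinAt, fun z hz => (key z hz).2.1,
    fun z hz => (key z hz).2.2.1.continuousWithinAt, fun i z hz => (key z hz).2.2.2.1 i,
    fun i z hz => ((key z hz).2.2.2.2.1 i).continuousWithinAt,
    fun i j z hz => (key z hz).2.2.2.2.2.1 i j,
    fun i j z hz => ((key z hz).2.2.2.2.2.2.1 i j).continuousWithinAt⟩,
    fun z hz => (key z hz).2.2.2.2.2.2.2⟩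

end classical

/-- Local representation formulas characterising solutions near `z₀`. -/
structure LocRep (z₀ : PSpace N) (R : ℝ) (v : PSpace N → ℝ) : Prop where
  bm : BM v
  supp : ∀ z ∉ ball z₀ R, v z = 0
  rep : ∀ χ, Cut χ → tsupport χ ⊆ ball 0 (R / 2) → ∀ z ∈ ball z₀ (R / 2),
    v z = cv (Gam χ) (fun z => phi (v z)) z - cv (th χ) v z
  weak : ∀ θ, Tst θ → tsupport θ ⊆ ball 0 (R / 2) → ∀ z ∈ ball z₀ (R / 2),
    cv (Lop θ) v z = cv θ (fun z => phi (v z)) z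

lemma phi_zero : phi 0 = 0 := by simp [phi]

lemma BM.integrable_of_ball {g : PSpace N → ℝ} (hg : BM g) {z₀ : PSpace N} {R : ℝ}
    (h : ∀ z ∉ ball z₀ R, g z = 0) : Integrable g := by
  obtain ⟨hm, C, hC⟩ := hg
  have : IntegrableOn g (ball z₀ R) := Measure.integrableOn_of_bounded (M := C)
    measure_ball_lt_top.ne hm.aestronglyMeasurable (Filter.Eventually.of_forall hC)
  exact (integrableOn_iff_integrable_of_support_subset fun z hz => by
    by_contra h'; exact hz (h z h')).1 this

lemma exists_bump (z₀ : PSpace N) {a b : ℝ} (ha : 0 < a) (hab : a < b) :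
    ∃ ζ : PSpace N → ℝ, Tst ζ ∧ (∀ z ∈ closedBall z₀ a, ζ z = 1) ∧ tsupport ζ ⊆ ball z₀ b ∧
      ∀ z, 0 ≤ ζ z ∧ ζ z ≤ 1 := by
  let B : ContDiffBump z₀ := ⟨a, (a + b) / 2, ha, by linarith⟩
  refine ⟨B, ⟨B.contDiff, B.hasCompactSupport⟩, fun z hz => B.one_of_mem_closedBall hz, ?_,
    fun z => ⟨B.nonneg, B.le_one⟩⟩
  rw [B.tsupport_eq]
  exact closedBall_subset_ball (show (a + b) / 2 < b by linarith)

lemma exists_cut {b : ℝ} (hb : 0 < b) : ∃ χ : PSpace N → ℝ, Cut χ ∧ tsupport χ ⊆ ball 0 b := by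
  obtain ⟨ζ, h1, h2, h3, -⟩ := exists_bump (0 : PSpace N) (half_pos hb) (half_lt_self hb)
  refine ⟨ζ, ⟨h1, ?_⟩, h3⟩
  filter_upwards [closedBall_mem_nhds _ (half_pos hb)] with z hz using h2 z hz

lemma cv_congr_ball {f g g' : PSpace N → ℝ} {a b : ℝ} {z₀ z : PSpace N}
    (hf : ∀ w ∉ ball 0 a, f w = 0) (hz : z ∈ ball z₀ b)
    (hg : ∀ y ∈ ball z₀ (a + b), g y = g' y) : cv f g z = cv f g' z := by
  refine integral_congr_ae (Filter.Eventually.of_forall fun w => ?_)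
  by_cases hw : w ∈ ball 0 a
  · simp only
    rw [hg]
    rw [mem_ball, dist_eq_norm] at hz ⊢
    rw [mem_ball_zero_iff] at hw
    calc ‖z - w - z₀‖ = ‖(z - z₀) - w‖ := by congr 1; abel
      _ ≤ _ := norm_sub_le _ _
      _ < _ := by linarith
  · simp only [hf w hw, zero_mul]

lemma Gam_of_notMem {χ : PSpace N → ℝ} {z : PSpace N} (h : z ∉ tsupport χ) : Gam χ z = 0 := by
  rw [Gam, image_eq_zero_of_notMem_tsupport h, zero_mul]

/-- Interior regularity. -/
lemma LocRep.locSol {z₀ : PSpace N} {R : ℝ} (hR : 0 < R) {v : PSpace N → ℝ}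
    (hv : LocRep z₀ R v) : LocSol (ball z₀ (R / 8)) v := by
  have hh : BM fun z => phi (v z) := hv.bm.comp continuous_phi
  have hhi : Integrable fun z => phi (v z) :=
    hh.integrable_of_ball fun z hz => by rw [hv.supp z hz, phi_zero]
  have hvi : Integrable v := hv.bm.integrable_of_ball hv.supp
  obtain ⟨χ, hχ, hχs⟩ := exists_cut (N := N) (half_pos hR)
  obtain ⟨χ₂, hχ₂, hχs₂⟩ := exists_cut (N := N) (show 0 < R / 8 by linarith)
  obtain ⟨ζ, hζ, hζ1, hζs, -⟩ := exists_bump z₀ (show 0 < R / 4 by linarith)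
    (show R / 4 < R / 2 by linarith)
  have hθ := tst_th hχ
  have hθ₂ := tst_th hχ₂
  set a : PSpace N → ℝ := fun z => cv (Gam χ) (fun z => phi (v z)) z - cv (th χ) v z with ha
  set ai : Fin N → PSpace N → ℝ := fun i z =>
    cv (dd (ex i) (Gam χ)) (fun z => phi (v z)) z - cv (dd (ex i) (th χ)) v z
  have hac : Continuous a := (continuous_cv_Gam hχ.1 hh hhi).sub (continuous_cv_tst hθ hvi)
  have haic : ∀ i, Continuous (ai i) := fun i =>
    (continuous_cv_dd_Gam hχ.1 hh hhi i).sub (continuous_cv_tst (hθ.dd _) hvi)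
  have had : ∀ i z, HasLineDerivAt ℝ a (ai i z) z (ex i) := fun i z =>
    HasDerivAt.sub (hasLineDerivAt_cv_Gam hχ.1 hh hhi i z) (cv_swap_line hθ hvi (ex i) z)
  set h : PSpace N → ℝ := fun z => ζ z * phi (a z)
  set h' : Fin N → PSpace N → ℝ := fun i z =>
    dd (ex i) ζ z * phi (a z) + ζ z * ((1 - Real.exp (a z)) * ai i z)
  have hc : Continuous h := hζ.1.continuous.mul (continuous_phi.comp hac)
  have hs : HasCompactSupport h := hζ.2.mul_right
  have hc' : ∀ i, Continuous (h' i) := fun i =>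
    ((hζ.dd _).1.continuous.mul (continuous_phi.comp hac)).add (hζ.1.continuous.mul
      ((continuous_const.sub hac.rexp).mul (haic i)))
  have hs' : ∀ i, HasCompactSupport (h' i) := fun i =>
    (hζ.dd _).2.mul_right.add hζ.2.mul_right
  have hd : ∀ i z, HasLineDerivAt ℝ h (h' i z) z (ex i) := by
    intro i z
    have h1 : HasDerivAt (fun t : ℝ => ζ (z + t • ex i)) (dd (ex i) ζ z) 0 :=
      hζ.hasLineDerivAt (ex i) z
    have h2 : HasDerivAt (fun t : ℝ => a (z + t • ex i)) (ai i z) 0 := had i z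
    have h3 : HasDerivAt (fun t : ℝ => phi (a (z + t • ex i))) ((1 - Real.exp (a z)) * ai i z) 0 := by
      have := (h2.add_const 1).sub h2.exp
      simp only [zero_smul, add_zero] at this
      refine this.congr_deriv ?_
      ring
    have := h1.mul h3
    simp only [zero_smul, add_zero] at this
    exact this
  have bm : ∀ {h : PSpace N → ℝ}, Continuous h → HasCompactSupport h → BM h := fun hc hs =>
    ⟨hc.measurable, hs.exists_bound_of_continuous hc⟩
  have hhh : ∀ y ∈ ball z₀ (R / 8 + R / 8), phi (v y) = h y := by
    intro y hy
    have hy4 : y ∈ closedBall z₀ (R / 4) := by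
      rw [mem_ball] at hy; rw [mem_closedBall]; linarith
    have hy2 : y ∈ ball z₀ (R / 2) := by
      rw [mem_ball] at hy ⊢; linarith
    simp only [h, hζ1 y hy4, one_mul, ha]
    rw [← hv.rep χ hχ hχs y hy2]
  have sub1 : ball (0 : PSpace N) (R / 8) ⊆ ball 0 (R / 2) := ball_subset_ball (by linarith)
  have sub2 : ball z₀ (R / 8) ⊆ ball z₀ (R / 2) := ball_subset_ball (by linarith)
  have eG : ∀ z ∈ ball z₀ (R / 8), cv (Gam χ₂) (fun z => phi (v z)) z = cv (Gam χ₂) h z :=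
    fun z hz => cv_congr_ball (fun w hw => Gam_of_notMem fun h' => hw (hχs₂ h')) hz hhh
  have eθ : ∀ z ∈ ball z₀ (R / 8), cv (th χ₂) (fun z => phi (v z)) z = cv (th χ₂) h z :=
    fun z hz => cv_congr_ball (fun w hw => th_of_notMem fun h' => hw (hχs₂ h')) hz hhh
  have ev : ∀ z ∈ ball z₀ (R / 8), v z = cv (Gam χ₂) h z - cv (th χ₂) v z := fun z hz => by
    rw [← eG z hz]; exact hv.rep χ₂ hχ₂ (hχs₂.trans sub1) z (sub2 hz)
  refine ⟨fun z => cv (Gam χ₂) h z - cv (th χ₂) v z,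
    fun z => (cv (th χ₂) h z + h z + ∑ i, cv (dd (ex i) (Gam χ₂)) (h' i) z - cv (Gam χ₂) h z)
      - cv (dd (et N) (th χ₂)) v z,
    fun i z => cv (Gam χ₂) (h' i) z - cv (dd (ex i) (th χ₂)) v z,
    fun i j z => cv (dd (ex i) (Gam χ₂)) (h' j) z - cv (dd (ex i) (dd (ex j) (th χ₂))) v z,
    ?_, ?_, ?_, ?_, ev, ?_, ?_, ?_, ?_⟩
  · exact (continuous_cv_Gam hχ₂.1 (bm hc hs) (hc.integrable_of_hasCompactSupport hs)).sub
      (continuous_cv_tst hθ₂ hvi)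
  · refine Continuous.sub (Continuous.sub (Continuous.add (Continuous.add ?_ hc)
      (continuous_finsetSum _ fun i _ => ?_)) ?_) (continuous_cv_tst (hθ₂.dd _) hvi)
    · exact continuous_cv_tst hθ₂ (hc.integrable_of_hasCompactSupport hs)
    · exact continuous_cv_dd_Gam hχ₂.1 (bm (hc' i) (hs' i))
        ((hc' i).integrable_of_hasCompactSupport (hs' i)) i
    · exact continuous_cv_Gam hχ₂.1 (bm hc hs) (hc.integrable_of_hasCompactSupport hs)
  · exact fun i => (continuous_cv_Gam hχ₂.1 (bm (hc' i) (hs' i))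
      ((hc' i).integrable_of_hasCompactSupport (hs' i))).sub (continuous_cv_tst (hθ₂.dd _) hvi)
  · exact fun i j => (continuous_cv_dd_Gam hχ₂.1 (bm (hc' j) (hs' j))
      ((hc' j).integrable_of_hasCompactSupport (hs' j)) i).sub
        (continuous_cv_tst ((hθ₂.dd _).dd _) hvi)
  · exact fun z => HasDerivAt.sub (hasLineDerivAt_time hχ₂ hc hs hc' hs' hd z)
      (cv_swap_line hθ₂ hvi _ z)
  · exact fun i z => HasDerivAt.sub (hasLineDerivAt_cv (integrable_Gam hχ₂.1) (bm hc hs)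
      (bm (hc' i) (hs' i)) (hd i) z) (cv_swap_line hθ₂ hvi _ z)
  · exact fun i j z => HasDerivAt.sub (hasLineDerivAt_cv_Gam hχ₂.1 (bm (hc' j) (hs' j))
      ((hc' j).integrable_of_hasCompactSupport (hs' j)) i z) (cv_swap_line (hθ₂.dd _) hvi _ z)
  · intro z hz
    have hw := hv.weak (th χ₂) hθ₂ ((closure_minimal (fun w hw => by
      by_contra h'; exact hw (th_of_notMem h')) (isClosed_tsupport χ₂)).trans (hχs₂.trans sub1))
      z (sub2 hz)
    have hL : cv (Lop (th χ₂)) v z = cv (dd (et N) (th χ₂)) v z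
        - ∑ i, cv (dd (ex i) (dd (ex i) (th χ₂))) v z + cv (th χ₂) v z := by
      have j1 : ∀ i, Integrable (dd (ex i) (dd (ex i) (th χ₂))) := fun i =>
        ((hθ₂.dd _).dd _).integrable
      have j2 : Integrable fun z => ∑ i, dd (ex i) (dd (ex i) (th χ₂)) z :=
        integrable_finsetSum _ fun i _ => j1 i
      have j3 : Integrable fun z => dd (et N) (th χ₂) z - ∑ i, dd (ex i) (dd (ex i) (th χ₂)) z :=
        (hθ₂.dd _).integrable.sub j2
      have e1 : Lop (th χ₂) = fun z => dd (et N) (th χ₂) z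
        - ∑ i, dd (ex i) (dd (ex i) (th χ₂)) z + th χ₂ z := rfl
      rw [e1, cv_add_left j3 hθ₂.integrable hv.bm,
        cv_sub_left (hθ₂.dd _).integrable j2 hv.bm]
      congr 2
      simp only [cv, Finset.sum_mul]
      exact integral_finsetSum _ fun i _ => integrable_cv (j1 i) hv.bm z
    rw [eθ z hz, hL] at hw
    have hp := hhh z (ball_subset_ball (by linarith) hz)
    have hvz := ev z hz
    rw [phi] at hp
    rw [Finset.sum_sub_distrib]
    linarith

section limits

open Filter Topology

lemma Lop_of_notMem {θ : PSpace N → ℝ} {w : PSpace N} (h : w ∉ tsupport θ) : Lop θ w = 0 := by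
  have h2 : ∀ i, dd (ex i) (dd (ex i) θ) w = 0 := fun i =>
    dd_of_notMem fun h' => h (tsupport_dd_subset _ _ h')
  simp [Lop, dd_of_notMem h, h2, image_eq_zero_of_notMem_tsupport h]

lemma locRep_of_pot {z₀ : PSpace N} {R : ℝ} {F u : PSpace N → ℝ} (hF : BM F) (hc : Continuous u)
    (hu : BM u) (hue : ∀ z, u z = pot N 1 (fun z => F z + phi (u z)) z)
    (hF0 : ∀ z ∈ ball z₀ R, F z = 0) : LocRep z₀ R ((ball z₀ R).indicator u) := by
  have hG : BM fun z => F z + phi (u z) := hF.add (hu.comp continuous_phi)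
  have hpu : pot N 1 (fun z => F z + phi (u z)) = u := (funext hue).symm
  have e1 : ∀ y ∈ ball z₀ (R / 2 + R / 2), F y + phi (u y) = phi ((ball z₀ R).indicator u y) := by
    intro y hy
    rw [add_halves] at hy
    rw [indicator_of_mem hy, hF0 y hy, zero_add]
  have e2 : ∀ y ∈ ball z₀ (R / 2 + R / 2), u y = (ball z₀ R).indicator u y := by
    intro y hy
    rw [add_halves] at hy
    rw [indicator_of_mem hy]
  refine ⟨⟨hu.1.indicator measurableSet_ball, hu.2.imp fun C hC z => ?_⟩,
    fun z hz => indicator_of_notMem hz _, fun χ hχ hs z hz => ?_, fun θ hθ hs z hz => ?_⟩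
  · by_cases hz : z ∈ ball z₀ R
    · rw [indicator_of_mem hz]; exact hC z
    · rw [indicator_of_notMem hz, abs_zero]; exact (abs_nonneg _).trans (hC z)
  · have h := pot_rep hχ hG (z := z) (by rw [hpu]; exact hc.continuousAt)
    rw [hpu] at h
    have hR : 0 < R := by linarith [(dist_nonneg).trans_lt (mem_ball.1 hz)]
    rw [← e2 z (ball_subset_ball (by linarith) hz), h,
      cv_congr_ball (fun w hw => Gam_of_notMem fun h' => hw (hs h')) hz e1,
      cv_congr_ball (fun w hw => th_of_notMem fun h' => hw (hs h')) hz e2]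
  · have h := cv_Lop_pot hθ hG z
    rw [hpu] at h
    rw [← cv_congr_ball (fun w hw => Lop_of_notMem fun h' => hw (hs h')) hz e2, h,
      cv_congr_ball (fun w hw => image_eq_zero_of_notMem_tsupport fun h' => hw (hs h')) hz e1]

lemma tendsto_cv {f : PSpace N → ℝ} (hf : Integrable f) {g : ℕ → PSpace N → ℝ}
    {g' : PSpace N → ℝ} (hg : ∀ k, Measurable (g k)) {C : ℝ} (hC : ∀ k z, |g k z| ≤ C)
    (h : ∀ z, Tendsto (fun k => g k z) atTop (𝓝 (g' z))) (z : PSpace N) :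
    Tendsto (fun k => cv f (g k) z) atTop (𝓝 (cv f g' z)) := by
  refine tendsto_integral_of_dominated_convergence (fun w => ‖f w‖ * C) (fun k => ?_)
    (hf.norm.mul_const C) (fun k => Eventually.of_forall fun w => ?_)
    (Eventually.of_forall fun w => (h _).const_mul _)
  · exact hf.1.mul ((hg k).comp (by fun_prop)).aestronglyMeasurable
  · rw [norm_mul]
    exact mul_le_mul_of_nonneg_left (hC k _) (norm_nonneg _)

lemma LocRep.of_tendsto {z₀ : PSpace N} {R : ℝ} {v : ℕ → PSpace N → ℝ} {w : PSpace N → ℝ}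
    (hv : ∀ k, LocRep z₀ R (v k)) {C : ℝ} (hC : ∀ k z, |v k z| ≤ C)
    (h : ∀ z, Tendsto (fun k => v k z) atTop (𝓝 (w z))) : LocRep z₀ R w := by
  obtain ⟨D, hD⟩ := (isCompact_Icc (a := -C) (b := C)).exists_bound_of_continuousOn
    continuous_phi.continuousOn
  have hp : ∀ k, Measurable fun z => phi (v k z) := fun k =>
    continuous_phi.measurable.comp (hv k).bm.1
  have hpC : ∀ k z, |phi (v k z)| ≤ D := fun k z => hD _ (abs_le.1 (hC k z))
  have hpl : ∀ z, Tendsto (fun k => phi (v k z)) atTop (𝓝 (phi (w z))) := fun z =>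
    (continuous_phi.tendsto _).comp (h z)
  refine ⟨⟨measurable_of_tendsto_metrizable (fun k => (hv k).bm.1) (tendsto_pi_nhds.2 h), C,
      fun z => le_of_tendsto (h z).abs (Eventually.of_forall fun k => hC k z)⟩,
    fun z hz => tendsto_nhds_unique (h z) ?_, fun χ hχ hs z hz => ?_, fun θ hθ hs z hz => ?_⟩
  · simp only [fun k => (hv k).supp z hz, tendsto_const_nhds]
  · refine tendsto_nhds_unique (h z) ?_
    simp only [fun k => (hv k).rep χ hχ hs z hz]
    exact (tendsto_cv (integrable_Gam hχ.1) hp hpC hpl z).sub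
      (tendsto_cv (tst_th hχ).integrable (fun k => (hv k).bm.1) hC h z)
  · refine tendsto_nhds_unique (tendsto_cv hθ.Lop.integrable (fun k => (hv k).bm.1) hC h z) ?_
    simp only [fun k => (hv k).weak θ hθ hs z hz]
    exact tendsto_cv hθ.integrable hp hpC hpl z

lemma LocSol.congr {W W' : Set (PSpace N)} {u v : PSpace N → ℝ} (h : LocSol W v) (hW : W' ⊆ W)
    (huv : ∀ z ∈ W', u z = v z) : LocSol W' u := by
  obtain ⟨u0, ut, ui, uij, a, b, c, d, e, f, g, h, i⟩ := h
  refine ⟨u0, ut, ui, uij, a, b, c, d, fun z hz => (huv z hz).trans (e z (hW hz)), f, g, h,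
    fun z hz => ?_⟩
  rw [huv z hz]
  exact i z (hW hz)

lemma Tst.hasLineDerivAt' {f : PSpace N → ℝ} (hf : Tst f) (e z : PSpace N) :
    HasDerivAt (fun t : ℝ => f (z + t • e)) (_root_.dd e f z) 0 := hf.hasLineDerivAt e z

lemma Tst.dd_eq {f : PSpace N → ℝ} (hf : Tst f) {e z : PSpace N} {c : ℝ}
    (h : HasDerivAt (fun t : ℝ => f (z + t • e)) c 0) : _root_.dd e f z = c :=
  (hf.hasLineDerivAt' e z).unique h

/-- A barrier blowing up near the boundary of a ball. -/
lemma exists_upper_bound (z₀ : PSpace N) {r : ℝ} (hr : 0 < r) :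
    ∃ b : ℝ, ∀ (F u : PSpace N → ℝ), BM F → BM u → (∀ z, 0 ≤ u z) →
      (∀ z, u z = pot N 1 (fun z => F z + phi (u z)) z) → (∀ z ∈ ball z₀ (2 * r), F z = 0) →
      ∀ z ∈ closedBall z₀ r, u z ≤ b := by
  obtain ⟨d, hd, hd1, hds, hd01⟩ := exists_bump z₀ hr (show r < 2 * r by linarith)
  have hD : Tst fun z => dd (et N) d z - ∑ i, dd (ex i) (dd (ex i) d) z :=
    (hd.dd _).sub (Tst.sum _ fun i => (hd.dd _).dd _)
  have hS : Tst fun z => ∑ i, dd (ex i) d z * dd (ex i) d z :=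
    Tst.sum _ fun i => Tst.mul_left (hd.dd _).1 (hd.dd _)
  obtain ⟨CD, hCD⟩ := hD.bm.2
  obtain ⟨CS, hCS⟩ := hS.bm.2
  have hCD0 : 0 ≤ CD := (abs_nonneg _).trans (hCD 0)
  have hCS0 : 0 ≤ CS := (abs_nonneg _).trans (hCS 0)
  set b := Real.log (4 * CD + 2 * CS + 4) with hb
  have heb : Real.exp b = 4 * CD + 2 * CS + 4 := Real.exp_log (by positivity)
  refine ⟨b, fun F u hF hu hu0 hue hF0 z hz => ?_⟩
  obtain ⟨A, hA⟩ := hF.2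
  have hA0 : 0 ≤ A := (abs_nonneg _).trans (hA 0)
  set ε := 1 / (1 + A) with hε
  have hε0 : 0 < ε := by positivity
  have hε1 : ε ≤ 1 := by rw [hε, div_le_one (by positivity)]; linarith
  have hg : ∀ z, 0 < ε + d z := fun z => by linarith [(hd01 z).1]
  have hg2 : ∀ z, ε + d z ≤ 2 := fun z => by linarith [(hd01 z).2]
  set W : PSpace N → ℝ := fun z => -2 * Real.log (ε + d z) + 2 * Real.log ε with hW
  have hWT : Tst W := by
    refine ⟨(contDiff_const.mul ((contDiff_const.add hd.1).log fun z => (hg z).ne')).add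
      contDiff_const, hd.2.comp_left (g := fun x => -2 * Real.log (ε + x) + 2 * Real.log ε)
        (by simp)⟩
  have hW1 : ∀ e z, dd e W z = -2 * (dd e d z / (ε + d z)) := by
    intro e z
    refine hWT.dd_eq ?_
    have h1 := (((hd.hasLineDerivAt' e z).const_add ε).log (by simpa using (hg z).ne')).const_mul
      (-2) |>.add_const (2 * Real.log ε)
    refine h1.congr_deriv ?_
    simp
  have hW2 : ∀ e z, dd e (dd e W) z = -2 * (dd e (dd e d) z / (ε + d z))
      + 2 * (dd e d z * dd e d z / (ε + d z) ^ 2) := by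
    intro e z
    refine (hWT.dd e).dd_eq ?_
    simp only [hW1]
    have h1 := (((hd.dd e).hasLineDerivAt' e z).div ((hd.hasLineDerivAt' e z).const_add ε)
      (by simpa using (hg z).ne')).const_mul (-2)
    refine h1.congr_deriv ?_
    have := (hg z).ne'
    simp only [zero_smul, add_zero]
    field_simp
    ring
  set c := b - 2 * Real.log ε
  set V : PSpace N → ℝ := fun z => c + W z with hV
  have hVb : BM V := (BM.const c).add hWT.bm
  have hVeq : ∀ z, V z = b - 2 * Real.log (ε + d z) := fun z => by simp only [hV, hW, c]; ring
  set G : PSpace N → ℝ := fun z => c + Lop W z with hG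
  have hGb : BM G := (BM.const c).add hWT.Lop.bm
  have hVp : ∀ z, V z = pot N 1 G z := by
    intro z
    rw [hG, pot_add one_pos (BM.const c) hWT.Lop.bm, pot_const one_pos, pot_one_eq_cv,
      cv_Kf_Lop hWT, div_one]
  set F' : PSpace N → ℝ := fun z => G z - phi (V z) with hF'
  have heV : ∀ z, Real.exp (V z) = Real.exp b / (ε + d z) ^ 2 := by
    intro z
    rw [hVeq, Real.exp_sub, two_mul, Real.exp_add, Real.exp_log (hg z), sq]
  have hF'eq : ∀ z, F' z = -2 * ((dd (et N) d z - ∑ i, dd (ex i) (dd (ex i) d) z) / (ε + d z))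
      - 2 * ((∑ i, dd (ex i) d z * dd (ex i) d z) / (ε + d z) ^ 2)
      + Real.exp b / (ε + d z) ^ 2 - 1 := by
    intro z
    have e1 : ∑ i : Fin N, dd (ex i) (dd (ex i) W) z = -2 * ((∑ i, dd (ex i) (dd (ex i) d) z) /
        (ε + d z)) + 2 * ((∑ i, dd (ex i) d z * dd (ex i) d z) / (ε + d z) ^ 2) := by
      simp only [hW2, Finset.sum_add_distrib, Finset.mul_sum, Finset.sum_div]
    have e2 := heV z
    simp only [hV] at e2
    simp only [hF', hG, Lop, phi, e1, hW1, hV, e2]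
    ring
  have hF'0 : ∀ z, 0 ≤ F' z := by
    intro z
    have hgz := hg z
    have k1 : (dd (et N) d z - ∑ i, dd (ex i) (dd (ex i) d) z) / (ε + d z) ≤
        2 * CD / (ε + d z) ^ 2 := by
      rw [div_le_div_iff₀ hgz (by positivity)]
      have := (le_abs_self _).trans (hCD z)
      calc _ ≤ CD * (ε + d z) ^ 2 := mul_le_mul_of_nonneg_right this (by positivity)
        _ = (ε + d z) * (CD * (ε + d z)) := by ring
        _ ≤ 2 * (CD * (ε + d z)) := mul_le_mul_of_nonneg_right (hg2 z) (by positivity)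
        _ = _ := by ring
    have k2 : (∑ i, dd (ex i) d z * dd (ex i) d z) / (ε + d z) ^ 2 ≤ CS / (ε + d z) ^ 2 :=
      div_le_div_of_nonneg_right ((le_abs_self _).trans (hCS z)) (by positivity)
    have k3 : 1 ≤ 4 / (ε + d z) ^ 2 := by
      rw [le_div_iff₀ (by positivity)]
      nlinarith [hg2 z]
    have k4 : Real.exp b / (ε + d z) ^ 2 = 2 * (2 * CD / (ε + d z) ^ 2) +
        2 * (CS / (ε + d z) ^ 2) + 4 / (ε + d z) ^ 2 := by rw [heb]; ring
    rw [hF'eq]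
    linarith
  have hFF : ∀ z, F z ≤ F' z := by
    intro z
    by_cases hz : z ∈ ball z₀ (2 * r)
    · rw [hF0 z hz]; exact hF'0 z
    · have hz' : z ∉ tsupport d := fun h => hz (hds h)
      have h2 : ∀ i, dd (ex i) (dd (ex i) d) z = 0 := fun i =>
        dd_of_notMem fun h' => hz' (tsupport_dd_subset _ _ h')
      have h3 : A + 1 ≤ Real.exp b / ε ^ 2 := by
        rw [hε, heb]
        have : (4 * CD + 2 * CS + 4) / (1 / (1 + A)) ^ 2 = (4 * CD + 2 * CS + 4) * (1 + A) ^ 2 := by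
          field_simp
        rw [this]
        nlinarith [mul_nonneg hCD0 (sq_nonneg (1 + A)), mul_nonneg hCS0 (sq_nonneg (1 + A))]
      rw [hF'eq]
      simp only [dd_of_notMem hz', h2, image_eq_zero_of_notMem_tsupport hz', Finset.sum_const_zero,
        mul_zero, sub_zero, zero_div, add_zero]
      linarith [(le_abs_self _).trans (hA z)]
  have hV0 : ∀ z, 0 ≤ V z := by
    intro z
    have h1 : Real.log ((ε + d z) ^ 2) ≤ b := by
      refine Real.log_le_log (pow_pos (hg z) 2) ?_
      nlinarith [hg2 z, hg z]
    rw [Real.log_pow] at h1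
    rw [hVeq]
    push_cast at h1
    linarith
  have hcmp := pot_comparison (F := F') (G := fun z => F z + phi (u z)) (u := V) (v := u)
    (hGb.sub (hVb.comp continuous_phi)) (hF.add (hu.comp continuous_phi)) hVb
    (fun z => by rw [hVp]; congr 1; ext w; simp only [hF']; ring) hue hV0
    (fun z => by rw [max_eq_left (hu0 z)]; linarith [hFF z]) z
  refine hcmp.trans ?_
  rw [hVeq, hd1 z hz]
  have := Real.log_nonneg (show 1 ≤ ε + 1 by linarith)
  linarith

end limits

section interior

open Filter Topology

/-- Continuous cutoff concentrated near and outside the boundary of `O`. -/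
noncomputable def bcut (O : Set (PSpace N)) (n : ℕ) (z : PSpace N) : ℝ :=
  min 1 (max 0 (2 - n * infDist z Oᶜ))

lemma continuous_bcut (O : Set (PSpace N)) (n : ℕ) : Continuous (bcut O n) := by
  unfold bcut
  exact continuous_const.min (continuous_const.max (continuous_const.sub
    (continuous_const.mul (continuous_infDist_pt _))))

lemma bcut_nonneg (O : Set (PSpace N)) (n : ℕ) (z : PSpace N) : 0 ≤ bcut O n z :=
  le_min zero_le_one (le_max_left _ _)

lemma bcut_le_one (O : Set (PSpace N)) (n : ℕ) (z : PSpace N) : bcut O n z ≤ 1 := min_le_left _ _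

lemma bcut_anti (O : Set (PSpace N)) {m n : ℕ} (h : m ≤ n) (z : PSpace N) :
    bcut O n z ≤ bcut O m z := by
  refine min_le_min_left _ (max_le_max_left _ (sub_le_sub_left ?_ _))
  exact mul_le_mul_of_nonneg_right (by exact_mod_cast h) infDist_nonneg

lemma bcut_eq_zero {O : Set (PSpace N)} {n : ℕ} {z : PSpace N} (h : 2 ≤ n * infDist z Oᶜ) :
    bcut O n z = 0 := by
  rw [bcut, max_eq_left (by linarith), min_eq_right zero_le_one]

lemma bcut_eq_one {O : Set (PSpace N)} {n : ℕ} {z : PSpace N} (h : n * infDist z Oᶜ ≤ 1) :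
    bcut O n z = 1 := by
  rw [bcut, max_eq_right (by linarith), min_eq_left (by linarith)]

lemma exists_approx (O : Set (PSpace N)) (n k : ℕ) : ∃ u : PSpace N → ℝ, Continuous u ∧ BM u ∧
    (∀ z, 0 ≤ u z) ∧ ∀ z, u z = pot N 1 (fun z => k * bcut O n z + phi (u z)) z :=
  exists_pot_solution (continuous_const.mul (continuous_bcut O n)) (A := k)
    (fun z => mul_nonneg k.cast_nonneg (bcut_nonneg O n z))
    (fun z => mul_le_of_le_one_right k.cast_nonneg (bcut_le_one O n z))

/-- Approximating solutions with large source near the boundary. -/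
noncomputable def approx (O : Set (PSpace N)) (n k : ℕ) : PSpace N → ℝ :=
  (exists_approx O n k).choose

section
variable (O : Set (PSpace N)) (n k : ℕ)

lemma continuous_approx : Continuous (approx O n k) := (exists_approx O n k).choose_spec.1

lemma bm_approx : BM (approx O n k) := (exists_approx O n k).choose_spec.2.1

lemma approx_nonneg (z : PSpace N) : 0 ≤ approx O n k z :=
  (exists_approx O n k).choose_spec.2.2.1 z

lemma approx_eq (z : PSpace N) :
    approx O n k z = pot N 1 (fun z => k * bcut O n z + phi (approx O n k z)) z :=
  (exists_approx O n k).choose_spec.2.2.2 z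

lemma bm_source : BM fun z => (k : ℝ) * bcut O n z :=
  ⟨(continuous_const.mul (continuous_bcut O n)).measurable, k, fun z => by
    rw [abs_of_nonneg (mul_nonneg k.cast_nonneg (bcut_nonneg O n z))]
    exact mul_le_of_le_one_right k.cast_nonneg (bcut_le_one O n z)⟩

variable {O n k}

lemma le_approx {G v : PSpace N → ℝ} (hG : BM G) (hv : ∀ z, v z = pot N 1 G z)
    (h : ∀ z, G z ≤ k * bcut O n z + phi (max (v z) 0)) (z : PSpace N) : v z ≤ approx O n k z :=
  pot_comparison (bm_source O n k) hG (bm_approx O n k) (approx_eq O n k) hv (approx_nonneg O n k)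
    h z

lemma approx_mono {m n k l : ℕ} (hkl : k ≤ l) (hmn : m ≤ n) (z : PSpace N) :
    approx O n k z ≤ approx O m l z := by
  refine le_approx ((bm_source O n k).add ((bm_approx O n k).comp continuous_phi))
    (approx_eq O n k) (fun z => ?_) z
  rw [max_eq_left (approx_nonneg O n k z)]
  gcongr
  · exact bcut_nonneg O n z
  · exact bcut_anti O hmn z

end

noncomputable def approxLim (O : Set (PSpace N)) (n : ℕ) (z : PSpace N) : ℝ :=
  limUnder atTop fun k => approx O n k z

/-- The candidate for the large solution. -/
noncomputable def bigSol (O : Set (PSpace N)) (z : PSpace N) : ℝ :=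
  limUnder atTop fun n => approxLim O n z

lemma exists_local_bound {O : Set (PSpace N)} (hO : IsOpen O) (hne : Oᶜ.Nonempty) {z₀ : PSpace N}
    (hz : z₀ ∈ O) : ∃ r > 0, ∃ n₀ : ℕ, ∃ b : ℝ, ∀ n ≥ n₀, ∀ k,
      (∀ z ∈ ball z₀ r, approx O n k z ≤ b) ∧ ∀ z ∈ ball z₀ r, (k : ℝ) * bcut O n z = 0 := by
  have hd : 0 < infDist z₀ Oᶜ :=
    (hO.isClosed_compl.notMem_iff_infDist_pos hne).1 fun h => h hz
  set R := infDist z₀ Oᶜ / 2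
  have hR : 0 < R := half_pos hd
  obtain ⟨b, hb⟩ := exists_upper_bound z₀ (half_pos hR)
  obtain ⟨n₀, hn₀⟩ := exists_nat_ge (2 / R)
  have h0 : ∀ n ≥ n₀, ∀ k : ℕ, ∀ z ∈ ball z₀ R, (k : ℝ) * bcut O n z = 0 := by
    intro n hn k z hz
    rw [bcut_eq_zero, mul_zero]
    have h1 : infDist z₀ Oᶜ ≤ infDist z Oᶜ + dist z₀ z := infDist_le_infDist_add_dist
    rw [dist_comm] at h1
    have h2 : R ≤ infDist z Oᶜ := by
      have := mem_ball.1 hz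
      have e : infDist z₀ Oᶜ = 2 * R := by simp only [R]; ring
      linarith
    have h3 : 2 / R ≤ n := hn₀.trans (by exact_mod_cast hn)
    rw [div_le_iff₀ hR] at h3
    exact h3.trans (mul_le_mul_of_nonneg_left h2 n.cast_nonneg)
  refine ⟨R / 2, half_pos hR, n₀, b, fun n hn k => ⟨fun z hz => ?_, fun z hz =>
    h0 n hn k z (ball_subset_ball (by linarith) hz)⟩⟩
  refine hb _ _ (bm_source O n k) (bm_approx O n k) (approx_nonneg O n k) (approx_eq O n k) ?_ z
    (ball_subset_closedBall hz)
  rw [mul_div_cancel₀ _ two_ne_zero]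
  exact h0 n hn k

section
variable {O : Set (PSpace N)} {W : Set (PSpace N)} {n₀ : ℕ} {b : ℝ}
  (hb : ∀ n ≥ n₀, ∀ k, ∀ z ∈ W, approx O n k z ≤ b)
include hb

lemma tendsto_approx {n : ℕ} (hn : n₀ ≤ n) {z : PSpace N} (hz : z ∈ W) :
    Tendsto (fun k => approx O n k z) atTop (𝓝 (approxLim O n z)) :=
  tendsto_nhds_limUnder ⟨_, tendsto_atTop_ciSup (fun _ _ h => approx_mono h le_rfl z)
    ⟨b, by rintro _ ⟨k, rfl⟩; exact hb n hn k z hz⟩⟩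

lemma approxLim_mem {n : ℕ} (hn : n₀ ≤ n) {z : PSpace N} (hz : z ∈ W) (k : ℕ) :
    approx O n k z ≤ approxLim O n z ∧ approxLim O n z ≤ b :=
  ⟨Monotone.ge_of_tendsto (fun _ _ h => approx_mono h le_rfl z) (tendsto_approx hb hn hz) k,
    le_of_tendsto (tendsto_approx hb hn hz) (Eventually.of_forall fun k => hb n hn k z hz)⟩

lemma tendsto_approxLim {z : PSpace N} (hz : z ∈ W) :
    Tendsto (fun n => approxLim O (n + n₀) z) atTop (𝓝 (bigSol O z)) := by
  have ha : Antitone fun n => approxLim O (n + n₀) z := fun m n h =>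
    le_of_tendsto_of_tendsto (tendsto_approx hb (by omega) hz) (tendsto_approx hb (by omega) hz)
      (Eventually.of_forall fun k => approx_mono le_rfl (by omega) z)
  have h1 : ∃ l, Tendsto (fun n => approxLim O (n + n₀) z) atTop (𝓝 l) :=
    ⟨_, tendsto_atTop_ciInf ha ⟨0, by
      rintro _ ⟨n, rfl⟩
      exact (approx_nonneg O (n + n₀) 0 z).trans (approxLim_mem hb (by omega) hz 0).1⟩⟩
  obtain ⟨l, hl⟩ := h1
  have h2 : Tendsto (fun n => approxLim O n z) atTop (𝓝 (bigSol O z)) :=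
    tendsto_nhds_limUnder ⟨l, (tendsto_add_atTop_iff_nat n₀).1 hl⟩
  exact (tendsto_add_atTop_iff_nat n₀).2 h2

end

lemma locSol_bigSol {O : Set (PSpace N)} (hO : IsOpen O) (hne : Oᶜ.Nonempty) {z₀ : PSpace N}
    (hz : z₀ ∈ O) : ∃ W, IsOpen W ∧ z₀ ∈ W ∧ LocSol W (bigSol O) := by
  obtain ⟨r, hr, n₀, b, h⟩ := exists_local_bound hO hne hz
  have hb : ∀ n ≥ n₀, ∀ k, ∀ z ∈ ball z₀ r, approx O n k z ≤ b := fun n hn k => (h n hn k).1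
  have hb0 : 0 ≤ b :=
    (approx_nonneg O n₀ 0 z₀).trans (hb n₀ le_rfl 0 z₀ (mem_ball_self hr))
  have r1 : ∀ n ≥ n₀, LocRep z₀ r ((ball z₀ r).indicator (approxLim O n)) := by
    intro n hn
    refine LocRep.of_tendsto (C := b) (v := fun k => (ball z₀ r).indicator (approx O n k))
      (fun k => locRep_of_pot (bm_source O n k) (continuous_approx O n k) (bm_approx O n k)
        (approx_eq O n k) (h n hn k).2) (fun k z => ?_) (fun z => ?_)
    · by_cases hz : z ∈ ball z₀ r
      · rw [indicator_of_mem hz, abs_of_nonneg (approx_nonneg O n k z)]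
        exact hb n hn k z hz
      · rwa [indicator_of_notMem hz, abs_zero]
    · by_cases hz : z ∈ ball z₀ r
      · simp only [indicator_of_mem hz]
        exact tendsto_approx hb hn hz
      · simp only [indicator_of_notMem hz, tendsto_const_nhds]
  have r2 : LocRep z₀ r ((ball z₀ r).indicator (bigSol O)) := by
    refine LocRep.of_tendsto (C := b)
      (v := fun n => (ball z₀ r).indicator (approxLim O (n + n₀)))
      (fun n => r1 _ (by omega)) (fun n z => ?_) (fun z => ?_)
    · by_cases hz : z ∈ ball z₀ r
      · have := approxLim_mem hb (show n₀ ≤ n + n₀ by omega) hz 0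
        rw [indicator_of_mem hz, abs_of_nonneg ((approx_nonneg O _ 0 z).trans this.1)]
        exact this.2
      · rwa [indicator_of_notMem hz, abs_zero]
    · by_cases hz : z ∈ ball z₀ r
      · simp only [indicator_of_mem hz]
        exact tendsto_approxLim hb hz
      · simp only [indicator_of_notMem hz, tendsto_const_nhds]
  refine ⟨ball z₀ (r / 8), isOpen_ball, mem_ball_self (by positivity),
    (r2.locSol hr).congr subset_rfl fun z hz => ?_⟩
  rw [indicator_of_mem (ball_subset_ball (by linarith) hz)]

lemma le_bigSol {O : Set (PSpace N)} (hO : IsOpen O) (hne : Oᶜ.Nonempty) {w : PSpace N}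
    (hw : w ∈ O) {M : ℝ}
    (h : ∀ η > 0, ∃ (G v : PSpace N → ℝ) (A : ℝ), BM G ∧ (∀ z, v z = pot N 1 G z) ∧
      (∀ z, infDist z Oᶜ < η → G z ≤ A + phi (max (v z) 0)) ∧
      (∀ z, η ≤ infDist z Oᶜ → G z ≤ phi (max (v z) 0)) ∧ M ≤ v w) : M ≤ bigSol O w := by
  obtain ⟨r, hr, n₀, b, hrb⟩ := exists_local_bound hO hne hw
  have hb : ∀ n ≥ n₀, ∀ k, ∀ z ∈ ball w r, approx O n k z ≤ b := fun n hn k => (hrb n hn k).1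
  have hww := mem_ball_self (x := w) hr
  refine ge_of_tendsto (tendsto_approxLim hb hww) (Eventually.of_forall fun m => ?_)
  set n := m + n₀
  obtain ⟨G, v, A, hG, hv, h1, h2, h3⟩ := h (1 / (n + 1)) (by positivity)
  obtain ⟨k, hk⟩ := exists_nat_ge A
  refine h3.trans ((le_approx (k := k) (n := n) hG hv (fun z => ?_) w).trans
    (approxLim_mem hb (show n₀ ≤ n by omega) hww k).1)
  by_cases hz : infDist z Oᶜ < 1 / (n + 1)
  · rw [bcut_eq_one, mul_one]
    · linarith [h1 z hz]
    · rw [lt_div_iff₀ (by positivity)] at hz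
      nlinarith [infDist_nonneg (x := z) (s := Oᶜ)]
  · linarith [h2 z (not_lt.1 hz), mul_nonneg k.cast_nonneg (bcut_nonneg O n z) (a := (k : ℝ))]

end interior

section frostman

/-- The parabolic distance whose balls are the cylinders `pQt`. -/
noncomputable def qd (p q : PSpace N) : ℝ := max (dist p.1 q.1) (Real.sqrt |p.2 - q.2|)

lemma qd_comm (p q : PSpace N) : qd p q = qd q p := by rw [qd, qd, dist_comm, abs_sub_comm]

lemma qd_self (p : PSpace N) : qd p p = 0 := by simp [qd]

lemma qd_triangle (p q s : PSpace N) : qd p s ≤ qd p q + qd q s := by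
  refine max_le ((dist_triangle _ q.1 _).trans (add_le_add (le_max_left _ _) (le_max_left _ _))) ?_
  refine le_trans ?_ (add_le_add (le_max_right _ _) (le_max_right _ _))
  refine (Real.sqrt_le_sqrt (abs_sub_le p.2 q.2 s.2)).trans ?_
  refine Real.sqrt_le_iff.2 ⟨by positivity, ?_⟩
  nlinarith [Real.sq_sqrt (abs_nonneg (p.2 - q.2)), Real.sq_sqrt (abs_nonneg (q.2 - s.2)),
    Real.sqrt_nonneg |p.2 - q.2|, Real.sqrt_nonneg |q.2 - s.2|]

lemma mem_pQt {r : ℝ} {p q : PSpace N} : q ∈ pQt N r p ↔ qd q p < r := by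
  by_cases hr : 0 < r
  · rw [qd, max_lt_iff, Real.sqrt_lt' hr, abs_sub_lt_iff, pQt, mem_prod, mem_ball, mem_Ioo]
    constructor
    · rintro ⟨a, b, c⟩
      exact ⟨a, by linarith, by linarith⟩
    · rintro ⟨a, b, c⟩
      exact ⟨a, by linarith, by linarith⟩
  · constructor
    · rintro ⟨a, -⟩
      exact absurd (dist_nonneg.trans_lt a) hr
    · intro h
      exact absurd ((dist_nonneg.trans (le_max_left _ _)).trans_lt h) hr

lemma measurableSet_pQt (r : ℝ) (z : PSpace N) : MeasurableSet (pQt N r z) :=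
  measurableSet_ball.prod measurableSet_Ioo

lemma PHcap_le_sum (hN : N ≠ 0) {ρ : ℝ} (hρ : 0 ≤ ρ) {E : Set (PSpace N)} {ι : Type*}
    (u : Finset ι) (y : ι → PSpace N) (r : ι → ℝ) (hr : ∀ i ∈ u, 0 ≤ r i ∧ r i ≤ ρ)
    (hE : E ⊆ ⋃ i ∈ u, pQt N (r i) (y i)) :
    PHcap N ρ E ≤ ∑ i ∈ u, ENNReal.ofReal (r i ^ N) := by
  classical
  set c : ℕ → PSpace N × ℝ := fun j =>
    if h : j < u.card then (y (u.equivFin.symm ⟨j, h⟩), r (u.equivFin.symm ⟨j, h⟩)) else (0, 0)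
    with hc
  have hcm : ∀ i : Fin u.card, c i = (y (u.equivFin.symm i), r (u.equivFin.symm i)) := by
    intro i; simp [hc]
  have hc0 : ∀ j, ¬ j < u.card → c j = (0, 0) := fun j hj => by simp [hc, hj]
  have hc' : (∀ j, 0 ≤ (c j).2 ∧ (c j).2 ≤ ρ) ∧ E ⊆ ⋃ j, pQt N (c j).2 (c j).1 := by
    refine ⟨fun j => ?_, fun z hz => ?_⟩
    · by_cases hj : j < u.card
      · rw [hcm ⟨j, hj⟩]
        exact hr _ (u.equivFin.symm ⟨j, hj⟩).2
      · rw [hc0 j hj]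
        exact ⟨le_rfl, hρ⟩
    · obtain ⟨i, hi, hzi⟩ := mem_iUnion₂.1 (hE hz)
      refine mem_iUnion.2 ⟨u.equivFin ⟨i, hi⟩, ?_⟩
      rw [hcm]
      simpa using hzi
  refine (iInf₂_le c hc').trans (le_of_eq ?_)
  rw [tsum_eq_sum (s := Finset.range u.card), Finset.sum_range]
  · simp only [hcm]
    rw [Equiv.sum_comp u.equivFin.symm (fun i : u => ENNReal.ofReal (r i ^ N))]
    exact Finset.sum_coe_sort u fun i => ENNReal.ofReal (r i ^ N)
  · intro j hj
    rw [hc0 j (by simpa using hj)]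
    simp [hN]

lemma exists_finite_net {E : Set (PSpace N)} (hE : Bornology.IsBounded E) {ε : ℝ} (hε : 0 < ε) :
    ∃ X : Finset (PSpace N), ↑X ⊆ E ∧ E ⊆ ⋃ x ∈ X, pQt N ε x := by
  have hm : 0 < min ε (ε ^ 2) := lt_min hε (by positivity)
  obtain ⟨t, ht, hf, hc⟩ := Metric.finite_approx_of_totallyBounded
    (hE.isCompact_closure.totallyBounded.subset subset_closure) _ hm
  refine ⟨hf.toFinset, by simpa using ht, fun z hz => ?_⟩
  obtain ⟨x, hx, hzx⟩ := mem_iUnion₂.1 (hc hz)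
  refine mem_iUnion₂.2 ⟨x, by simpa using hx, ?_⟩
  rw [mem_ball, Prod.dist_eq, max_lt_iff] at hzx
  rw [mem_pQt, qd, max_lt_iff, Real.sqrt_lt' hε, ← Real.dist_eq]
  exact ⟨hzx.1.trans_le (min_le_left _ _), hzx.2.trans_le (min_le_right _ _)⟩

/-- A discrete Frostman lemma at scale `ε` for the parabolic Hausdorff capacity. -/
lemma exists_frostman (hN : N ≠ 0) {E : Set (PSpace N)} (hE : Bornology.IsBounded E) {ε : ℝ}
    (hε : 0 < ε) (hε7 : ε ≤ 1 / 7) :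
    ∃ (X : Finset (PSpace N)) (a : PSpace N → ℝ), ↑X ⊆ E ∧ (∀ x, 0 ≤ a x) ∧
      (∀ y r, ε ≤ r → r ≤ 1 / 7 → ∑ x ∈ X, (pQt N r y).indicator a x ≤ r ^ N) ∧
      PHcap N 1 E ≤ ENNReal.ofReal (2 * 7 ^ N * ∑ x ∈ X, a x) := by
  classical
  obtain ⟨X, hXE, hEX⟩ := exists_finite_net hE hε
  let P : (PSpace N → ℝ) → Prop := fun a => (∀ x, 0 ≤ a x) ∧
    ∀ y r, ε ≤ r → r ≤ 1 / 7 → ∑ x ∈ X, (pQt N r y).indicator a x ≤ r ^ N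
  let S : Set ℝ := {s | ∃ a, P a ∧ s = ∑ x ∈ X, a x}
  have hbdd : BddAbove S := by
    refine ⟨∑ x ∈ X, ε ^ N, ?_⟩
    rintro _ ⟨a, ⟨ha0, ha⟩, rfl⟩
    refine Finset.sum_le_sum fun x hx => ?_
    refine le_trans ?_ (ha x ε le_rfl hε7)
    have h1 : (pQt N ε x).indicator a x = a x :=
      indicator_of_mem (mem_pQt.2 (by rwa [qd_self])) _
    rw [← h1]
    exact Finset.single_le_sum (f := (pQt N ε x).indicator a)
      (fun z _ => indicator_nonneg (fun w _ => ha0 w) z) hx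
  have hne : S.Nonempty := ⟨_, fun _ => 0, ⟨fun _ => le_rfl, fun y r hr _ => by
    simpa using pow_nonneg (hε.le.trans hr) N⟩, rfl⟩
  have hη : 0 < ε ^ N / 2 := by positivity
  obtain ⟨_, ⟨a, ⟨ha0, ha⟩, rfl⟩, hlt⟩ := exists_lt_of_lt_csSup hne
    (show sSup S - ε ^ N / 2 < sSup S by linarith)
  refine ⟨X, a, hXE, ha0, ha, ?_⟩
  have sat : ∀ x ∈ X, ∃ (y : PSpace N) (r : ℝ), ε ≤ r ∧ r ≤ 1 / 7 ∧ x ∈ pQt N r y ∧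
      r ^ N / 2 ≤ ∑ z ∈ X, (pQt N r y).indicator a z := by
    intro x hx
    by_contra! hcon
    have hP : P fun z => a z + if z = x then ε ^ N / 2 else 0 := by
      refine ⟨fun z => add_nonneg (ha0 z) (by split_ifs <;> positivity), fun y r hr hr7 => ?_⟩
      have e1 : ∑ z ∈ X, (pQt N r y).indicator (fun z => a z + if z = x then ε ^ N / 2 else 0) z
          = ∑ z ∈ X, (pQt N r y).indicator a z
            + ∑ z ∈ X, (pQt N r y).indicator (fun z => if z = x then ε ^ N / 2 else 0) z := by
        rw [← Finset.sum_add_distrib]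
        exact Finset.sum_congr rfl fun z _ => congrFun (indicator_add _ _ _) z
      rw [e1]
      have e2 : ∑ z ∈ X, (pQt N r y).indicator (fun z => if z = x then ε ^ N / 2 else 0) z
          = (pQt N r y).indicator (fun _ => ε ^ N / 2) x := by
        rw [Finset.sum_eq_single_of_mem x hx]
        · by_cases h : x ∈ pQt N r y <;> simp [h]
        · intro z _ hz
          by_cases h : z ∈ pQt N r y <;> simp [h, hz]
      rw [e2]
      by_cases h : x ∈ pQt N r y
      · rw [indicator_of_mem h]
        have h1 := hcon y r hr hr7 h
        have h2 : ε ^ N ≤ r ^ N := pow_le_pow_left₀ hε.le hr N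
        linarith
      · rw [indicator_of_notMem h, add_zero]
        exact ha y r hr hr7
    have h1 := le_csSup hbdd (show _ ∈ S from ⟨_, hP, rfl⟩)
    rw [Finset.sum_add_distrib, Finset.sum_ite_eq' X x, if_pos hx] at h1
    linarith
  choose! y r hr1 hr7 hxy hsat using sat
  obtain ⟨u, huX, hdisj, hu⟩ := Vitali.exists_disjoint_subfamily_covering_enlargement
    (fun x => pQt N (r x) (y x)) (X : Set (PSpace N)) r 2 one_lt_two
    (fun x hx => hε.le.trans (hr1 x hx)) (1 / 7) hr7 (fun x hx => ⟨x, hxy x hx⟩)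
  have hfin : u.Finite := X.finite_toSet.subset huX
  have hmem : ∀ b ∈ hfin.toFinset, b ∈ X := fun b hb => huX (by simpa using hb)
  refine (PHcap_le_sum hN zero_le_one hfin.toFinset y (fun x => 7 * r x) (fun b hb =>
    ⟨?_, ?_⟩) ?_).trans ?_
  · linarith [hr1 b (hmem b hb)]
  · linarith [hr7 b (hmem b hb)]
  · intro z hz
    obtain ⟨x, hx, hzx⟩ := mem_iUnion₂.1 (hEX hz)
    obtain ⟨b, hb, ⟨p, hp1, hp2⟩, hrb⟩ := hu x hx
    refine mem_iUnion₂.2 ⟨b, by simpa using hb, mem_pQt.2 ?_⟩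
    have h1 := mem_pQt.1 hzx
    have h2 := mem_pQt.1 (hxy x hx)
    have h3 := mem_pQt.1 hp1
    have h4 := mem_pQt.1 hp2
    rw [qd_comm] at h3
    have h5 := hr1 b (huX hb)
    linarith [qd_triangle z x (y b), qd_triangle x (y x) (y b), qd_triangle (y x) p (y b)]
  · rw [← ENNReal.ofReal_sum_of_nonneg fun b hb => by
      exact pow_nonneg (by linarith [hr1 b (hmem b hb)]) N]
    refine ENNReal.ofReal_le_ofReal ?_
    have h1 : ∑ b ∈ hfin.toFinset, ∑ x ∈ X, (pQt N (r b) (y b)).indicator a x ≤ ∑ x ∈ X, a x := by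
      rw [Finset.sum_comm]
      refine Finset.sum_le_sum fun x _ => ?_
      by_cases hx : ∃ b ∈ hfin.toFinset, x ∈ pQt N (r b) (y b)
      · obtain ⟨b, hb, hxb⟩ := hx
        rw [Finset.sum_eq_single_of_mem b hb, indicator_of_mem hxb]
        intro b' hb' hne
        refine indicator_of_notMem (fun hxb' => ?_) _
        exact (disjoint_left.1 (hdisj (by simpa using hb') (by simpa using hb) hne)) hxb' hxb
      · push Not at hx
        rw [Finset.sum_eq_zero fun b hb => indicator_of_notMem (hx b hb) _]
        exact ha0 x
    calc ∑ b ∈ hfin.toFinset, (7 * r b) ^ N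
        ≤ ∑ b ∈ hfin.toFinset, 2 * 7 ^ N * ∑ x ∈ X, (pQt N (r b) (y b)).indicator a x := by
          refine Finset.sum_le_sum fun b hb => ?_
          have := hsat b (hmem b hb)
          rw [mul_pow]
          have h7 : (0 : ℝ) < 7 ^ N := by positivity
          nlinarith
      _ ≤ _ := by
          rw [← Finset.mul_sum]
          exact mul_le_mul_of_nonneg_left h1 (by positivity)

end frostman

section slabs

/-- The exponential time weight. -/
noncomputable def ewt (s : ℝ) : ℝ≥0∞ := ENNReal.ofReal (Real.exp (-1 * s))

lemma measurable_ewt : Measurable ewt := measurable_expWeight 1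

lemma kap_one_eq_heatMeas : kap N 1 = heatMeas N ewt := rfl

/-- Dyadic time slabs. -/
def slab : ℕ → Set ℝ
  | 0 => Ici 1
  | k + 1 => Ico ((1 / 4 : ℝ) ^ (k + 1)) ((1 / 4) ^ k)

lemma measurableSet_slab : ∀ k, MeasurableSet (slab k)
  | 0 => measurableSet_Ici
  | _ + 1 => measurableSet_Ico

/-- Potential with time weight `w`. -/
noncomputable def wpot (N : ℕ) (w : ℝ → ℝ≥0∞) (F : PSpace N → ℝ≥0∞) (z : PSpace N) : ℝ≥0∞ :=
  ∫⁻ a, F (z - a) ∂heatMeas N w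

lemma wpot_eq {w : ℝ → ℝ≥0∞} (hw : Measurable w) {F : PSpace N → ℝ≥0∞} (hF : Measurable F)
    (z : PSpace N) : wpot N w F z
      = ∫⁻ s in Ioi 0, w s * ∫⁻ y, ENNReal.ofReal (heatK N (y, s)) * F (z - (y, s)) :=
  lintegral_heatMeas hw (G := fun a => F (z - a)) (hF.comp (by fun_prop))

lemma wpot_mono_weight {w w' : ℝ → ℝ≥0∞} (hw : Measurable w) (hw' : Measurable w')
    (h : ∀ s > 0, w s ≤ w' s) {F : PSpace N → ℝ≥0∞} (hF : Measurable F)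
    (z : PSpace N) : wpot N w F z ≤ wpot N w' F z := by
  rw [wpot_eq hw hF, wpot_eq hw' hF]
  exact setLIntegral_mono' measurableSet_Ioi fun s hs => mul_le_mul_left (h s hs) _

lemma measurable_inner {F : PSpace N → ℝ≥0∞} (hF : Measurable F) (z : PSpace N) :
    Measurable fun s : ℝ => ∫⁻ y, ENNReal.ofReal (heatK N (y, s)) * F (z - (y, s)) := by
  have h : Measurable fun p : ℝ × EuclideanSpace ℝ (Fin N) =>
      ENNReal.ofReal (heatK N (p.2, p.1)) * F (z - (p.2, p.1)) :=
    (measurable_heatK.comp measurable_swap).ennreal_ofReal.mul (hF.comp (by fun_prop))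
  exact h.lintegral_prod_right'

lemma wpot_add_weight {w w' : ℝ → ℝ≥0∞} (hw : Measurable w) (hw' : Measurable w')
    {F : PSpace N → ℝ≥0∞} (hF : Measurable F) (z : PSpace N) :
    wpot N (fun s => w s + w' s) F z = wpot N w F z + wpot N w' F z := by
  rw [wpot_eq hw hF, wpot_eq hw' hF, wpot_eq (w := fun s => w s + w' s) (hw.add hw') hF,
    ← lintegral_add_left]
  · simp only [add_mul]
  · exact hw.mul (measurable_inner hF z)

lemma wpot_const_mul_weight {w : ℝ → ℝ≥0∞} (hw : Measurable w) (c : ℝ≥0∞)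
    {F : PSpace N → ℝ≥0∞} (hF : Measurable F) (z : PSpace N) :
    wpot N (fun s => c * w s) F z = c * wpot N w F z := by
  rw [wpot_eq hw hF, wpot_eq (hw.const_mul c) hF, ← lintegral_const_mul]
  · simp only [mul_assoc]
  · exact hw.mul (measurable_inner hF z)

lemma wpot_le_const {w : ℝ → ℝ≥0∞} (hw : Measurable w) {F : PSpace N → ℝ≥0∞} {c : ℝ≥0∞}
    (h : ∀ z, F z ≤ c) (z : PSpace N) : wpot N w F z ≤ c * ∫⁻ s in Ioi 0, w s := by
  rw [← heatMeas_univ (N := N) hw, ← lintegral_const]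
  exact lintegral_mono fun a => h _

/-- Weight of the part of the kernel at times at least `4 ^ (-k)`. -/
noncomputable def headW (k : ℕ) : ℝ → ℝ≥0∞ := (Ici ((1 / 4 : ℝ) ^ k)).indicator ewt

noncomputable def slabW (k : ℕ) : ℝ → ℝ≥0∞ := (slab k).indicator ewt

noncomputable def tailW (k : ℕ) : ℝ → ℝ≥0∞ := (Iio ((1 / 4 : ℝ) ^ k)).indicator ewt

lemma measurable_headW (k : ℕ) : Measurable (headW k) := measurable_ewt.indicator measurableSet_Ici

lemma measurable_slabW (k : ℕ) : Measurable (slabW k) :=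
  measurable_ewt.indicator (measurableSet_slab k)

lemma measurable_tailW (k : ℕ) : Measurable (tailW k) := measurable_ewt.indicator measurableSet_Iio

lemma headW_zero : headW 0 = slabW 0 := by simp [headW, slabW, slab]

lemma headW_succ (k : ℕ) : headW (k + 1) = fun s => headW k s + slabW (k + 1) s := by
  ext s
  have h : (1 / 4 : ℝ) ^ (k + 1) ≤ (1 / 4) ^ k :=
    pow_le_pow_of_le_one (by norm_num) (by norm_num) (Nat.le_succ k)
  by_cases h1 : (1 / 4 : ℝ) ^ k ≤ s
  · have : ¬ s ∈ slab (k + 1) := fun h' => absurd h'.2 (not_lt.2 h1)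
    simp only [headW, slabW]
    rw [indicator_of_mem (show s ∈ Ici _ from h.trans h1), indicator_of_mem (show s ∈ Ici _ from h1),
      indicator_of_notMem this, add_zero]
  · by_cases h2 : (1 / 4 : ℝ) ^ (k + 1) ≤ s
    · simp only [headW, slabW]
      rw [indicator_of_mem (show s ∈ Ici _ from h2), indicator_of_notMem (show s ∉ Ici _ from h1),
        indicator_of_mem (show s ∈ slab (k + 1) from ⟨h2, not_le.1 h1⟩), zero_add]
    · have : ¬ s ∈ slab (k + 1) := fun h' => h2 h'.1
      simp only [headW, slabW]
      rw [indicator_of_notMem (show s ∉ Ici _ from h2), indicator_of_notMem (show s ∉ Ici _ from h1),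
        indicator_of_notMem this, zero_add]

lemma head_add_tail (k : ℕ) : ewt = fun s => headW k s + tailW k s := by
  ext s
  by_cases h : (1 / 4 : ℝ) ^ k ≤ s
  · rw [headW, tailW, indicator_of_mem (show s ∈ Ici _ from h),
      indicator_of_notMem (show s ∉ Iio _ from fun h' => absurd h (not_le.2 h')), add_zero]
  · rw [headW, tailW, indicator_of_notMem (show s ∉ Ici _ from h),
      indicator_of_mem (show s ∈ Iio _ from not_le.1 h), zero_add]

lemma ewt_le_one {s : ℝ} (hs : 0 ≤ s) : ewt s ≤ 1 := by
  rw [ewt, ← ENNReal.ofReal_one]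
  exact ENNReal.ofReal_le_ofReal (Real.exp_le_one_iff.2 (by linarith))

lemma lintegral_tailW (k : ℕ) : ∫⁻ s in Ioi 0, tailW k s ≤ ENNReal.ofReal ((1 / 4) ^ k) := by
  calc ∫⁻ s in Ioi 0, tailW k s ≤ ∫⁻ s in Ioi 0, (Iio ((1 / 4 : ℝ) ^ k)).indicator 1 s := by
        refine setLIntegral_mono' measurableSet_Ioi fun s hs => ?_
        exact indicator_le_indicator' fun _ => ewt_le_one (le_of_lt hs)
    _ = _ := by
        rw [lintegral_indicator_one measurableSet_Iio, Measure.restrict_apply measurableSet_Iio,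
          inter_comm, Ioi_inter_Iio, Real.volume_Ioo, sub_zero]

lemma slab_conv_le (k : ℕ) (t : ℝ) (ht : 0 < t) :
    ∫⁻ s in Ioo 0 t, ewt s * slabW (k + 1) (t - s)
      ≤ ENNReal.ofReal ((1 / 4) ^ k) * headW (k + 1) t := by
  by_cases h : (1 / 4 : ℝ) ^ (k + 1) ≤ t
  · rw [headW, indicator_of_mem (show t ∈ Ici _ from h)]
    have e : ∀ s, ewt s * slabW (k + 1) (t - s)
        = (Ioc (t - (1 / 4) ^ k) (t - (1 / 4) ^ (k + 1))).indicator (fun _ => ewt t) s := by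
      intro s
      by_cases hs : t - s ∈ slab (k + 1)
      · rw [slabW, indicator_of_mem hs, indicator_of_mem, ewt, ewt, ewt,
          ← ENNReal.ofReal_mul (Real.exp_pos _).le, ← Real.exp_add]
        · congr 2; ring
        · exact ⟨by linarith [hs.2], by linarith [hs.1]⟩
      · rw [slabW, indicator_of_notMem hs, indicator_of_notMem, mul_zero]
        exact fun h' => hs ⟨by linarith [h'.2], by linarith [h'.1]⟩
    simp only [e]
    refine (setLIntegral_le_lintegral _ _).trans ?_
    rw [lintegral_indicator_const measurableSet_Ioc, Real.volume_Ioc, mul_comm]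
    refine mul_le_mul_left (ENNReal.ofReal_le_ofReal ?_) _
    have : (0 : ℝ) ≤ (1 / 4) ^ (k + 1) := by positivity
    linarith
  · rw [headW, indicator_of_notMem (show t ∉ Ici _ from h), mul_zero]
    refine le_of_eq ((setLIntegral_congr_fun measurableSet_Ioo fun s hs => ?_).trans
      lintegral_zero)
    rw [slabW, indicator_of_notMem, mul_zero]
    exact fun h' => h (h'.1.trans (by linarith [hs.1]))

section
variable {F : PSpace N → ℝ≥0∞} (hF : Measurable F) {b : ℝ≥0∞}
  (hb : ∀ k z, wpot N (slabW k) F z ≤ b)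
include hF hb

lemma wpot_head_le : ∀ k z, wpot N (headW k) F z ≤ (k + 1) * b
  | 0, z => by rw [headW_zero]; simpa using hb 0 z
  | k + 1, z => by
    rw [headW_succ, wpot_add_weight (measurable_headW k) (measurable_slabW _) hF]
    refine (add_le_add (wpot_head_le k z) (hb (k + 1) z)).trans (le_of_eq ?_)
    push_cast
    ring

lemma lintegral_slab_le (k : ℕ) (z : PSpace N) :
    ∫⁻ a, wpot N (slabW k) F (z - a) ∂kap N 1 ≤ ENNReal.ofReal (4 * (1 / 4) ^ k) * ((k + 1) * b) := by
  cases k with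
  | zero =>
    refine (lintegral_mono fun a => hb 0 (z - a)).trans ?_
    rw [lintegral_const, kap_univ one_pos]
    simp only [div_one, ENNReal.ofReal_one, mul_one, pow_zero, Nat.cast_zero, zero_add, one_mul]
    exact le_mul_of_one_le_left zero_le (by
      rw [← ENNReal.ofReal_one]; exact ENNReal.ofReal_le_ofReal (by norm_num))
  | succ k =>
    have h1 := lintegral_lintegral_heatMeas (N := N) measurable_ewt (measurable_slabW (k + 1))
      (G := fun c => F (z - c)) (hF.comp (by fun_prop))
    simp only [wpot]
    simp only [← sub_sub] at h1
    rw [kap_one_eq_heatMeas, h1]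
    have h2 : ∫⁻ c, F (z - c) ∂heatMeas N (fun t => ∫⁻ s in Ioo 0 t, ewt s * slabW (k + 1) (t - s))
        ≤ wpot N (fun t => ENNReal.ofReal ((1 / 4) ^ k) * headW (k + 1) t) F z :=
      wpot_mono_weight (measurable_timeConv measurable_ewt (measurable_slabW _))
        ((measurable_headW _).const_mul _) (slab_conv_le k) hF z
    refine h2.trans ?_
    rw [wpot_const_mul_weight (measurable_headW _) _ hF]
    have e : (4 : ℝ) * (1 / 4) ^ (k + 1) = (1 / 4) ^ k := by rw [pow_succ]; ring
    rw [e]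
    gcongr
    exact wpot_head_le hF hb (k + 1) z

end

lemma sum_dyadic_le (K : ℕ) : ∑ k ∈ Finset.range K, ((k : ℝ) + 1) * (1 / 2) ^ k ≤ 4 := by
  have h : ∑ k ∈ Finset.range K, ((k : ℝ) + 1) * (1 / 2) ^ k = 4 - (2 * K + 4) * (1 / 2) ^ K := by
    induction K with
    | zero => simp
    | succ K ih => rw [Finset.sum_range_succ, ih, pow_succ]; push_cast; ring
  rw [h]
  have : (0 : ℝ) ≤ (2 * K + 4) * (1 / 2) ^ K := by positivity
  linarith

lemma ofReal_pot {f : PSpace N → ℝ} (hf : BM f) (h0 : ∀ z, 0 ≤ f z) (z : PSpace N) :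
    ENNReal.ofReal (pot N 1 f z) = wpot N ewt (fun z => ENNReal.ofReal (f z)) z :=
  ofReal_integral_eq_lintegral_ofReal (integrable_pot one_pos hf z)
    (Filter.Eventually.of_forall fun _ => h0 _)

lemma exp_half_le_two : Real.exp (1 / 2) ≤ 2 := by
  have h := Real.exp_one_lt_d9
  have h2 : Real.exp (1 / 2) ^ 2 = Real.exp 1 := by rw [← Real.exp_nat_mul]; norm_num
  nlinarith [Real.exp_pos (1 / 2)]

/-- A uniform bound for the potential of an exponential of a potential. -/
lemma pot_exp_le {f : PSpace N → ℝ} (hf : BM f) (h0 : ∀ z, 0 ≤ f z)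
    (hs : ∀ k z, wpot N (slabW k) (fun z => ENNReal.ofReal (f z)) z ≤ ENNReal.ofReal (1 / 2))
    (z : PSpace N) : pot N 1 (fun z => Real.exp (pot N 1 f z) - 1) z ≤ 17 := by
  set F : PSpace N → ℝ≥0∞ := fun z => ENNReal.ofReal (f z) with hFdef
  have hF : Measurable F := hf.1.ennreal_ofReal
  obtain ⟨A, hA⟩ := hf.2
  have hA0 : 0 ≤ A := (abs_nonneg _).trans (hA 0)
  have hFA : ∀ z, F z ≤ ENNReal.ofReal A := fun z =>
    ENNReal.ofReal_le_ofReal ((le_abs_self _).trans (hA z))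
  set P := pot N 1 f
  have hP : BM P := hf.pot one_pos
  have hP0 : ∀ z, 0 ≤ P z := fun z => by
    have := le_pot one_pos hf h0 z
    rwa [zero_div] at this
  have hPA : ∀ z, P z ≤ A := fun z => by
    have := pot_le one_pos hf (fun z => (le_abs_self _).trans (hA z)) z
    rwa [div_one] at this
  obtain ⟨K, hK⟩ : ∃ K : ℕ, A * (1 / 4) ^ K * Real.exp A ≤ 1 := by
    obtain ⟨K, hK⟩ := exists_pow_lt_of_lt_one (show 0 < 1 / (1 + A * Real.exp A) by positivity)
      (show (1 / 4 : ℝ) < 1 by norm_num)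
    refine ⟨K, ?_⟩
    rw [lt_div_iff₀ (by positivity)] at hK
    have : (0 : ℝ) ≤ (1 / 4) ^ K := by positivity
    linarith
  set p : ℕ → PSpace N → ℝ := fun k z => (wpot N (slabW k) F z).toReal with hp
  have hpe : ∀ k z, ENNReal.ofReal (p k z) = wpot N (slabW k) F z := fun k z =>
    ENNReal.ofReal_toReal (ne_top_of_le_ne_top ENNReal.ofReal_ne_top (hs k z))
  have hp0 : ∀ k z, 0 ≤ p k z := fun k z => ENNReal.toReal_nonneg
  have hph : ∀ k z, p k z ≤ 1 / 2 := fun k z => ENNReal.toReal_le_of_le_ofReal (by norm_num) (hs k z)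
  have hhead : ∀ k z, wpot N (headW k) F z = ENNReal.ofReal (∑ j ∈ Finset.range (k + 1), p j z) := by
    intro k z
    induction k with
    | zero => rw [headW_zero, Finset.sum_range_one, hpe]
    | succ k ih =>
      rw [headW_succ, wpot_add_weight (measurable_headW k) (measurable_slabW _) hF, ih,
        Finset.sum_range_succ (fun j => p j z) (k + 1),
        ENNReal.ofReal_add (Finset.sum_nonneg fun j _ => hp0 j z) (hp0 _ z),
        hpe]
  have hsum : ∀ k z, ∑ j ∈ Finset.range k, p j z ≤ k * (1 / 2) := fun k z => by
    refine (Finset.sum_le_card_nsmul _ _ (1 / 2) fun j _ => hph j z).trans ?_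
    simp
  have hexp : ∀ k z, Real.exp (∑ j ∈ Finset.range k, p j z) - 1
      ≤ ∑ j ∈ Finset.range k, 2 ^ (j + 1) * p j z := by
    intro k z
    induction k with
    | zero => simp
    | succ k ih =>
      rw [Finset.sum_range_succ, Finset.sum_range_succ]
      have h1 : Real.exp (∑ j ∈ Finset.range k, p j z + p k z) ≤ 2 ^ (k + 1) := by
        rw [← Finset.sum_range_succ (fun j => p j z)]
        refine (Real.exp_le_exp.2 (hsum (k + 1) z)).trans ?_
        rw [Real.exp_nat_mul]
        exact pow_le_pow_left₀ (Real.exp_pos _).le exp_half_le_two _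
      have h2 : Real.exp (∑ j ∈ Finset.range k, p j z) =
          Real.exp (∑ j ∈ Finset.range k, p j z + p k z) * Real.exp (-p k z) := by
        rw [← Real.exp_add]; congr 1; ring
      have h3 := Real.add_one_le_exp (-p k z)
      have h4 := Real.exp_pos (∑ j ∈ Finset.range k, p j z + p k z)
      nlinarith [hp0 k z]
  have hsplit : ∀ z, P z ≤ ∑ j ∈ Finset.range (K + 1), p j z + A * (1 / 4) ^ K := by
    intro z
    have h1 : ENNReal.ofReal (P z) ≤
        ENNReal.ofReal (∑ j ∈ Finset.range (K + 1), p j z + A * (1 / 4) ^ K) := by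
      rw [ofReal_pot hf h0, head_add_tail K,
        wpot_add_weight (measurable_headW K) (measurable_tailW K) hF, hhead,
        ENNReal.ofReal_add (Finset.sum_nonneg fun j _ => hp0 j z) (by positivity),
        ENNReal.ofReal_mul hA0]
      gcongr
      exact (wpot_le_const (measurable_tailW K) hFA z).trans
        (mul_le_mul_right (lintegral_tailW K) _)
    exact (ENNReal.ofReal_le_ofReal_iff (add_nonneg (Finset.sum_nonneg fun j _ => hp0 j z)
      (by positivity))).1 h1
  have hpt : ∀ z, Real.exp (P z) - 1 ≤ ∑ j ∈ Finset.range (K + 1), 2 ^ (j + 1) * p j z + 1 := by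
    intro z
    set S := ∑ j ∈ Finset.range (K + 1), p j z
    have h1 : Real.exp (P z) - Real.exp S ≤ 1 := by
      have h2 : Real.exp S = Real.exp (P z) * Real.exp (S - P z) := by
        rw [← Real.exp_add]; congr 1; ring
      have h3 := Real.add_one_le_exp (S - P z)
      have h4 := hsplit z
      have h5 : Real.exp (P z) ≤ Real.exp A := Real.exp_le_exp.2 (hPA z)
      have h6 := Real.exp_pos (P z)
      have h7 : (0 : ℝ) ≤ A * (1 / 4) ^ K := by positivity
      calc Real.exp (P z) - Real.exp S = Real.exp (P z) * (1 - Real.exp (S - P z)) := by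
            rw [h2]; ring
        _ ≤ Real.exp (P z) * (A * (1 / 4) ^ K) := by gcongr; linarith
        _ ≤ Real.exp A * (A * (1 / 4) ^ K) := by gcongr
        _ ≤ 1 := by linarith
    linarith [hexp (K + 1) z]
  have hE : BM fun z => Real.exp (P z) - 1 := hP.comp (by fun_prop : Continuous fun x => Real.exp x - 1)
  have hE0 : ∀ z, 0 ≤ Real.exp (P z) - 1 := fun z => by linarith [Real.one_le_exp (hP0 z)]
  have main : ENNReal.ofReal (pot N 1 (fun z => Real.exp (P z) - 1) z) ≤ ENNReal.ofReal 17 := by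
    have hmw : ∀ k, Measurable fun a => wpot N (slabW k) F (z - a) := by
      intro k
      have : SFinite (heatMeas N (slabW k)) := by unfold heatMeas; infer_instance
      have h : Measurable fun q : PSpace N × PSpace N => F (z - q.1 - q.2) := hF.comp (by fun_prop)
      exact h.lintegral_prod_right'
    rw [ofReal_pot hE hE0]
    calc wpot N ewt (fun z => ENNReal.ofReal (Real.exp (P z) - 1)) z
        ≤ ∫⁻ a, (∑ j ∈ Finset.range (K + 1), ENNReal.ofReal (2 ^ (j + 1)) *
            wpot N (slabW j) F (z - a) + 1) ∂kap N 1 := by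
          refine lintegral_mono fun a => ?_
          refine (ENNReal.ofReal_le_ofReal (hpt (z - a))).trans (le_of_eq ?_)
          rw [ENNReal.ofReal_add (Finset.sum_nonneg fun j _ => mul_nonneg (by positivity) (hp0 j _))
            zero_le_one, ENNReal.ofReal_sum_of_nonneg fun j _ => mul_nonneg (by positivity) (hp0 j _),
            ENNReal.ofReal_one]
          congr 1
          refine Finset.sum_congr rfl fun j _ => ?_
          rw [ENNReal.ofReal_mul (by positivity), hpe]
      _ = ∑ j ∈ Finset.range (K + 1), ENNReal.ofReal (2 ^ (j + 1)) *
            ∫⁻ a, wpot N (slabW j) F (z - a) ∂kap N 1 + 1 := by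
          rw [lintegral_add_right _ measurable_const, lintegral_finsetSum]
          · congr 1
            · exact Finset.sum_congr rfl fun j _ => lintegral_const_mul _ (hmw j)
            · rw [lintegral_const, kap_univ one_pos]; simp
          · exact fun j _ => (hmw j).const_mul _
      _ ≤ ∑ j ∈ Finset.range (K + 1), ENNReal.ofReal (4 * (((j : ℝ) + 1) * (1 / 2) ^ j)) + 1 := by
          gcongr with j _
          refine (mul_le_mul_right (lintegral_slab_le hF hs j z) _).trans (le_of_eq ?_)
          have e : ((j : ℝ≥0∞) + 1) = ENNReal.ofReal ((j : ℝ) + 1) := by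
            rw [ENNReal.ofReal_add (by positivity) zero_le_one]; simp
          rw [e, ← ENNReal.ofReal_mul (by positivity), ← ENNReal.ofReal_mul (by positivity),
            ← ENNReal.ofReal_mul (by positivity)]
          congr 1
          have e2 : (1 / 4 : ℝ) ^ j = (1 / 2) ^ j * (1 / 2) ^ j := by rw [← mul_pow]; norm_num
          have e3 : (2 : ℝ) ^ j * (1 / 2) ^ j = 1 := by rw [← mul_pow]; norm_num
          rw [e2, pow_succ]
          linear_combination (4 * (j + 1) * (1 / 2 : ℝ) ^ j) * e3
      _ ≤ ENNReal.ofReal 16 + ENNReal.ofReal 1 := by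
          rw [ENNReal.ofReal_one, ← ENNReal.ofReal_sum_of_nonneg fun j _ => by positivity]
          gcongr
          rw [← Finset.mul_sum]
          linarith [sum_dyadic_le (K + 1)]
      _ = ENNReal.ofReal 17 := by
          rw [← ENNReal.ofReal_add (by norm_num) (by norm_num)]; norm_num
  exact (ENNReal.ofReal_le_ofReal_iff (by norm_num)).1 main

end slabs

section growth

/-- The dimensional constant relating growth of a density to its dyadic potentials. -/
noncomputable def lam (N : ℕ) : ℝ≥0∞ :=
  ∑' m : ℕ, ENNReal.ofReal (Real.exp (-(m : ℝ) ^ 2 / 4) * ((m : ℝ) + 1) ^ N)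

lemma lam_ne_top (N : ℕ) : lam N ≠ ⊤ := by
  have h : Summable fun m : ℕ => Real.exp (-(m : ℝ) ^ 2 / 4) * ((m : ℝ) + 1) ^ N := by
    have h1 : Summable fun m : ℕ => ((m + 1 : ℕ) : ℝ) ^ N * Real.exp (-(1 / 4) * (m + 1 : ℕ)) :=
      (summable_nat_add_iff 1).2 (Real.summable_pow_mul_exp_neg_nat_mul N (by norm_num))
    refine Summable.of_nonneg_of_le (fun m => by positivity) (fun m => ?_)
      (h1.mul_left (Real.exp (1 / 4)))
    have h2 : (m : ℝ) ≤ (m : ℝ) ^ 2 := by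
      exact_mod_cast Nat.le_self_pow two_ne_zero m
    have h3 : Real.exp (-(m : ℝ) ^ 2 / 4) ≤ Real.exp (1 / 4) * Real.exp (-(1 / 4) * (m + 1 : ℕ)) := by
      rw [← Real.exp_add, Real.exp_le_exp]
      push_cast
      linarith
    calc Real.exp (-(m : ℝ) ^ 2 / 4) * ((m : ℝ) + 1) ^ N
        ≤ Real.exp (1 / 4) * Real.exp (-(1 / 4) * (m + 1 : ℕ)) * ((m : ℝ) + 1) ^ N := by gcongr
      _ = _ := by push_cast; ring
  rw [lam, ← ENNReal.ofReal_tsum_of_nonneg (fun m => by positivity) h]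
  exact ENNReal.ofReal_ne_top

lemma one_le_lam (N : ℕ) : 1 ≤ lam N := by
  refine le_trans ?_ (ENNReal.le_tsum (f := fun m : ℕ =>
    ENNReal.ofReal (Real.exp (-(m : ℝ) ^ 2 / 4) * ((m : ℝ) + 1) ^ N)) 0)
  simp

lemma qd_zero_right (a : PSpace N) : qd a 0 = max ‖a.1‖ (Real.sqrt |a.2|) := by
  simp [qd]

lemma qd_sub_self (z a : PSpace N) : qd (z - a) z = qd a 0 := by
  simp [qd]

lemma lintegral_pQt_zero {F : PSpace N → ℝ≥0∞} (r : ℝ) (z : PSpace N) :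
    ∫⁻ a, (pQt N r 0).indicator (fun a => F (z - a)) a = ∫⁻ b in pQt N r z, F b := by
  rw [← lintegral_indicator (measurableSet_pQt r z),
    ← lintegral_sub_left_eq_self (fun b => (pQt N r z).indicator F b) z]
  refine lintegral_congr fun a => ?_
  by_cases h : a ∈ pQt N r 0
  · rw [indicator_of_mem h, indicator_of_mem]
    rw [mem_pQt] at h ⊢
    rwa [qd_sub_self]
  · rw [indicator_of_notMem h, indicator_of_notMem]
    rw [mem_pQt] at h ⊢
    rwa [qd_sub_self]

lemma heatK_prefactor_le {s b : ℝ} (hb : 0 < b) (h : b ^ 2 ≤ 4 * Real.pi * s) :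
    (4 * Real.pi * s) ^ (-(N : ℝ) / 2) ≤ b⁻¹ ^ N := by
  have h1 : (b ^ 2 : ℝ) ^ (-(N : ℝ) / 2) = b⁻¹ ^ N := by
    rw [← Real.rpow_natCast b 2, ← Real.rpow_mul hb.le, inv_pow, ← Real.rpow_natCast b N,
      ← Real.rpow_neg hb.le]
    congr 1
    push_cast
    ring
  rw [← h1]
  exact Real.rpow_le_rpow_of_nonpos (by positivity) h (by
    have : (0 : ℝ) ≤ N := N.cast_nonneg
    linarith)

lemma quarter_pow (k : ℕ) : (1 / 4 : ℝ) ^ k = ((1 / 2) ^ k) ^ 2 := by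
  rw [← pow_mul, mul_comm, pow_mul]; norm_num

lemma heatK_slab_le (k : ℕ) {a : PSpace N} (ha : a.2 ∈ slab (k + 1)) :
    ENNReal.ofReal (heatK N a) ≤ ∑' m : ℕ, ENNReal.ofReal
      (((1 / 2 : ℝ) ^ k)⁻¹ ^ N * Real.exp (-(m : ℝ) ^ 2 / 4)) *
        (pQt N (((m : ℝ) + 1) * (1 / 2) ^ k) 0).indicator 1 a := by
  obtain ⟨y, s⟩ := a
  have hs1 : (1 / 4 : ℝ) ^ (k + 1) ≤ s := ha.1
  have hs2 : s < (1 / 4 : ℝ) ^ k := ha.2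
  have hs : 0 < s := lt_of_lt_of_le (by positivity) hs1
  set b : ℝ := (1 / 2) ^ k with hb
  have hb0 : 0 < b := by positivity
  rw [quarter_pow, ← hb] at hs2
  rw [pow_succ, quarter_pow, ← hb] at hs1
  set m := ⌊‖y‖ / b⌋₊
  have hm1 : (m : ℝ) * b ≤ ‖y‖ := by
    rw [← le_div_iff₀ hb0]; exact Nat.floor_le (by positivity)
  have hm2 : ‖y‖ < ((m : ℝ) + 1) * b := by
    rw [← div_lt_iff₀ hb0]; exact Nat.lt_floor_add_one _
  refine le_trans ?_ (ENNReal.le_tsum m)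
  rw [indicator_of_mem, Pi.one_apply, mul_one, heatK_of_pos hs]
  · refine ENNReal.ofReal_le_ofReal ?_
    gcongr ?_ * ?_
    · refine heatK_prefactor_le hb0 ?_
      nlinarith [Real.pi_gt_three]
    · rw [Real.exp_le_exp, neg_div, neg_div, neg_le_neg_iff, div_le_div_iff₀ (by norm_num) (by positivity)]
      have h1 : ((m : ℝ) * b) ^ 2 ≤ ‖y‖ ^ 2 := by gcongr
      have h2 : (m : ℝ) ^ 2 * s ≤ (m : ℝ) ^ 2 * b ^ 2 := by gcongr
      nlinarith
  · rw [mem_pQt, qd_zero_right, max_lt_iff]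
    refine ⟨hm2, ?_⟩
    rw [abs_of_pos hs]
    refine (Real.sqrt_lt_sqrt hs.le hs2).trans_le ?_
    rw [Real.sqrt_sq hb0.le]
    exact le_mul_of_one_le_left hb0.le (by simp)

/-- Growth of order `N` bounds every dyadic piece of the potential. -/
lemma wpot_slab_le {F : PSpace N → ℝ≥0∞} (hF : Measurable F) {g : ℝ≥0∞}
    (hg : ∀ z r, 0 < r → ∫⁻ b in pQt N r z, F b ≤ g * ENNReal.ofReal (r ^ N))
    (htot : ∫⁻ b, F b ≤ g) (k : ℕ) (z : PSpace N) :
    wpot N (slabW k) F z ≤ g * lam N := by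
  have h0 : wpot N (slabW k) F z
      = ∫⁻ a, (slabW k a.2 * ENNReal.ofReal (heatK N a)) * F (z - a) := by
    rw [wpot, heatMeas, lintegral_withDensity_eq_lintegral_mul _
      (measurable_heatDens (measurable_slabW k))
      (show Measurable fun a => F (z - a) from hF.comp (by fun_prop))]
    rfl
  rw [h0]
  cases k with
  | zero =>
    calc ∫⁻ a, (slabW 0 a.2 * ENNReal.ofReal (heatK N a)) * F (z - a)
        ≤ ∫⁻ a, F (z - a) := by
          refine lintegral_mono fun a => mul_le_of_le_one_left zero_le ?_
          by_cases h : a.2 ∈ slab 0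
          · have h1 : (1 : ℝ) ≤ a.2 := h
            rw [slabW, indicator_of_mem h]
            refine mul_le_one' (ewt_le_one (by linarith)) ?_
            rw [← ENNReal.ofReal_one]
            refine ENNReal.ofReal_le_ofReal ?_
            obtain ⟨y, s⟩ := a
            simp only at h1
            rw [heatK_of_pos (by linarith)]
            refine mul_le_one₀ ?_ (Real.exp_pos _).le ?_
            · simpa using heatK_prefactor_le (N := N) one_pos
                (by nlinarith [Real.pi_gt_three] : (1 : ℝ) ^ 2 ≤ 4 * Real.pi * s)
            · rw [Real.exp_le_one_iff, neg_div, neg_nonpos]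
              positivity
          · rw [slabW, indicator_of_notMem h, zero_mul]
            exact zero_le
      _ = ∫⁻ b, F b := lintegral_sub_left_eq_self F z
      _ ≤ g := htot
      _ ≤ g * lam N := le_mul_of_one_le_right zero_le (one_le_lam N)
  | succ k =>
    set b : ℝ := (1 / 2) ^ k with hb
    have hb0 : 0 < b := by positivity
    set cm : ℕ → ℝ≥0∞ := fun m => ENNReal.ofReal (b⁻¹ ^ N * Real.exp (-(m : ℝ) ^ 2 / 4))
    calc ∫⁻ a, (slabW (k + 1) a.2 * ENNReal.ofReal (heatK N a)) * F (z - a)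
        ≤ ∫⁻ a, ∑' m : ℕ, cm m *
            (pQt N (((m : ℝ) + 1) * b) 0).indicator (fun a => F (z - a)) a := by
          refine lintegral_mono fun a => ?_
          by_cases h : a.2 ∈ slab (k + 1)
          · have h1 : slabW (k + 1) a.2 ≤ 1 := by
              rw [slabW, indicator_of_mem h]
              exact ewt_le_one (le_trans (by positivity) h.1)
            refine (mul_le_mul_left (mul_le_mul' h1 (heatK_slab_le k h)) _).trans (le_of_eq ?_)
            rw [one_mul, ← ENNReal.tsum_mul_right]
            refine tsum_congr fun m => ?_
            rw [mul_assoc, ← hb]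
            congr 1
            by_cases h' : a ∈ pQt N (((m : ℝ) + 1) * b) 0
            · rw [indicator_of_mem h', indicator_of_mem h', Pi.one_apply, one_mul]
            · rw [indicator_of_notMem h', indicator_of_notMem h', zero_mul]
          · rw [slabW, indicator_of_notMem h, zero_mul, zero_mul]
            exact zero_le
      _ = ∑' m : ℕ, cm m * ∫⁻ x in pQt N (((m : ℝ) + 1) * b) z, F x := by
          have hm : ∀ m : ℕ, Measurable
              ((pQt N (((m : ℝ) + 1) * b) 0).indicator (fun a => F (z - a))) := fun m =>
            (hF.comp (by fun_prop)).indicator (measurableSet_pQt _ _)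
          rw [lintegral_tsum fun m => ((hm m).const_mul _).aemeasurable]
          refine tsum_congr fun m => ?_
          rw [lintegral_const_mul _ (hm m), lintegral_pQt_zero]
      _ ≤ ∑' m : ℕ, g * ENNReal.ofReal (Real.exp (-(m : ℝ) ^ 2 / 4) * ((m : ℝ) + 1) ^ N) := by
          refine ENNReal.tsum_le_tsum fun m => ?_
          refine (mul_le_mul_right (hg z _ (by positivity)) _).trans (le_of_eq ?_)
          rw [mul_left_comm, ← ENNReal.ofReal_mul (by positivity)]
          congr 2
          rw [mul_pow, inv_pow]
          field_simp
      _ = g * lam N := by rw [ENNReal.tsum_mul_left, lam]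

end growth

section density

/-- Volume of the unit cylinder. -/
noncomputable def cylVol (N : ℕ) : ℝ :=
  2 * (volume (ball (0 : EuclideanSpace ℝ (Fin N)) 1)).toReal

lemma cylVol_pos (N : ℕ) : 0 < cylVol N :=
  mul_pos two_pos (ENNReal.toReal_pos (measure_ball_pos _ _ one_pos).ne' measure_ball_lt_top.ne)

lemma volume_pQt {r : ℝ} (hr : 0 < r) (z : PSpace N) :
    volume (pQt N r z) = ENNReal.ofReal (cylVol N * r ^ (N + 2)) := by
  rw [pQt, Measure.volume_eq_prod, Measure.prod_prod, Measure.addHaar_ball_of_pos _ _ hr,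
    Real.volume_Ioo, finrank_euclideanSpace_fin,
    ← ENNReal.ofReal_toReal (measure_ball_lt_top (μ := volume)
      (x := (0 : EuclideanSpace ℝ (Fin N))) (r := 1)).ne, ← ENNReal.ofReal_mul (by positivity),
    ← ENNReal.ofReal_mul (by positivity), cylVol]
  congr 1
  ring

/-- Point masses `a i` at `p i`, spread uniformly over cylinders of radius `ε`. -/
noncomputable def spread {ι : Type*} (ε : ℝ) (S : Finset ι) (p : ι → PSpace N) (a : ι → ℝ)
    (z : PSpace N) : ℝ :=
  ∑ i ∈ S, a i / (cylVol N * ε ^ (N + 2)) * (pQt N ε (p i)).indicator 1 z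

variable {ι : Type*} {ε : ℝ} {S : Finset ι} {p : ι → PSpace N} {a : ι → ℝ}

lemma spread_nonneg (hε : 0 < ε) (ha : ∀ i, 0 ≤ a i) (z : PSpace N) : 0 ≤ spread ε S p a z := by
  have := cylVol_pos N
  exact Finset.sum_nonneg fun i _ => mul_nonneg (div_nonneg (ha i) (by positivity))
    (indicator_nonneg (fun _ _ => zero_le_one) _)

lemma spread_eq_zero {z : PSpace N} (h : ∀ i ∈ S, z ∉ pQt N ε (p i)) : spread ε S p a z = 0 :=
  Finset.sum_eq_zero fun i hi => by rw [indicator_of_notMem (h i hi), mul_zero]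

lemma measurable_spread : Measurable (spread ε S p a) :=
  Finset.measurable_sum _ fun i _ =>
    (measurable_one.indicator (measurableSet_pQt ε (p i))).const_mul _

lemma spread_le (hε : 0 < ε) (ha : ∀ i, 0 ≤ a i) (z : PSpace N) :
    spread ε S p a z ≤ ∑ i ∈ S, a i / (cylVol N * ε ^ (N + 2)) := by
  have := cylVol_pos N
  refine Finset.sum_le_sum fun i _ => mul_le_of_le_one_right
    (div_nonneg (ha i) (by positivity)) ?_
  exact indicator_apply_le' (fun _ => le_rfl) fun _ => zero_le_one

lemma bm_spread (hε : 0 < ε) (ha : ∀ i, 0 ≤ a i) : BM (spread ε S p a) :=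
  ⟨measurable_spread, ∑ i ∈ S, a i / (cylVol N * ε ^ (N + 2)), fun z => by
    rw [abs_of_nonneg (spread_nonneg hε ha z)]; exact spread_le hε ha z⟩

lemma lintegral_spread (hε : 0 < ε) (ha : ∀ i, 0 ≤ a i) {k : PSpace N → ℝ≥0∞} (hk : Measurable k) :
    ∫⁻ z, k z * ENNReal.ofReal (spread ε S p a z)
      = ∑ i ∈ S, ENNReal.ofReal (a i / (cylVol N * ε ^ (N + 2))) *
          ∫⁻ z in pQt N ε (p i), k z := by
  have h0 := cylVol_pos N
  have h1 : ∀ z, k z * ENNReal.ofReal (spread ε S p a z)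
      = ∑ i ∈ S, ENNReal.ofReal (a i / (cylVol N * ε ^ (N + 2))) *
          (pQt N ε (p i)).indicator k z := by
    intro z
    have hn : ∀ i ∈ S, 0 ≤ a i / (cylVol N * ε ^ (N + 2)) * (pQt N ε (p i)).indicator 1 z :=
      fun i _ => mul_nonneg (div_nonneg (ha i) (by positivity))
        (indicator_nonneg (fun _ _ => zero_le_one) _)
    rw [spread, ENNReal.ofReal_sum_of_nonneg hn, Finset.mul_sum]
    refine Finset.sum_congr rfl fun i _ => ?_
    rw [ENNReal.ofReal_mul (div_nonneg (ha i) (by positivity))]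
    by_cases h : z ∈ pQt N ε (p i)
    · simp [indicator_of_mem h, mul_comm]
    · simp [indicator_of_notMem h]
  simp_rw [h1]
  rw [lintegral_finsetSum _ fun i _ => (hk.indicator (measurableSet_pQt _ _)).const_mul _]
  refine Finset.sum_congr rfl fun i _ => ?_
  rw [lintegral_const_mul _ (hk.indicator (measurableSet_pQt _ _)),
    lintegral_indicator (measurableSet_pQt _ _)]

lemma lintegral_spread_total (hε : 0 < ε) (ha : ∀ i, 0 ≤ a i) :
    ∫⁻ z, ENNReal.ofReal (spread ε S p a z) = ENNReal.ofReal (∑ i ∈ S, a i) := by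
  have h0 := cylVol_pos N
  have h := lintegral_spread (S := S) (p := p) hε ha (k := fun _ => 1) measurable_const
  simp only [one_mul] at h
  rw [h, ENNReal.ofReal_sum_of_nonneg fun i _ => ha i]
  refine Finset.sum_congr rfl fun i _ => ?_
  rw [lintegral_one, Measure.restrict_apply_univ, volume_pQt hε,
    ← ENNReal.ofReal_mul (div_nonneg (ha i) (by positivity))]
  congr 1
  field_simp

lemma lintegral_spread_pQt_le (hε : 0 < ε) (ha : ∀ i, 0 ≤ a i) {C : ℝ}
    (hgr : ∀ y r, ε ≤ r → ∑ i ∈ S, (p ⁻¹' pQt N r y).indicator a i ≤ C * r ^ N)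
    (y : PSpace N) {r : ℝ} (hr : 0 < r) :
    ∫⁻ z in pQt N r y, ENNReal.ofReal (spread ε S p a z) ≤ ENNReal.ofReal (C * 2 ^ N * r ^ N) := by
  have h0 := cylVol_pos N
  have h := lintegral_spread (S := S) (p := p) hε ha (k := (pQt N r y).indicator 1)
    (measurable_one.indicator (measurableSet_pQt _ _))
  have h2 : ∀ z, (pQt N r y).indicator 1 z * ENNReal.ofReal (spread ε S p a z)
      = (pQt N r y).indicator (fun z => ENNReal.ofReal (spread ε S p a z)) z := by
    intro z
    by_cases h : z ∈ pQt N r y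
    · simp [indicator_of_mem h]
    · simp [indicator_of_notMem h]
  simp_rw [h2] at h
  rw [lintegral_indicator (measurableSet_pQt _ _)] at h
  rw [h]
  set m := min r ε
  set M := max r ε
  have hm : 0 < m := lt_min hr hε
  have hM : ε ≤ 2 * M := by
    have : ε ≤ M := le_max_right _ _
    linarith
  have hmM : m * M = r * ε := min_mul_max _ _
  have hme : m / ε ≤ 1 := (div_le_one hε).2 (min_le_right _ _)
  have key : ∀ i ∈ S, ENNReal.ofReal (a i / (cylVol N * ε ^ (N + 2))) *
      ∫⁻ z in pQt N ε (p i), (pQt N r y).indicator 1 z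
      ≤ ENNReal.ofReal ((m / ε) ^ N * (p ⁻¹' pQt N (2 * M) y).indicator a i) := by
    intro i _
    rw [lintegral_indicator_one (measurableSet_pQt _ _),
      Measure.restrict_apply (measurableSet_pQt _ _)]
    by_cases hi : p i ∈ pQt N (2 * M) y
    · rw [indicator_of_mem (show i ∈ p ⁻¹' pQt N (2 * M) y from hi)]
      have hv : volume (pQt N r y ∩ pQt N ε (p i)) ≤ ENNReal.ofReal (cylVol N * m ^ (N + 2)) := by
        rcases min_choice r ε with h | h
        · rw [show m = r from h, ← volume_pQt hr y]; exact measure_mono inter_subset_left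
        · rw [show m = ε from h, ← volume_pQt hε (p i)]; exact measure_mono inter_subset_right
      refine (mul_le_mul_right hv _).trans ?_
      rw [← ENNReal.ofReal_mul (div_nonneg (ha i) (by positivity))]
      refine ENNReal.ofReal_le_ofReal ?_
      have e : a i / (cylVol N * ε ^ (N + 2)) * (cylVol N * m ^ (N + 2)) =
          (m / ε) ^ N * a i * (m / ε) ^ 2 := by
        rw [div_pow, div_pow]; field_simp; ring
      rw [e]
      exact mul_le_of_le_one_right (mul_nonneg (by positivity) (ha i))
        (pow_le_one₀ (by positivity) hme)
    · have : pQt N r y ∩ pQt N ε (p i) = ∅ := by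
        refine eq_empty_of_forall_notMem fun z hz => hi ?_
        have h1 := mem_pQt.1 hz.1
        have h2 := mem_pQt.1 hz.2
        rw [mem_pQt]
        have h3 := qd_triangle (p i) z y
        rw [qd_comm (p i) z] at h3
        have h4 : r ≤ M := le_max_left _ _
        have h5 : ε ≤ M := le_max_right _ _
        linarith
      rw [this, measure_empty, mul_zero]
      exact zero_le
  refine (Finset.sum_le_sum key).trans ?_
  rw [← ENNReal.ofReal_sum_of_nonneg fun i _ => mul_nonneg (by positivity)
    (indicator_nonneg (fun _ _ => ha _) _), ← Finset.mul_sum]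
  refine ENNReal.ofReal_le_ofReal ?_
  refine (mul_le_mul_of_nonneg_left (hgr y _ hM) (by positivity)).trans (le_of_eq ?_)
  have e : (m / ε) * (2 * M) = 2 * r := by field_simp; linarith
  calc (m / ε) ^ N * (C * (2 * M) ^ N) = C * ((m / ε) * (2 * M)) ^ N := by rw [mul_pow]; ring
    _ = _ := by rw [e, mul_pow]; ring

lemma le_pot_spread (hε : 0 < ε) (ha : ∀ i, 0 ≤ a i) (w : PSpace N) {L : ι → ℝ}
    (hL0 : ∀ i, 0 ≤ L i)
    (hL : ∀ i ∈ S, ∀ b ∈ pQt N ε (p i), L i ≤ Real.exp (-(w.2 - b.2)) * heatK N (w - b)) :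
    ∑ i ∈ S, L i * a i ≤ pot N 1 (spread ε S p a) w := by
  have h0 := cylVol_pos N
  have hP0 : 0 ≤ pot N 1 (spread ε S p a) w := by
    have := le_pot one_pos (bm_spread (S := S) (p := p) hε ha) (spread_nonneg hε ha) w
    rwa [zero_div] at this
  refine (ENNReal.ofReal_le_ofReal_iff hP0).1 ?_
  rw [ofReal_pot (bm_spread hε ha) (spread_nonneg hε ha)]
  set F : PSpace N → ℝ≥0∞ := fun z => ENNReal.ofReal (spread ε S p a z)
  have hF : Measurable F := measurable_spread.ennreal_ofReal
  set k : PSpace N → ℝ≥0∞ := fun a => ewt a.2 * ENNReal.ofReal (heatK N a)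
  have hk : Measurable k := measurable_heatDens measurable_ewt
  have h1 : wpot N ewt F w = ∫⁻ b, k (w - b) * F b := by
    rw [wpot, heatMeas, lintegral_withDensity_eq_lintegral_mul _ hk
      (show Measurable fun a => F (w - a) from hF.comp (by fun_prop)),
      ← lintegral_sub_left_eq_self _ w]
    simp
  rw [h1, lintegral_spread hε ha (k := fun b => k (w - b)) (hk.comp (by fun_prop)),
    ENNReal.ofReal_sum_of_nonneg fun i _ => mul_nonneg (hL0 i) (ha i)]
  refine Finset.sum_le_sum fun i hi => ?_
  have h2 : ENNReal.ofReal (L i) * volume (pQt N ε (p i)) ≤ ∫⁻ b in pQt N ε (p i), k (w - b) := by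
    rw [← setLIntegral_const]
    refine setLIntegral_mono' (measurableSet_pQt _ _) fun b hb => ?_
    simp only [k, ewt]
    rw [← ENNReal.ofReal_mul (Real.exp_pos _).le]
    refine ENNReal.ofReal_le_ofReal ((hL i hi b hb).trans (le_of_eq ?_))
    congr 2
    simp
  refine le_trans (le_of_eq ?_) (mul_le_mul_right h2 _)
  rw [volume_pQt hε, ← ENNReal.ofReal_mul (hL0 i),
    ← ENNReal.ofReal_mul (div_nonneg (ha i) (by positivity))]
  congr 1
  field_simp

end density

section wiener

/-- Dyadic pieces of the complement in the past of `z`. -/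
def capE (O : Set (PSpace N)) (z : PSpace N) (j : ℕ) : Set (PSpace N) :=
  Oᶜ ∩ (ball z.1 ((1 / 2) ^ j / 30) ×ˢ
    Ioo (z.2 - 30 * ((1 / 2) ^ j) ^ 2) (z.2 - ((1 / 2) ^ (j + 1)) ^ 2))

lemma PHcap_mono {ρ : ℝ} {E E' : Set (PSpace N)} (h : E ⊆ E') : PHcap N ρ E ≤ PHcap N ρ E' :=
  le_iInf₂ fun c hc => iInf₂_le_of_le c ⟨hc.1, h.trans hc.2⟩ le_rfl

lemma PHcap_ne_top (hN : N ≠ 0) {E : Set (PSpace N)} (hE : Bornology.IsBounded E) :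
    PHcap N 1 E ≠ ⊤ := by
  obtain ⟨X, -, hX⟩ := exists_finite_net hE one_pos
  refine ne_top_of_le_ne_top ?_ (PHcap_le_sum hN zero_le_one X id (fun _ => 1)
    (fun _ _ => ⟨zero_le_one, le_rfl⟩) hX)
  exact ENNReal.sum_ne_top.2 fun _ _ => ENNReal.ofReal_ne_top

lemma capE_subset_pQt (O : Set (PSpace N)) (z : PSpace N) (j : ℕ) :
    capE O z j ⊆ pQt N (6 * (1 / 2) ^ j) z := by
  rintro p ⟨-, h1, h2⟩
  have hb : (0 : ℝ) < (1 / 2) ^ j := by positivity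
  have hb' : (0 : ℝ) < (1 / 2) ^ (j + 1) := by positivity
  set b : ℝ := (1 / 2) ^ j
  refine ⟨ball_subset_ball (by linarith) h1, ?_, ?_⟩
  · nlinarith [h2.1]
  · nlinarith [h2.2]

lemma isBounded_capE (O : Set (PSpace N)) (z : PSpace N) (j : ℕ) :
    Bornology.IsBounded (capE O z j) :=
  (isBounded_ball.prod (isBounded_Ioo _ _)).subset inter_subset_right

lemma tsum_capE_eq_top (O : Set (PSpace N)) (z : PSpace N)
    (h : ∫⁻ ρ in Ioo (0 : ℝ) 1, PHcap N 1 (Oᶜ ∩ (ball z.1 (ρ / 30) ×ˢ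
      Ioo (z.2 - 30 * ρ ^ 2) (z.2 - ρ ^ 2))) / ENNReal.ofReal (ρ ^ (N + 1)) = ⊤) :
    ∑' j, PHcap N 1 (capE O z j) * ENNReal.ofReal ((2 ^ (j + 1)) ^ N) = ⊤ := by
  rw [eq_top_iff, ← h]
  have hsub : Ioo (0 : ℝ) 1 ⊆ ⋃ j : ℕ, Ico ((1 / 2) ^ (j + 1)) ((1 / 2) ^ j) := by
    intro ρ hρ
    obtain ⟨n, h1, h2⟩ := exists_nat_pow_near_of_lt_one hρ.1 hρ.2.le
      (show (0 : ℝ) < 1 / 2 by norm_num) (by norm_num)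
    rcases h2.lt_or_eq with h2 | h2
    · exact mem_iUnion.2 ⟨n, h1.le, h2⟩
    · cases n with
      | zero => simp at h2; linarith [hρ.2]
      | succ n =>
        refine mem_iUnion.2 ⟨n, h2.ge, h2.trans_lt ?_⟩
        exact pow_lt_pow_right_of_lt_one₀ (by norm_num) (by norm_num) (Nat.lt_succ_self n)
  refine (lintegral_mono_set hsub).trans ((lintegral_iUnion_le _ _).trans ?_)
  refine ENNReal.tsum_le_tsum fun j => ?_
  set b : ℝ := (1 / 2) ^ (j + 1) with hb
  have hb0 : 0 < b := by positivity
  have hb2 : (1 / 2 : ℝ) ^ j = 2 * b := by rw [hb, pow_succ]; ring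
  have hb3 : (2 : ℝ) ^ (j + 1) = b⁻¹ := by rw [hb, ← inv_pow]; norm_num
  calc ∫⁻ ρ in Ico b ((1 / 2) ^ j), PHcap N 1 (Oᶜ ∩ (ball z.1 (ρ / 30) ×ˢ
        Ioo (z.2 - 30 * ρ ^ 2) (z.2 - ρ ^ 2))) / ENNReal.ofReal (ρ ^ (N + 1))
      ≤ ∫⁻ _ in Ico b ((1 / 2) ^ j), PHcap N 1 (capE O z j) / ENNReal.ofReal (b ^ (N + 1)) := by
        refine setLIntegral_mono' measurableSet_Ico fun ρ hρ => ?_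
        have hρ0 : 0 < ρ := hb0.trans_le hρ.1
        have hρ1 := hρ.2
        refine ENNReal.div_le_div (PHcap_mono ?_)
          (ENNReal.ofReal_le_ofReal (pow_le_pow_left₀ hb0.le hρ.1 _))
        refine inter_subset_inter_right _ (prod_mono (ball_subset_ball (by linarith))
          (Ioo_subset_Ioo ?_ ?_))
        · gcongr
        · rw [← hb]; gcongr; exact hρ.1
    _ = PHcap N 1 (capE O z j) * ENNReal.ofReal ((2 ^ (j + 1)) ^ N) := by
        rw [setLIntegral_const, Real.volume_Ico, hb2, hb3, div_eq_mul_inv,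
          ← ENNReal.ofReal_inv_of_pos (by positivity), mul_assoc,
          ← ENNReal.ofReal_mul (by positivity)]
        congr 2
        rw [inv_pow]
        field_simp
        ring

lemma exists_sum_Ico_ge {T : ℕ → ℝ≥0∞} (hT : ∑' j, T j = ⊤) (hf : ∀ j, T j ≠ ⊤) (m : ℕ)
    {S : ℝ≥0∞} (hS : S ≠ ⊤) : ∃ J, S ≤ ∑ j ∈ Finset.Ico m J, T j := by
  have h := ENNReal.summable.hasSum.tendsto_sum_nat (f := T)
  rw [hT] at h
  have hA : ∑ j ∈ Finset.range m, T j ≠ ⊤ := ENNReal.sum_ne_top.2 fun j _ => hf j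
  obtain ⟨J, h1, h2⟩ := ((h.eventually (lt_mem_nhds (b := ⊤)
    (ENNReal.add_lt_top.2 ⟨hA.lt_top, hS.lt_top⟩))).and
    (Filter.eventually_ge_atTop m)).exists
  refine ⟨J, ?_⟩
  rw [← Finset.sum_range_add_sum_Ico _ h2] at h1
  exact le_of_lt ((ENNReal.add_lt_add_iff_left hA).1 h1)

lemma sum_half_pow_le {s : Finset ℕ} {R : ℝ} (hR : 0 ≤ R) (h : ∀ j ∈ s, (1 / 2 : ℝ) ^ j ≤ R) :
    ∑ j ∈ s, (1 / 2 : ℝ) ^ j ≤ 2 * R := by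
  rcases s.eq_empty_or_nonempty with rfl | hne
  · simpa using hR
  set m := s.min' hne
  have hI : ∀ n, m ≤ n → ∑ j ∈ Finset.Ico m n, (1 / 2 : ℝ) ^ j = 2 * (1 / 2) ^ m - 2 * (1 / 2) ^ n := by
    intro n hn
    induction n, hn using Nat.le_induction with
    | base => simp
    | succ n hn ih => rw [Finset.sum_Ico_succ_top hn, ih, pow_succ]; ring
  have hm : m ∈ s := s.min'_mem hne
  calc ∑ j ∈ s, (1 / 2 : ℝ) ^ j ≤ ∑ j ∈ Finset.Ico m (s.max' hne + 1), (1 / 2 : ℝ) ^ j := by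
        refine Finset.sum_le_sum_of_subset_of_nonneg (fun j hj => ?_) fun j _ _ => by positivity
        exact Finset.mem_Ico.2 ⟨s.min'_le j hj, Nat.lt_succ_of_le (s.le_max' j hj)⟩
    _ ≤ 2 * (1 / 2) ^ m := by
        rw [hI (s.max' hne + 1) ((s.le_max' m hm).trans (Nat.le_succ _))]
        have : (0 : ℝ) ≤ (1 / 2) ^ (s.max' hne + 1) := by positivity
        linarith
    _ ≤ 2 * R := by linarith [h m hm]

/-- Pieces at widely separated scales do not meet a common small cylinder. -/
lemma scale_separation {O : Set (PSpace N)} {z y p q : PSpace N} {r : ℝ} {i j : ℕ} (hr : 0 < r)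
    (hp : p ∈ capE O z i) (hq : q ∈ capE O z j) (hpy : p ∈ pQt N r y) (hqy : q ∈ pQt N r y)
    (hri : 4 * r < (1 / 2) ^ i) : j ≤ i + 3 := by
  by_contra! hlt
  have h1 : (1 / 2 : ℝ) ^ j ≤ (1 / 2) ^ (i + 4) :=
    pow_le_pow_of_le_one (by norm_num) (by norm_num) hlt
  have a1 := hp.2.2.2
  have a2 := hq.2.2.1
  have a3 := hpy.2.1
  have a4 := hqy.2.2
  rw [pow_add] at h1
  rw [pow_succ (1 / 2 : ℝ) i] at a1
  have hb : (0 : ℝ) < (1 / 2) ^ i := by positivity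
  have hc : (0 : ℝ) < (1 / 2) ^ j := by positivity
  set b : ℝ := (1 / 2) ^ i
  set c : ℝ := (1 / 2) ^ j
  have h2 : c ^ 2 ≤ (b * (1 / 2) ^ 4) ^ 2 := by gcongr
  have h3 : (4 * r) ^ 2 < b ^ 2 := by gcongr
  nlinarith

section
variable {O : Set (PSpace N)} {z : PSpace N} {J : ℕ} {ε : ℝ} {X : ℕ → Finset (PSpace N)}
  {a : ℕ → PSpace N → ℝ}

lemma mass_le (hX : ∀ j, ↑(X j) ⊆ capE O z j) (hεJ : ε ≤ (1 / 2) ^ J)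
    (hgr : ∀ j y r, ε ≤ r → r ≤ 1 / 7 → ∑ x ∈ X j, (pQt N r y).indicator (a j) x ≤ r ^ N)
    {j : ℕ} (h6 : 6 ≤ j) (hjJ : j < J) : ∑ x ∈ X j, a j x ≤ (6 * (1 / 2) ^ j) ^ N := by
  have hb : (0 : ℝ) < (1 / 2) ^ j := by positivity
  have h1 : (1 / 2 : ℝ) ^ J ≤ (1 / 2) ^ j := pow_le_pow_of_le_one (by norm_num) (by norm_num) hjJ.le
  have h2 : (1 / 2 : ℝ) ^ j ≤ (1 / 2) ^ 6 := pow_le_pow_of_le_one (by norm_num) (by norm_num) h6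
  refine le_trans (le_of_eq ?_) (hgr j z _ (by linarith) (by norm_num at h2 ⊢; linarith))
  exact Finset.sum_congr rfl fun x hx =>
    (indicator_of_mem (capE_subset_pQt O z j (hX j hx)) _).symm

lemma growth_le (hN : N ≠ 0) (hε : 0 < ε) (hX : ∀ j, ↑(X j) ⊆ capE O z j) (hεJ : ε ≤ (1 / 2) ^ J)
    (ha : ∀ j x, 0 ≤ a j x)
    (hgr : ∀ j y r, ε ≤ r → r ≤ 1 / 7 → ∑ x ∈ X j, (pQt N r y).indicator (a j) x ≤ r ^ N)
    (y : PSpace N) {r : ℝ} (hr : ε ≤ r) :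
    ∑ j ∈ Finset.Ico 6 J, ∑ x ∈ X j, (pQt N r y).indicator (a j) x ≤ (2 * 24 ^ N + 4) * r ^ N := by
  have hr0 : 0 < r := hε.trans_le hr
  set A : ℕ → ℝ := fun j => ∑ x ∈ X j, (pQt N r y).indicator (a j) x
  have hAm : ∀ j, A j ≤ ∑ x ∈ X j, a j x := fun j => Finset.sum_le_sum fun x _ =>
    indicator_apply_le' (fun _ => le_rfl) fun _ => ha j x
  rw [← Finset.sum_filter_add_sum_filter_not _ (fun j : ℕ => (1 / 2 : ℝ) ^ j ≤ 4 * r), add_mul]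
  refine add_le_add ?_ ?_
  · obtain ⟨n, rfl⟩ := Nat.exists_eq_succ_of_ne_zero hN
    calc ∑ j ∈ Finset.Ico 6 J with (1 / 2 : ℝ) ^ j ≤ 4 * r, A j
        ≤ ∑ j ∈ Finset.Ico 6 J with (1 / 2 : ℝ) ^ j ≤ 4 * r,
            6 ^ (n + 1) * (4 * r) ^ n * (1 / 2) ^ j := by
          refine Finset.sum_le_sum fun j hj => ?_
          rw [Finset.mem_filter, Finset.mem_Ico] at hj
          refine (hAm j).trans ((mass_le hX hεJ hgr hj.1.1 hj.1.2).trans ?_)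
          rw [mul_pow, pow_succ ((1 / 2 : ℝ) ^ j), ← mul_assoc]
          gcongr
          exact hj.2
      _ ≤ 6 ^ (n + 1) * (4 * r) ^ n * (2 * (4 * r)) := by
          rw [← Finset.mul_sum]
          gcongr
          exact sum_half_pow_le (by positivity) fun j hj => (Finset.mem_filter.1 hj).2
      _ = 2 * 24 ^ (n + 1) * r ^ (n + 1) := by
          rw [show (24 : ℝ) = 6 * 4 by norm_num, mul_pow, mul_pow, pow_succ, pow_succ, pow_succ]
          ring
  · rw [← Finset.sum_filter_ne_zero]
    set T := {j ∈ {j ∈ Finset.Ico 6 J | ¬ (1 / 2 : ℝ) ^ j ≤ 4 * r} | A j ≠ 0} with hT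
    have hmem : ∀ j ∈ T, 6 ≤ j ∧ 4 * r < (1 / 2) ^ j ∧ ∃ x ∈ capE O z j, x ∈ pQt N r y := by
      intro j hj
      rw [hT, Finset.mem_filter, Finset.mem_filter, Finset.mem_Ico] at hj
      obtain ⟨x, hx, hx0⟩ := Finset.exists_ne_zero_of_sum_ne_zero hj.2
      exact ⟨hj.1.1.1, not_le.1 hj.1.2, x, hX j hx, by
        by_contra h
        exact hx0 (indicator_of_notMem h _)⟩
    have hcard : T.card ≤ 4 := by
      rcases T.eq_empty_or_nonempty with h | hne
      · rw [h]; simp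
      obtain ⟨-, h2, p, hp, hpy⟩ := hmem _ (T.min'_mem hne)
      have hsub : T ⊆ Finset.Icc (T.min' hne) (T.min' hne + 3) := by
        intro j hj
        obtain ⟨-, -, q, hq, hqy⟩ := hmem j hj
        exact Finset.mem_Icc.2 ⟨T.min'_le j hj, scale_separation hr0 hp hq hpy hqy h2⟩
      refine (Finset.card_le_card hsub).trans (le_of_eq ?_)
      rw [Nat.card_Icc]
      omega
    calc ∑ j ∈ T, A j ≤ T.card • r ^ N := by
          refine Finset.sum_le_card_nsmul _ _ _ fun j hj => ?_
          obtain ⟨h6, h4, -⟩ := hmem j hj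
          have h2 : (1 / 2 : ℝ) ^ j ≤ (1 / 2) ^ 6 :=
            pow_le_pow_of_le_one (by norm_num) (by norm_num) h6
          exact hgr j y r hr (by norm_num at h2 h4 ⊢; linarith)
      _ ≤ 4 * r ^ N := by
          rw [nsmul_eq_mul]
          gcongr
          exact_mod_cast hcard

end

end wiener

section boundary

lemma heatK_lower {b s : ℝ} (hb : 0 < b) (hb1 : b ≤ 1 / 64) (hs1 : b ^ 2 / 8 ≤ s)
    (hs2 : s ≤ 31 * b ^ 2) {y : EuclideanSpace ℝ (Fin N)} (hy : ‖y‖ ≤ b) :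
    Real.exp (-3) * (20 * b)⁻¹ ^ N ≤ Real.exp (-s) * heatK N (y, s) := by
  have hs : 0 < s := lt_of_lt_of_le (by positivity) hs1
  have h1 : ((20 * b) ^ 2 : ℝ) ^ (-(N : ℝ) / 2) = (20 * b)⁻¹ ^ N := by
    have hb' : 0 < 20 * b := by positivity
    rw [← Real.rpow_natCast _ 2, ← Real.rpow_mul hb'.le, inv_pow, ← Real.rpow_natCast _ N,
      ← Real.rpow_neg hb'.le]
    congr 1
    push_cast
    ring
  have h2 : (20 * b)⁻¹ ^ N ≤ (4 * Real.pi * s) ^ (-(N : ℝ) / 2) := by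
    rw [← h1]
    refine Real.rpow_le_rpow_of_nonpos (by positivity) ?_ (by
      have : (0 : ℝ) ≤ N := N.cast_nonneg
      linarith)
    have := Real.pi_lt_d2
    calc 4 * Real.pi * s ≤ 4 * 3.15 * (31 * b ^ 2) := by gcongr
      _ ≤ (20 * b) ^ 2 := by nlinarith [sq_nonneg b]
  have h3 : Real.exp (-3) ≤ Real.exp (-s) * Real.exp (-‖y‖ ^ 2 / (4 * s)) := by
    rw [← Real.exp_add, Real.exp_le_exp]
    have h4 : ‖y‖ ^ 2 / (4 * s) ≤ 2 := by
      rw [div_le_iff₀ (by positivity)]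
      have : ‖y‖ ^ 2 ≤ b ^ 2 := by gcongr
      linarith
    have h5 : s ≤ 1 := by nlinarith
    rw [neg_div]
    linarith
  rw [heatK_of_pos hs]
  calc Real.exp (-3) * (20 * b)⁻¹ ^ N
      ≤ (Real.exp (-s) * Real.exp (-‖y‖ ^ 2 / (4 * s))) * (4 * Real.pi * s) ^ (-(N : ℝ) / 2) := by
        gcongr
    _ = _ := by ring

/-- The kernel is large between a point near `z` and a point near a piece of the complement. -/
lemma kernel_capE {O : Set (PSpace N)} {z w x b : PSpace N} {δ ε : ℝ} {j J : ℕ} (h6 : 6 ≤ j)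
    (hjJ : j < J) (hδ : δ = (1 / 2) ^ J / 100) (hεδ : ε ≤ δ) (hε : 0 < ε) (hw : w ∈ pQ N δ z)
    (hx : x ∈ capE O z j) (hb : b ∈ pQt N ε x) :
    Real.exp (-3) * (20 * (1 / 2) ^ j)⁻¹ ^ N ≤ Real.exp (-(w.2 - b.2)) * heatK N (w - b) := by
  have h1 : (1 / 2 : ℝ) ^ J ≤ (1 / 2) ^ j := pow_le_pow_of_le_one (by norm_num) (by norm_num) hjJ.le
  have h2 : (1 / 2 : ℝ) ^ j ≤ 1 / 64 :=
    (pow_le_pow_of_le_one (by norm_num) (by norm_num) h6).trans (by norm_num)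
  have hβ : (0 : ℝ) < (1 / 2) ^ j := by positivity
  have x1 : dist x.1 z.1 < (1 / 2) ^ j / 30 := hx.2.1
  have x2 := hx.2.2.1
  have x3 := hx.2.2.2
  rw [pow_succ (1 / 2 : ℝ) j] at x3
  have b1 : dist b.1 x.1 < ε := hb.1
  have b2 := hb.2.1
  have b3 := hb.2.2
  have w1 : dist w.1 z.1 < δ := hw.1
  have w2 := hw.2.1
  have w3 := hw.2.2
  set β : ℝ := (1 / 2) ^ j
  have hδβ : δ ≤ β / 100 := by rw [hδ]; linarith
  have hδ0 : 0 < δ := hε.trans_le hεδ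
  have hd2 : δ ^ 2 ≤ β ^ 2 / 10000 := by
    calc δ ^ 2 ≤ (β / 100) ^ 2 := by gcongr
      _ = _ := by ring
  have he2 : ε ^ 2 ≤ β ^ 2 / 10000 := le_trans (by gcongr) hd2
  have hβ2 : 0 < β ^ 2 := by positivity
  refine heatK_lower (s := w.2 - b.2) (y := w.1 - b.1) hβ h2 ?_ ?_ ?_
  · nlinarith
  · nlinarith
  · rw [← dist_eq_norm]
    have t1 := dist_triangle w.1 z.1 b.1
    have t2 := dist_triangle z.1 x.1 b.1
    rw [dist_comm z.1 x.1, dist_comm x.1 b.1] at t2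
    linarith

lemma sum_sigma_indicator_le {ι' : Type*} {s : Finset ι'} {X : ι' → Finset (PSpace N)}
    {a : ι' → PSpace N → ℝ} (κ : ℝ) (E : Set (PSpace N)) :
    ∑ i ∈ s.sigma X, ((fun i : (_ : ι') × PSpace N => i.2) ⁻¹' E).indicator
        (fun i => κ * a i.1 i.2) i
      = κ * ∑ j ∈ s, ∑ x ∈ X j, E.indicator (a j) x := by
  rw [Finset.sum_sigma, Finset.mul_sum]
  refine Finset.sum_congr rfl fun j _ => ?_
  rw [Finset.mul_sum]
  refine Finset.sum_congr rfl fun x _ => ?_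
  by_cases h : x ∈ E
  · rw [indicator_of_mem h, indicator_of_mem]
    exact h
  · rw [indicator_of_notMem h, indicator_of_notMem, mul_zero]
    exact h

/-- Subtracting the potential of the exponential turns a potential into a subsolution. -/
lemma exists_test_of_density {O : Set (PSpace N)} {f : PSpace N → ℝ} (hf : BM f)
    (h0 : ∀ z, 0 ≤ f z)
    (hs : ∀ k z, wpot N (slabW k) (fun z => ENNReal.ofReal (f z)) z ≤ ENNReal.ofReal (1 / 2))
    {η : ℝ} (hη : ∀ z, η ≤ infDist z Oᶜ → f z = 0) {w : PSpace N} {M : ℝ}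
    (hw : M + 17 ≤ pot N 1 f w) :
    ∃ (G v : PSpace N → ℝ) (A : ℝ), BM G ∧ (∀ z, v z = pot N 1 G z) ∧
      (∀ z, infDist z Oᶜ < η → G z ≤ A + phi (max (v z) 0)) ∧
      (∀ z, η ≤ infDist z Oᶜ → G z ≤ phi (max (v z) 0)) ∧ M ≤ v w := by
  set P := pot N 1 f
  have hP : BM P := hf.pot one_pos
  have hP0 : ∀ z, 0 ≤ P z := fun z => by
    have := le_pot one_pos hf h0 z
    rwa [zero_div] at this
  set e : PSpace N → ℝ := fun z => Real.exp (P z) - 1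
  have he : BM e := hP.comp (by fun_prop : Continuous fun x => Real.exp x - 1)
  have he0 : ∀ z, 0 ≤ e z := fun z => by
    have := Real.one_le_exp (hP0 z)
    simp only [e]
    linarith
  have hR0 : ∀ z, 0 ≤ pot N 1 e z := fun z => by
    have := le_pot one_pos he he0 z
    rwa [zero_div] at this
  have hv : ∀ z, pot N 1 (fun z => f z - e z) z = P z - pot N 1 e z := pot_sub one_pos hf he
  obtain ⟨A, hA⟩ := hf.2
  have key : ∀ z, f z - e z ≤ f z + phi (max (pot N 1 (fun z => f z - e z) z) 0) := by
    intro z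
    have h1 : max (pot N 1 (fun z => f z - e z) z) 0 ≤ P z :=
      max_le (by rw [hv]; linarith [hR0 z]) (hP0 z)
    have h2 : 0 ≤ max (pot N 1 (fun z => f z - e z) z) 0 := le_max_right _ _
    have h3 := Real.exp_le_exp.2 h1
    simp only [e, phi]
    simp only [e] at h2 h3
    linarith
  refine ⟨fun z => f z - e z, pot N 1 fun z => f z - e z, A, hf.sub he, fun z => rfl, ?_, ?_, ?_⟩
  · intro z _
    exact (key z).trans (by linarith [(le_abs_self _).trans (hA z)])
  · intro z hz
    have := key z
    have h1 := hη z hz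
    simp only [h1, zero_add] at this ⊢
    exact this
  · rw [hv]
    linarith [pot_exp_le hf h0 hs w]

lemma exists_test_near_boundary (hN : N ≠ 0) {O : Set (PSpace N)} {z : PSpace N}
    (h : ∫⁻ ρ in Ioo (0 : ℝ) 1, PHcap N 1 (Oᶜ ∩ (ball z.1 (ρ / 30) ×ˢ
      Ioo (z.2 - 30 * ρ ^ 2) (z.2 - ρ ^ 2))) / ENNReal.ofReal (ρ ^ (N + 1)) = ⊤) (M : ℝ) :
    ∃ δ > 0, ∀ w ∈ pQ N δ z, ∀ η > 0, ∃ (G v : PSpace N → ℝ) (A : ℝ), BM G ∧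
      (∀ z, v z = pot N 1 G z) ∧ (∀ z, infDist z Oᶜ < η → G z ≤ A + phi (max (v z) 0)) ∧
      (∀ z, η ≤ infDist z Oᶜ → G z ≤ phi (max (v z) 0)) ∧ M ≤ v w := by
  set lr := (lam N).toReal
  have hlr : 1 ≤ lr := by
    have := ENNReal.toReal_mono (lam_ne_top N) (one_le_lam N)
    simpa using this
  set C : ℝ := 2 * 24 ^ N + 4
  have hC : 0 < C := by positivity
  set κ : ℝ := 1 / (2 * (C * 2 ^ N * lr)) with hκ
  have hκ0 : 0 < κ := by positivity
  set σ : ℝ := (|M| + 17) * (2 * 280 ^ N) / (κ * Real.exp (-3)) with hσ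
  obtain ⟨J, hJ⟩ := exists_sum_Ico_ge (tsum_capE_eq_top O z h)
    (fun j => ENNReal.mul_ne_top (PHcap_ne_top hN (isBounded_capE O z j)) ENNReal.ofReal_ne_top) 6
    (S := ENNReal.ofReal σ) ENNReal.ofReal_ne_top
  have hJ0 : (0 : ℝ) < (1 / 2) ^ J := by positivity
  have hJ1 : (1 / 2 : ℝ) ^ J ≤ 1 := pow_le_one₀ (by norm_num) (by norm_num)
  set δ : ℝ := (1 / 2) ^ J / 100 with hδ
  have hδ0 : 0 < δ := by positivity
  refine ⟨δ, hδ0, fun w hw η hη => ?_⟩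
  set ε := min η δ
  have hε : 0 < ε := lt_min hη hδ0
  have hεδ : ε ≤ δ := min_le_right _ _
  choose X a hX ha hgr hcapX using fun j =>
    exists_frostman hN (isBounded_capE O z j) hε (by linarith)
  have hεJ : ε ≤ (1 / 2) ^ J := by linarith
  set S := (Finset.Ico 6 J).sigma X
  set p : (_ : ℕ) × PSpace N → PSpace N := fun i => i.2
  set q : (_ : ℕ) × PSpace N → ℝ := fun i => κ * a i.1 i.2
  have hq : ∀ i, 0 ≤ q i := fun i => mul_nonneg hκ0.le (ha _ _)
  have hgrq : ∀ y r, ε ≤ r → ∑ i ∈ S, (p ⁻¹' pQt N r y).indicator q i ≤ κ * C * r ^ N := by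
    intro y r hr
    rw [sum_sigma_indicator_le κ (pQt N r y), mul_assoc]
    exact mul_le_mul_of_nonneg_left (growth_le hN hε hX hεJ ha hgr y hr) hκ0.le
  have htot : ∑ i ∈ S, q i ≤ κ * C := by
    have h1 := hgrq z 1 (by linarith)
    rw [one_pow, mul_one] at h1
    refine le_trans (le_of_eq (Finset.sum_congr rfl fun i hi => ?_)) h1
    rw [indicator_of_mem]
    obtain ⟨hi1, hi2⟩ := Finset.mem_sigma.1 hi
    have h3 := mem_pQt.1 (capE_subset_pQt O z i.1 (hX i.1 hi2))
    have h2 : (1 / 2 : ℝ) ^ i.1 ≤ (1 / 2) ^ 6 :=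
      pow_le_pow_of_le_one (by norm_num) (by norm_num) (Finset.mem_Ico.1 hi1).1
    refine mem_pQt.2 (h3.trans ?_)
    norm_num at h2 ⊢
    linarith
  refine exists_test_of_density (f := spread ε S p q) (bm_spread hε hq) (spread_nonneg hε hq)
    (fun k y => ?_) (fun y hy => ?_) ?_
  · refine (wpot_slab_le (g := ENNReal.ofReal (κ * C * 2 ^ N)) measurable_spread.ennreal_ofReal
      (fun y r hr => ?_) ?_ k y).trans (le_of_eq ?_)
    · rw [← ENNReal.ofReal_mul (by positivity)]
      exact lintegral_spread_pQt_le hε hq hgrq y hr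
    · rw [lintegral_spread_total hε hq]
      refine ENNReal.ofReal_le_ofReal (htot.trans ?_)
      exact le_mul_of_one_le_right (by positivity) (one_le_pow₀ (by norm_num))
    · rw [← ENNReal.ofReal_toReal (lam_ne_top N), ← ENNReal.ofReal_mul (by positivity)]
      congr 1
      change κ * C * 2 ^ N * lr = 1 / 2
      rw [hκ]
      field_simp
  · refine spread_eq_zero fun i hi hyi => ?_
    obtain ⟨hi1, hi2⟩ := Finset.mem_sigma.1 hi
    have h1 : infDist y Oᶜ ≤ dist y i.2 := infDist_le_dist_of_mem (hX i.1 hi2).1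
    have h2 : dist y i.2 < ε := by
      rw [Prod.dist_eq, max_lt_iff]
      refine ⟨hyi.1, ?_⟩
      rw [Real.dist_eq, abs_lt]
      have h3 := hyi.2.1
      have h4 := hyi.2.2
      have h5 : ε ^ 2 ≤ ε := by nlinarith
      constructor <;> simp only [p] at h3 h4 <;> linarith
    have h3 : ε ≤ η := min_le_left _ _
    linarith
  · refine le_trans ?_ (le_pot_spread (p := p) hε hq w
      (L := fun i => Real.exp (-3) * (20 * (1 / 2) ^ i.1)⁻¹ ^ N) (fun i => by positivity)
      fun i hi b hb => ?_)
    · have hS : ENNReal.ofReal σ ≤ ENNReal.ofReal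
          (∑ j ∈ Finset.Ico 6 J, ∑ x ∈ X j, 2 * 280 ^ N * ((20 * (1 / 2) ^ j)⁻¹ ^ N * a j x)) := by
        refine hJ.trans ?_
        rw [ENNReal.ofReal_sum_of_nonneg fun j _ => Finset.sum_nonneg fun x _ =>
          mul_nonneg (by positivity) (mul_nonneg (by positivity) (ha j x))]
        refine Finset.sum_le_sum fun j _ => ?_
        refine (mul_le_mul_left (hcapX j) _).trans (le_of_eq ?_)
        rw [← ENNReal.ofReal_mul (mul_nonneg (by positivity) (Finset.sum_nonneg fun x _ => ha j x))]
        congr 1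
        rw [← Finset.mul_sum, ← Finset.mul_sum]
        have e : (2 * 7 ^ N : ℝ) * (2 ^ (j + 1)) ^ N = 2 * 280 ^ N * (20 * (1 / 2) ^ j)⁻¹ ^ N := by
          rw [mul_assoc, mul_assoc, ← mul_pow, ← mul_pow]
          congr 2
          rw [mul_inv, ← inv_pow, pow_succ]
          norm_num
          ring
        linear_combination (∑ x ∈ X j, a j x) * e
      have hS2 := (ENNReal.ofReal_le_ofReal_iff (Finset.sum_nonneg fun j _ =>
        Finset.sum_nonneg fun x _ =>
          mul_nonneg (by positivity) (mul_nonneg (by positivity) (ha j x)))).1 hS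
      rw [Finset.sum_sigma]
      have e : ∑ j ∈ Finset.Ico 6 J, ∑ x ∈ X j,
          Real.exp (-3) * (20 * (1 / 2) ^ j)⁻¹ ^ N * (κ * a j x)
          = κ * Real.exp (-3) / (2 * 280 ^ N) * ∑ j ∈ Finset.Ico 6 J, ∑ x ∈ X j,
            2 * 280 ^ N * ((20 * (1 / 2) ^ j)⁻¹ ^ N * a j x) := by
        rw [Finset.mul_sum]
        refine Finset.sum_congr rfl fun j _ => ?_
        rw [Finset.mul_sum]
        refine Finset.sum_congr rfl fun x _ => ?_
        field_simp
      refine le_trans ?_ (le_of_eq e.symm)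
      refine le_trans ?_ (mul_le_mul_of_nonneg_left hS2 (by positivity))
      have e2 : κ * Real.exp (-3) / (2 * 280 ^ N) * σ = |M| + 17 := by
        rw [hσ]
        have := Real.exp_pos (-3)
        field_simp
      rw [e2]
      linarith [le_abs_self M]
    · obtain ⟨hi1, hi2⟩ := Finset.mem_sigma.1 hi
      rw [Finset.mem_Ico] at hi1
      exact kernel_capE hi1.1 hi1.2 hδ hεδ hε hw (hX i.1 hi2) hb

end boundary

end LargeSolution

/-- **Theorem 1.2.** Wiener-type sufficient condition, in terms of the parabolic
Hausdorff capacity `PH_1^N`, for existence of a large solution of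
`∂_t u - Δu + e^u - 1 = 0` in a bounded open set `O ⊆ ℝ^{N+1}`. -/
theorem hausdorff_wiener_test_implies_large_solution_exp
    (N : ℕ) (hN : 2 ≤ N)
    (O : Set (PSpace N)) (hO : IsOpen O) (hOb : Bornology.IsBounded O)
    (hcap : ∀ z ∈ pBoundary N O,
      ∫⁻ ρ in Ioo (0 : ℝ) 1,
        PHcap N 1 (Oᶜ ∩ (ball z.1 (ρ / 30) ×ˢ Ioo (z.2 - 30 * ρ ^ 2) (z.2 - ρ ^ 2))) /
          ENNReal.ofReal (ρ ^ (N + 1)) = ⊤) :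
    ∃ u : PSpace N → ℝ, IsLargeSolution O (fun s => Real.exp s - 1) u := by
  have hne : Oᶜ.Nonempty := by
    rw [nonempty_compl]
    rintro rfl
    exact NormedSpace.unbounded_univ ℝ (PSpace N) hOb
  obtain ⟨h1, h2⟩ := isC21_of_locSol fun z hz => locSol_bigSol hO hne hz
  refine ⟨bigSol O, h1, h2, fun z hz M => ?_⟩
  obtain ⟨δ, hδ, h⟩ := exists_test_near_boundary (by omega) (hcap z hz) M
  exact ⟨δ, hδ, fun w hw => le_bigSol hO hne hw.1 (h w hw.2)⟩
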